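/- Suppose m < (d−1)/2 (so d ≥ 4) and (d−1)/2 < α < d/2 + 1. Then for every β with 0 < β < α/2 + d/4 − 1/2 there exists a constant C_β such that for every μ ∈ M_d and every R > 1, ∫_{B^{d−1}(0,1)} |μ̂(R(ξ, ⟨Mξ,ξ⟩))|² √(1+4|ξ|²) dξ ≤ C_β · R^{−β} · I_α(μ). (Equivalently, β(α, H_m^{d−1}) ≥ α/2 + d/4 − 1/2 on this range.) -/

import Mathlib

open MeasureTheory Metric
open scoped ENNReal NNReal

noncomputable section

/-- The quadratic form `⟨Mξ, ξ⟩` on `ℝ^{d-1}`, where the diagonal matrix `M` has its first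
`d-1-m` diagonal entries equal to `+1` and its last `m` diagonal entries equal to `-1`. -/
def hypQ (d m : ℕ) (ξ : EuclideanSpace ℝ (Fin (d - 1))) : ℝ :=
  ∑ i : Fin (d - 1), (if (i : ℕ) < d - 1 - m then (1 : ℝ) else -1) * ξ i ^ 2

/-- The point `(ξ, ⟨Mξ, ξ⟩) ∈ ℝ^d` on the hyperbolic paraboloid. -/
def hypLift (d m : ℕ) (ξ : EuclideanSpace ℝ (Fin (d - 1))) : EuclideanSpace ℝ (Fin d) :=
  (EuclideanSpace.equiv (Fin d) ℝ).symm
    (fun i => if h : (i : ℕ) < d - 1 then ξ ⟨i, h⟩ else hypQ d m ξ)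

/-- The Fourier transform `μ̂(ζ) = ∫ e^{-i x·ζ} dμ(x)` of a measure on `ℝ^d`. -/
def ftM {d : ℕ} (μ : Measure (EuclideanSpace ℝ (Fin d))) (ζ : EuclideanSpace ℝ (Fin d)) : ℂ :=
  ∫ x, Complex.exp (-(Complex.I * (((∑ i, x i * ζ i) : ℝ) : ℂ))) ∂μ

/-- The `α`-dimensional energy `I_α(μ) = ∬ |x-y|^{-α} dμ(x) dμ(y)`. -/
def energy {d : ℕ} (α : ℝ) (μ : Measure (EuclideanSpace ℝ (Fin d))) : ℝ≥0∞ :=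
  ∫⁻ x, ∫⁻ y, ENNReal.ofReal (dist x y) ^ (-α) ∂μ ∂μ

/-- The hyperbolic average `∫_{B^{d-1}(0,1)} |μ̂(R(ξ,⟨Mξ,ξ⟩))|² √(1+4|ξ|²) dξ`. -/
def hypAvg (d m : ℕ) (μ : Measure (EuclideanSpace ℝ (Fin d))) (R : ℝ) : ℝ :=
  ∫ ξ in ball (0 : EuclideanSpace ℝ (Fin (d - 1))) 1,
    ‖ftM μ (R • hypLift d m ξ)‖ ^ 2 * Real.sqrt (1 + 4 * ‖ξ‖ ^ 2)

/-- The decay estimate `∫_H |μ̂(Rξ)|² dσ(ξ) ≤ C R^{-β} I_α(μ)` holds with some constant `C`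
uniformly over measures in `M_d` and all `R > 1`. -/
def decayBound (d m : ℕ) (α β : ℝ) : Prop :=
  ∃ C : ℝ, 0 < C ∧ ∀ μ : Measure (EuclideanSpace ℝ (Fin d)), IsFiniteMeasure μ →
    μ ((closedBall 0 1)ᶜ) = 0 → ∀ R : ℝ, 1 < R →
    ENNReal.ofReal (hypAvg d m μ R) ≤ ENNReal.ofReal (C * R ^ (-β)) * energy α μ

/-- The decay estimate with exponent `β` fails for every constant `C > 0`: there is a measure
in `M_d` with finite positive `α`-energy and an `R > 1` violating the estimate. -/
def decayFails (d m : ℕ) (α β : ℝ) : Prop :=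
  ∀ C : ℝ, 0 < C → ∃ μ : Measure (EuclideanSpace ℝ (Fin d)), IsFiniteMeasure μ ∧
    μ ((closedBall 0 1)ᶜ) = 0 ∧ 0 < energy α μ ∧ energy α μ ≠ ⊤ ∧
    ∃ R : ℝ, 1 < R ∧ C * R ^ (-β) * (energy α μ).toReal < hypAvg d m μ R

noncomputable section
open MeasureTheory Metric Set
open scoped ENNReal NNReal FourierTransform RealInnerProductSpace ContDiff

namespace HP
open ENNReal (ofReal ofReal_mul ofReal_le_ofReal ofReal_pow ofReal_one ofReal_ne_top ofReal_pos ofReal_add)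
set_option linter.unusedSectionVars false

def ee (x : ℝ) : ℂ := (𝐞 x : ℂ)

lemma ee_add (x y : ℝ) : ee (x + y) = ee x * ee y := by
  simp [ee, AddChar.map_add_eq_mul]
lemma ee_zero : ee 0 = 1 := by simp [ee]
lemma ee_eq (x : ℝ) : ee x = Complex.exp (2 * Real.pi * x * Complex.I) := by
  simp [ee, Real.fourierChar_apply]
lemma norm_ee (x : ℝ) : ‖ee x‖ = 1 := Circle.norm_coe _
lemma enorm_ee (x : ℝ) : ‖ee x‖ₑ = 1 := by
  rw [← ofReal_norm, norm_ee, ofReal_one]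
lemma conj_ee (x : ℝ) : (starRingEnd ℂ) (ee x) = ee (-x) := by
  rw [ee_eq, ee_eq, ← Complex.exp_conj]; simp [Complex.conj_ofNat]
lemma contDiff_ee : ContDiff ℝ ∞ ee := by
  have : ee = fun x : ℝ => Complex.exp (2 * Real.pi * x * Complex.I) := by ext; exact ee_eq _
  rw [this]
  have h : ContDiff ℝ ∞ (fun x : ℝ => (x : ℂ)) := Complex.ofRealCLM.contDiff
  fun_prop
@[fun_prop] lemma continuous_ee : Continuous ee := contDiff_ee.continuous
@[fun_prop] lemma measurable_ee : Measurable ee := continuous_ee.measurable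

variable {V : Type*} [NormedAddCommGroup V] [InnerProductSpace ℝ V] [FiniteDimensional ℝ V]
  [MeasurableSpace V] [BorelSpace V]

def nn {α : Type*} [MeasureSpace α] (f : α → ℂ) : ℝ≥0∞ := ∫⁻ x, ‖f x‖ₑ ^ 2

lemma memLp_two_of_nn {f : V → ℂ} (hf : Measurable f) (h : nn f ≠ ⊤) : MemLp f 2 volume := by
  refine ⟨hf.aestronglyMeasurable, ?_⟩
  rw [eLpNorm_eq_lintegral_rpow_enorm_toReal (by norm_num) (by norm_num)]
  refine ENNReal.rpow_lt_top_of_nonneg (by norm_num) ?_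
  simpa [nn] using h

lemma nn_eq_eLpNorm (f : V → ℂ) : nn f = eLpNorm f 2 volume ^ 2 := by
  rw [eLpNorm_eq_lintegral_rpow_enorm_toReal (by norm_num) (by norm_num), ← ENNReal.rpow_natCast,
    ← ENNReal.rpow_mul]
  simp [nn]

lemma plancherel_le {f : V → ℂ} (hf : Measurable f) (hi : Integrable f) :
    nn (𝓕 f) ≤ nn f := by
  by_cases h : nn f = ⊤
  · simp [h]
  have hL := memLp_two_of_nn hf h
  set F : Lp ℂ 2 (volume : Measure V) := hL.toLp f
  have key : 𝓕 f =ᵐ[volume] ((𝓕 F : Lp ℂ 2 (volume : Measure V)) : V → ℂ) := by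
    apply ae_eq_of_integral_contDiff_smul_eq
    · have : Continuous (𝓕 f) := VectorFourier.fourierIntegral_continuous Real.continuous_fourierChar
        (by exact continuous_inner) hi
      exact this.locallyIntegrable
    · exact (Lp.memLp _).locallyIntegrable (by norm_num)
    intro g hg hgc
    have hg' : ContDiff ℝ ∞ (fun x => (g x : ℂ)) := Complex.ofRealCLM.contDiff.comp hg
    have hgc' : HasCompactSupport (fun x => (g x : ℂ)) := hgc.comp_left (g := fun x : ℝ => (x : ℂ)) (by simp)
    set φ : SchwartzMap V ℂ := hgc'.toSchwartzMap hg'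
    have hφ : ∀ x, φ x = (g x : ℂ) := fun x => rfl
    have h1 : (Lp.toTemperedDistribution (𝓕 F : Lp ℂ 2 (volume : Measure V))) φ =
        (Lp.toTemperedDistribution F) (𝓕 φ) := by
      rw [← Lp.fourier_toTemperedDistribution_eq, TemperedDistribution.fourier_apply]
    rw [Lp.toTemperedDistribution_apply, Lp.toTemperedDistribution_apply] at h1
    have h2 : ∫ x, (𝓕 φ) x • F x = ∫ x, (𝓕 φ) x • f x := by
      refine integral_congr_ae ?_
      filter_upwards [hL.coeFn_toLp] with x hx
      rw [hx]
    have h3 : ∫ x, (𝓕 φ) x • f x = ∫ x, φ x • 𝓕 f x := by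
      have := VectorFourier.integral_fourierIntegral_smul_eq_flip (μ := (volume : Measure V))
        (ν := (volume : Measure V)) (L := innerₗ V)
        Real.continuous_fourierChar (by exact continuous_inner) (SchwartzMap.integrable φ) hi
      rw [flip_innerₗ] at this
      exact this
    have h4 : ∀ u : V → ℂ, ∫ x, g x • u x = ∫ x, φ x • u x := fun u => by
      congr 1
    rw [h4, h4, h1, h2, h3]
  calc nn (𝓕 f) = nn ((𝓕 F : Lp ℂ 2 (volume : Measure V)) : V → ℂ) := by
        refine lintegral_congr_ae ?_
        filter_upwards [key] with x hx
        rw [hx]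
    _ = nn (F : V → ℂ) := by
        rw [nn_eq_eLpNorm, nn_eq_eLpNorm]
        have := Lp.norm_fourier_eq F
        rw [Lp.norm_def, Lp.norm_def, ENNReal.toReal_eq_toReal_iff' (Lp.eLpNorm_ne_top _) (Lp.eLpNorm_ne_top _)] at this
        rw [this]
    _ ≤ nn f := by
        refine (lintegral_congr_ae ?_).le
        filter_upwards [hL.coeFn_toLp] with x hx
        rw [hx]

variable (M : V ≃ₗᵢ[ℝ] V)

def QQ (ξ : V) : ℝ := ⟪M ξ, ξ⟫

@[fun_prop] lemma continuous_QQ : Continuous (QQ M) := by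
  unfold QQ; exact (M.continuous).inner continuous_id

lemma contDiff_QQ : ContDiff ℝ ∞ (QQ M) := by
  unfold QQ; exact (M.contDiff).inner ℝ contDiff_id

@[fun_prop] lemma measurable_QQ : Measurable (QQ M) := (continuous_QQ M).measurable

def ph (p : V × ℝ) (ξ : V) : ℝ := ⟪p.1, ξ⟫ + p.2 * QQ M ξ

@[fun_prop] lemma continuous_ph : Continuous (fun q : (V × ℝ) × V => ph M q.1 q.2) := by
  unfold ph; fun_prop

def EE (f : V → ℂ) (p : V × ℝ) : ℂ := ∫ ξ, f ξ * ee (ph M p ξ)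

lemma EE_eq_fourier (f : V → ℂ) (y : V) (t : ℝ) :
    EE M f (y, t) = 𝓕 (fun ξ => f ξ * ee (t * QQ M ξ)) (-y) := by
  rw [EE, Real.fourier_eq]
  congr 1; ext ξ
  rw [Circle.smul_def]
  change _ = ee _ • _
  simp only [ph, ee_add, smul_eq_mul, inner_neg_right, neg_neg, real_inner_comm]
  ring

lemma measurable_EE {f : V → ℂ} (hf : Measurable f) : Measurable (EE M f) := by
  have : StronglyMeasurable (fun q : (V × ℝ) × V => f q.2 * ee (ph M q.1 q.2)) := by
    apply Measurable.stronglyMeasurable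
    exact (hf.comp measurable_snd).mul (measurable_ee.comp (continuous_ph M).measurable)
  exact this.integral_prod_right.measurable

lemma lintegral_neg_V {f : V → ℝ≥0∞} : ∫⁻ y, f (-y) = ∫⁻ y, f y :=
  (Measure.measurePreserving_neg (volume : Measure V)).lintegral_comp_emb
    (MeasurableEquiv.neg V).measurableEmbedding f

lemma EE_plancherel {f : V → ℂ} (hf : Measurable f) (hi : Integrable f) (t : ℝ) :
    ∫⁻ y, ‖EE M f (y, t)‖ₑ ^ 2 ≤ nn f := by
  simp_rw [EE_eq_fourier]
  rw [lintegral_neg_V (f := fun y => ‖𝓕 (fun ξ => f ξ * ee (t * QQ M ξ)) y‖ₑ ^ 2)]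
  refine (plancherel_le (by fun_prop) ?_).trans_eq ?_
  · refine hi.mono (by fun_prop) ?_
    simp [norm_ee]
  · simp [nn, enorm_mul, enorm_ee]

end HP
end

noncomputable section
open MeasureTheory Metric Set
open scoped ENNReal NNReal FourierTransform RealInnerProductSpace ContDiff

namespace HP
open ENNReal (ofReal ofReal_mul ofReal_le_ofReal ofReal_pow ofReal_one ofReal_ne_top ofReal_pos ofReal_add)
set_option linter.unusedSectionVars false
variable {V : Type*} [NormedAddCommGroup V] [InnerProductSpace ℝ V] [FiniteDimensional ℝ V]
  [MeasurableSpace V] [BorelSpace V]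

def ww (N : ℕ) (v : V) : ℝ≥0∞ := ofReal (((1 + ‖v‖ ^ 2) ^ N)⁻¹)

@[fun_prop] lemma continuous_ww (N : ℕ) : Continuous (ww N : V → ℝ≥0∞) := by
  unfold ww
  refine ENNReal.continuous_ofReal.comp (Continuous.inv₀ (by fun_prop) (fun v => by positivity))
@[fun_prop] lemma measurable_ww (N : ℕ) : Measurable (ww N : V → ℝ≥0∞) :=
  (continuous_ww N).measurable
@[fun_prop] lemma measurable_ww_comp {α : Type*} [MeasurableSpace α] (N : ℕ) {f : α → V}
    (hf : Measurable f) : Measurable (fun a => ww N (f a)) := (measurable_ww N).comp hf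

lemma ww_pos (N : ℕ) (v : V) : 0 < ww N v := by unfold ww; rw [ofReal_pos]; positivity
lemma ww_ne_top (N : ℕ) (v : V) : ww N v ≠ ⊤ := ofReal_ne_top
lemma ww_le_one (N : ℕ) (v : V) : ww N v ≤ 1 := by
  unfold ww; rw [ENNReal.ofReal_le_one]
  exact inv_le_one_of_one_le₀ (one_le_pow₀ (by nlinarith [sq_nonneg ‖v‖]))
lemma ww_neg (N : ℕ) (v : V) : ww N (-v) = ww N v := by simp [ww]
lemma ww_add (N K : ℕ) (v : V) : ww (N + K) v = ww N v * ww K v := by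
  unfold ww; rw [← ofReal_mul (by positivity), pow_add, mul_inv]
lemma ww_anti {N K : ℕ} (h : N ≤ K) (v : V) : ww K v ≤ ww N v := by
  obtain ⟨j, rfl⟩ := Nat.exists_eq_add_of_le h
  rw [ww_add]; exact mul_le_of_le_one_right' (ww_le_one _ _)

lemma ww_le_of {N : ℕ} {a b : V} {c : ℝ} (hc : 0 ≤ c) (h : 1 + ‖b‖ ^ 2 ≤ c * (1 + ‖a‖ ^ 2)) :
    ww N a ≤ ofReal (c ^ N) * ww N b := by
  unfold ww
  rw [← ofReal_mul (by positivity)]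
  apply ofReal_le_ofReal
  rw [← div_eq_mul_inv, le_div_iff₀ (by positivity), inv_mul_le_iff₀ (by positivity), ← mul_pow]
  rw [mul_comm c] at h
  gcongr

lemma peetre (N : ℕ) (a b : V) :
    ww N a ≤ ofReal ((2 * (1 + ‖b‖ ^ 2)) ^ N) * ww N (a + b) := by
  apply ww_le_of (by positivity)
  have h := norm_add_le a b
  have h2 : ‖a + b‖ ^ 2 ≤ (‖a‖ + ‖b‖) ^ 2 := by gcongr
  nlinarith [sq_nonneg (‖a‖ - ‖b‖), mul_nonneg (sq_nonneg ‖a‖) (sq_nonneg ‖b‖)]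

lemma ww_int_lt_top {N : ℕ} (hN : Module.finrank ℝ V < 2 * N) : ∫⁻ v : V, ww N v < ⊤ := by
  have h := integrable_rpow_neg_one_add_norm_sq (E := V) (μ := volume) (r := 2 * N)
    (by exact_mod_cast hN)
  have h2 := h.lintegral_lt_top
  refine lt_of_le_of_lt (le_of_eq ?_) h2
  congr 1; ext v; unfold ww; congr 1
  rw [show (-(2 * (N : ℝ)) / 2) = -(N : ℝ) by ring, Real.rpow_neg (by positivity), Real.rpow_natCast]

variable (M : V ≃ₗᵢ[ℝ] V)

lemma norm_EE_le (h : V → ℂ) (p : V × ℝ) : ‖EE M h p‖ ≤ ∫ u, ‖h u‖ := by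
  refine (norm_integral_le_integral_norm _).trans_eq ?_
  simp [norm_ee]

lemma enorm_EE_le (h : V → ℂ) (p : V × ℝ) : ‖EE M h p‖ₑ ≤ ∫⁻ u, ‖h u‖ₑ := by
  refine (enorm_integral_le_lintegral_enorm _).trans_eq ?_
  simp [enorm_mul, enorm_ee]

lemma ibp (h : V → ℂ) (hs : ContDiff ℝ ∞ h) (hc : HasCompactSupport h) (b : V) (v : V) (τ : ℝ) :
    (⟪v, b⟫ : ℂ) * EE M h (v, τ) =
      EE M (fun u => (Complex.I / (2 * Real.pi)) * fderiv ℝ h u b) (v, τ)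
        + τ * EE M (fun u => (-(fderiv ℝ (QQ M) u b : ℝ) : ℂ) * h u) (v, τ) := by
  have hQ := contDiff_QQ M
  have hQd : Differentiable ℝ (QQ M) := hQ.differentiable (by simp)
  have hhd : Differentiable ℝ h := hs.differentiable (by simp)
  have hfd : ContDiff ℝ ∞ (fun u => fderiv ℝ h u b) :=
    (hs.fderiv_right (m := ∞) (by simp)).clm_apply contDiff_const
  have hfc : HasCompactSupport (fun u => fderiv ℝ h u b) := hc.fderiv_apply ℝ b
  have hQc : Continuous (fun u => fderiv ℝ (QQ M) u b) :=
    ((hQ.fderiv_right (m := ∞) (by simp)).clm_apply contDiff_const).continuous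
  set e : V → ℂ := fun u => ee (ph M (v, τ) u) with he
  have hph : ∀ u, HasFDerivAt (ph M (v, τ)) (innerSL ℝ v + τ • fderiv ℝ (QQ M) u) u := by
    intro u
    exact ((innerSL ℝ v).hasFDerivAt).add ((hQd u).hasFDerivAt.const_mul τ)
  have hee : ∀ x, HasDerivAt ee (2 * Real.pi * Complex.I * ee x) x := by
    intro x
    have h1 : HasDerivAt (fun x : ℝ => Complex.exp (2 * Real.pi * x * Complex.I))
        (Complex.exp (2 * Real.pi * x * Complex.I) * (2 * Real.pi * 1 * Complex.I)) x := by
      have : HasDerivAt (fun x : ℝ => (2 * Real.pi * (x:ℂ) * Complex.I)) (2 * Real.pi * 1 * Complex.I) x :=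
        ((Complex.ofRealCLM.hasDerivAt (x := x)).const_mul _).mul_const _
      exact this.cexp
    have : ee = fun x : ℝ => Complex.exp (2 * Real.pi * x * Complex.I) := by ext; exact ee_eq _
    rw [this]; convert h1 using 1; ring
  have hed : ∀ u, HasFDerivAt e ((innerSL ℝ v + τ • fderiv ℝ (QQ M) u).smulRight
      (2 * Real.pi * Complex.I * ee (ph M (v, τ) u))) u := fun u => by
    have := (hee (ph M (v, τ) u)).hasFDerivAt.comp u (hph u)
    refine this.congr_fderiv ?_
    ext x; simp; ring
  have hev : ∀ u, fderiv ℝ e u b = (⟪v, b⟫ + τ * fderiv ℝ (QQ M) u b : ℝ) *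
      (2 * Real.pi * Complex.I * e u) := fun u => by
    rw [(hed u).fderiv]; simp [he]
  have hec : Continuous e := by rw [he]; unfold ph; fun_prop
  have I : ∀ {k : V → ℂ}, Continuous k → HasCompactSupport k → Integrable (fun u => k u * e u) :=
    fun hk hkc => (hk.mul hec).integrable_of_hasCompactSupport hkc.mul_right
  have hhQ : HasCompactSupport (fun u => (-(fderiv ℝ (QQ M) u b : ℝ) : ℂ) * h u) := hc.mul_left
  have hhc := hs.continuous
  have key := integral_mul_fderiv_eq_neg_fderiv_mul_of_integrable (μ := (volume : Measure V))
    (f := h) (g := e) (v := b) (I hfd.continuous hfc)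
    (by simp_rw [hev]
        exact (hhc.mul (by fun_prop)).integrable_of_hasCompactSupport hc.mul_right)
    (I hhc hc) (fun x _ => hhd x) (fun x _ => (hed x).differentiableAt)
  simp_rw [hev] at key
  unfold EE
  have e1 : (τ : ℂ) * ∫ ξ, (-(fderiv ℝ (QQ M) ξ b : ℝ) : ℂ) * h ξ * ee (ph M (v, τ) ξ) =
    ∫ ξ, -((τ * fderiv ℝ (QQ M) ξ b : ℝ) : ℂ) * h ξ * e ξ := by
    rw [← integral_const_mul]; congr 1; ext ξ; push_cast; ring
  have e2 : ∫ ξ, Complex.I / (2 * Real.pi) * fderiv ℝ h ξ b * ee (ph M (v, τ) ξ) =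
    Complex.I / (2 * Real.pi) * ∫ ξ, fderiv ℝ h ξ b * e ξ := by
    rw [← integral_const_mul]; congr 1; ext ξ; simp only [he]; ring
  have hpi : (Real.pi : ℂ) ≠ 0 := by exact_mod_cast Real.pi_ne_zero
  rw [e1, e2, ← neg_eq_iff_eq_neg.mpr key, ← integral_neg, ← integral_const_mul, ← integral_const_mul, ← integral_add]
  · congr 1; ext ξ
    simp only [he]; push_cast
    field_simp
    rw [Complex.I_sq]; ring
  · refine Integrable.const_mul (Integrable.neg ?_) _
    exact (hhc.mul (by fun_prop)).integrable_of_hasCompactSupport hc.mul_right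
  · simp_rw [mul_assoc]
    refine ((Continuous.mul (by fun_prop) (hhc.mul hec))).integrable_of_hasCompactSupport ?_
    exact (hc.mul_right).mul_left

lemma EE_decay_real (N : ℕ) : ∀ h : V → ℂ, ContDiff ℝ ∞ h → HasCompactSupport h →
    ∃ C : ℝ, 0 ≤ C ∧ ∀ v τ, (1 + ‖v‖ ^ 2) ^ N * ‖EE M h (v, τ)‖ ≤ C * (1 + |τ|) ^ (2 * N) := by
  have hQ := contDiff_QQ M
  have A : ∀ (h : V → ℂ), ContDiff ℝ ∞ h → HasCompactSupport h → ∀ b,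
      ContDiff ℝ ∞ (fun u => (Complex.I / (2 * Real.pi)) * fderiv ℝ h u b) ∧
      HasCompactSupport (fun u => (Complex.I / (2 * Real.pi)) * fderiv ℝ h u b) := fun h hs hc b =>
    ⟨contDiff_const.mul ((hs.fderiv_right (m := ∞) (by simp)).clm_apply contDiff_const),
      (hc.fderiv_apply ℝ b).mul_left⟩
  have B : ∀ (h : V → ℂ), ContDiff ℝ ∞ h → HasCompactSupport h → ∀ b,
      ContDiff ℝ ∞ (fun u => (-(fderiv ℝ (QQ M) u b : ℝ) : ℂ) * h u) ∧
      HasCompactSupport (fun u => (-(fderiv ℝ (QQ M) u b : ℝ) : ℂ) * h u) := fun h hs hc b =>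
    ⟨((Complex.ofRealCLM.contDiff.comp
      ((hQ.fderiv_right (m := ∞) (by simp)).clm_apply contDiff_const)).neg).mul hs, hc.mul_left⟩
  induction N with
  | zero =>
    intro h hs hc
    refine ⟨∫ u, ‖h u‖, by positivity, fun v τ => ?_⟩
    simpa using norm_EE_le M h (v, τ)
  | succ N ih =>
    intro h hs hc
    set b := stdOrthonormalBasis ℝ V
    obtain ⟨C0, hC0, H0⟩ := ih h hs hc
    have gain : ∀ i, ∃ C : ℝ, 0 ≤ C ∧ ∀ v τ,
        (1 + ‖v‖ ^ 2) ^ N * (⟪v, b i⟫ ^ 2 * ‖EE M h (v, τ)‖) ≤ C * (1 + |τ|) ^ (2 * (N + 1)) := by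
      intro i
      obtain ⟨hA, hAc⟩ := A h hs hc (b i)
      obtain ⟨hB, hBc⟩ := B h hs hc (b i)
      obtain ⟨c1, h1, H1⟩ := ih _ (A _ hA hAc (b i)).1 (A _ hA hAc (b i)).2
      obtain ⟨c2, h2, H2⟩ := ih _ (B _ hA hAc (b i)).1 (B _ hA hAc (b i)).2
      obtain ⟨c3, h3, H3⟩ := ih _ (A _ hB hBc (b i)).1 (A _ hB hBc (b i)).2
      obtain ⟨c4, h4, H4⟩ := ih _ (B _ hB hBc (b i)).1 (B _ hB hBc (b i)).2
      refine ⟨c1 + c2 + c3 + c4, by positivity, fun v τ => ?_⟩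
      have e0 := ibp M h hs hc (b i) v τ
      have e1 := ibp M _ hA hAc (b i) v τ
      have e2 := ibp M _ hB hBc (b i) v τ
      replace H1 := H1 v τ
      replace H2 := H2 v τ
      replace H3 := H3 v τ
      replace H4 := H4 v τ
      set X1 := EE M (fun u => Complex.I / (2 * ↑Real.pi) * (fderiv ℝ (fun u => Complex.I / (2 * ↑Real.pi) * (fderiv ℝ h u) (b i)) u) (b i)) (v, τ)
      set X2 := EE M (fun u => (-(fderiv ℝ (QQ M) u (b i) : ℝ) : ℂ) * (Complex.I / (2 * ↑Real.pi) * (fderiv ℝ h u) (b i))) (v, τ)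
      set X3 := EE M (fun u => Complex.I / (2 * ↑Real.pi) * (fderiv ℝ (fun u => (-(fderiv ℝ (QQ M) u (b i) : ℝ) : ℂ) * h u) u) (b i)) (v, τ)
      set X4 := EE M (fun u => (-(fderiv ℝ (QQ M) u (b i) : ℝ) : ℂ) * ((-(fderiv ℝ (QQ M) u (b i) : ℝ) : ℂ) * h u)) (v, τ)
      have e3 : ((⟪v, b i⟫ : ℝ) : ℂ) ^ 2 * EE M h (v, τ) = X1 + τ * X2 + τ * (X3 + τ * X4) := by
        rw [sq, mul_assoc, e0, mul_add, e1, mul_left_comm, e2]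
      have e4 : ⟪v, b i⟫ ^ 2 * ‖EE M h (v, τ)‖ ≤ ‖X1‖ + |τ| * ‖X2‖ + |τ| * (‖X3‖ + |τ| * ‖X4‖) := by
        have : ⟪v, b i⟫ ^ 2 * ‖EE M h (v, τ)‖ = ‖((⟪v, b i⟫ : ℝ) : ℂ) ^ 2 * EE M h (v, τ)‖ := by
          simp
        rw [this, e3]
        have ht : ‖(τ : ℂ)‖ = |τ| := by simp
        refine (norm_add_le _ _).trans (add_le_add ((norm_add_le _ _).trans ?_) ?_)
        · rw [norm_mul, ht]
        · rw [norm_mul, ht]; gcongr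
          refine (norm_add_le _ _).trans ?_
          rw [norm_mul, ht]
      have hτ := abs_nonneg τ
      have hP : 0 ≤ (1 + ‖v‖ ^ 2) ^ N := by positivity
      set P := (1 + ‖v‖ ^ 2) ^ N
      have hT : (1 + |τ|) ^ (2 * (N + 1)) = (1 + |τ|) ^ (2 * N) * (1 + |τ|) ^ 2 := by ring
      set T := (1 + |τ|) ^ (2 * N)
      have hT0 : 0 ≤ T := by positivity
      rw [hT]
      calc P * (⟪v, b i⟫ ^ 2 * ‖EE M h (v, τ)‖) ≤ P * (‖X1‖ + |τ| * ‖X2‖ + |τ| * (‖X3‖ + |τ| * ‖X4‖)) := by gcongr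
        _ = P * ‖X1‖ + |τ| * (P * ‖X2‖) + |τ| * (P * ‖X3‖) + |τ| ^ 2 * (P * ‖X4‖) := by ring
        _ ≤ c1 * T + |τ| * (c2 * T) + |τ| * (c3 * T) + |τ| ^ 2 * (c4 * T) := by gcongr
        _ ≤ (1 + |τ|) ^ 2 * (c1 * T) + (1 + |τ|) ^ 2 * (c2 * T) + (1 + |τ|) ^ 2 * (c3 * T) + (1 + |τ|) ^ 2 * (c4 * T) := by
          have k0 : 1 ≤ (1 + |τ|) ^ 2 := by nlinarith
          have k1 : |τ| ≤ (1 + |τ|) ^ 2 := by nlinarith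
          have k2 : |τ| ^ 2 ≤ (1 + |τ|) ^ 2 := by nlinarith
          have k3 := le_mul_of_one_le_left (mul_nonneg h1 hT0) k0
          gcongr
        _ = _ := by ring
    choose C hC H using gain
    refine ⟨C0 + ∑ i, C i, add_nonneg hC0 (Finset.sum_nonneg fun i _ => hC i), fun v τ => ?_⟩
    have hv : ‖v‖ ^ 2 = ∑ i, ⟪v, b i⟫ ^ 2 := by
      have := b.sum_sq_norm_inner_right v
      rw [← this]; simp [real_inner_comm]
    have hz := H0 v τ
    calc (1 + ‖v‖ ^ 2) ^ (N + 1) * ‖EE M h (v, τ)‖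
        = (1 + ‖v‖ ^ 2) ^ N * ‖EE M h (v, τ)‖ + ∑ i, (1 + ‖v‖ ^ 2) ^ N * (⟪v, b i⟫ ^ 2 * ‖EE M h (v, τ)‖) := by
          rw [← Finset.mul_sum, ← Finset.sum_mul, ← hv]; ring
      _ ≤ C0 * (1 + |τ|) ^ (2 * (N + 1)) + ∑ i, C i * (1 + |τ|) ^ (2 * (N + 1)) := by
          refine add_le_add (hz.trans ?_) (Finset.sum_le_sum fun i _ => H i v τ)
          gcongr
          · linarith [abs_nonneg τ]
          · omega
      _ = _ := by rw [← Finset.sum_mul]; ring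

lemma EE_decay (N : ℕ) {h : V → ℂ} (hs : ContDiff ℝ ∞ h) (hc : HasCompactSupport h) :
    ∃ C : ℝ, 0 < C ∧ ∀ v τ, ‖EE M h (v, τ)‖ₑ ≤ ofReal (C * (1 + |τ|) ^ (2 * N)) * ww N v := by
  obtain ⟨C, hC, H⟩ := EE_decay_real M N h hs hc
  refine ⟨C + 1, by positivity, fun v τ => ?_⟩
  rw [← ofReal_norm, ww, ← ofReal_mul (by positivity)]
  apply ofReal_le_ofReal
  rw [← div_eq_mul_inv, le_div_iff₀ (by positivity), mul_comm]
  refine (H v τ).trans ?_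
  gcongr
  linarith

end HP
end

noncomputable section
open MeasureTheory Metric Set
open scoped ENNReal NNReal FourierTransform RealInnerProductSpace ContDiff

namespace HP
open ENNReal (ofReal ofReal_mul ofReal_le_ofReal ofReal_pow ofReal_one ofReal_ne_top ofReal_pos ofReal_add)
set_option linter.unusedSectionVars false
variable {V : Type*} [NormedAddCommGroup V] [InnerProductSpace ℝ V] [FiniteDimensional ℝ V]
  [MeasurableSpace V] [BorelSpace V]

lemma CS_sq {α : Type*} [MeasurableSpace α] {μ : Measure α} {f g : α → ℝ≥0∞} (hf : AEMeasurable f μ)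
    (hg : AEMeasurable g μ) : (∫⁻ a, f a * g a ∂μ) ^ 2 ≤ (∫⁻ a, f a ^ 2 ∂μ) * ∫⁻ a, g a ^ 2 ∂μ := by
  have h := ENNReal.lintegral_mul_le_Lp_mul_Lq μ Real.HolderConjugate.two_two hf hg
  have h2 : (∫⁻ a, f a * g a ∂μ) ^ 2 ≤ ((∫⁻ a, f a ^ (2:ℝ) ∂μ) ^ (1 / (2:ℝ)) * (∫⁻ a, g a ^ (2:ℝ) ∂μ) ^ (1 / (2:ℝ))) ^ 2 := by
    gcongr; exact h
  refine h2.trans_eq ?_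
  rw [mul_pow]
  congr 1 <;> rw [← ENNReal.rpow_natCast, ← ENNReal.rpow_mul] <;> norm_num

structure Win (g : V → ℝ) : Prop where
  smooth : ContDiff ℝ ∞ g
  supp : ∀ u, 1 < ‖u‖ → g u = 0
  int : ∫ u, g u ^ 2 = 1

lemma exists_win : ∃ g : V → ℝ, Win g := by
  let b : ContDiffBump (0 : V) := ⟨1/2, 1, by norm_num, by norm_num⟩
  have hb : ContDiff ℝ ∞ b := b.contDiff
  have hsupp : ∀ u, 1 < ‖u‖ → b u = 0 := fun u hu => b.zero_of_le_dist (by simpa using hu.le)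
  have hpos : 0 < ∫ u, b u ^ 2 := by
    rw [integral_pos_iff_support_of_nonneg (fun u => by positivity)]
    · have : Function.support (fun u => b u ^ 2) = ball 0 1 := by
        rw [Function.support_pow _ (by norm_num)]; exact b.support_eq
      rw [this]; exact measure_ball_pos _ _ (by norm_num)
    · refine (hb.continuous.pow 2).integrable_of_hasCompactSupport ?_
      have := b.hasCompactSupport
      simp_rw [sq]; exact this.mul_left
  set I := ∫ u, b u ^ 2
  refine ⟨fun u => (√I)⁻¹ * b u, contDiff_const.mul hb, fun u hu => by simp [hsupp u hu], ?_⟩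
  simp_rw [mul_pow]
  rw [integral_const_mul, inv_pow, Real.sq_sqrt hpos.le, inv_mul_cancel₀ hpos.ne']

variable {g : V → ℝ}
lemma Win.hcs (hg : Win g) : HasCompactSupport g :=
  HasCompactSupport.intro (isCompact_closedBall (0:V) 1) (fun u hu => hg.supp u (by simpa using hu))
lemma Win.meas (hg : Win g) : Measurable g := hg.smooth.continuous.measurable
lemma Win.smoothC (hg : Win g) : ContDiff ℝ ∞ (fun u => (g u : ℂ)) :=
  Complex.ofRealCLM.contDiff.comp hg.smooth
lemma Win.hcsC (hg : Win g) : HasCompactSupport (fun u => (g u : ℂ)) :=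
  hg.hcs.comp_left (g := fun x : ℝ => (x : ℂ)) (by simp)
lemma Win.integrable (hg : Win g) : Integrable g :=
  hg.smooth.continuous.integrable_of_hasCompactSupport hg.hcs
lemma Win.nn_eq (hg : Win g) : ∫⁻ u, ‖(g u : ℂ)‖ₑ ^ 2 = 1 := by
  have h1 : Integrable (fun u => g u ^ 2) := by
    by_contra h
    have := hg.int
    rw [integral_undef h] at this; norm_num at this
  have : ∀ u, ‖(g u : ℂ)‖ₑ ^ 2 = ofReal (g u ^ 2) := fun u => by
    rw [← ofReal_norm, ← ofReal_pow (norm_nonneg _)]; simp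
  simp_rw [this]
  rw [← ofReal_integral_eq_lintegral_ofReal h1 (by filter_upwards with u; positivity), hg.int, ofReal_one]

variable (M : V ≃ₗᵢ[ℝ] V)
def pos (z : V × V) (p : V × ℝ) : V := p.1 - z.1 + (2 * p.2) • M z.2
@[fun_prop] lemma continuous_pos : Continuous (fun q : (V × V) × (V × ℝ) => pos M q.1 q.2) := by
  have := M.continuous
  unfold pos; fun_prop
@[fun_prop] lemma measurable_pos_comp {α : Type*} [MeasurableSpace α] {f : α → V × V} {h : α → V × ℝ}
    (hf : Measurable f) (hh : Measurable h) : Measurable (fun a => pos M (f a) (h a)) :=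
  (continuous_pos M).measurable.comp (hf.prodMk hh)

def wp (g : V → ℝ) (z : V × V) (η : V) : ℂ := g (η - z.2) * ee (-⟪z.1, η⟫)
def pk (g : V → ℝ) (z : V × V) (p : V × ℝ) : ℂ := EE M (wp g z) p

lemma QQ_add (hM : ∀ a b, ⟪M a, b⟫ = ⟪a, M b⟫) (a b : V) :
    QQ M (a + b) = QQ M a + 2 * ⟪M a, b⟫ + QQ M b := by
  unfold QQ; rw [map_add, inner_add_left, inner_add_right, inner_add_right, hM b a, real_inner_comm b (M a)]; ring

lemma pk_eq (hM : ∀ a b, ⟪M a, b⟫ = ⟪a, M b⟫) (z : V × V) (p : V × ℝ) :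
    pk M g z p = ee (ph M (p.1 - z.1, p.2) z.2) * EE M (fun u => (g u : ℂ)) (pos M z p, p.2) := by
  unfold pk EE wp
  rw [← integral_const_mul, ← integral_add_left_eq_self _ z.2]
  congr 1; ext u
  rw [add_sub_cancel_left, mul_assoc, ← ee_add, mul_left_comm, ← ee_add]
  congr 2
  unfold ph pos
  rw [QQ_add M hM]
  simp only [inner_add_right, inner_sub_left, inner_add_left, inner_smul_left]
  simp; ring

lemma enorm_pk (hM : ∀ a b, ⟪M a, b⟫ = ⟪a, M b⟫) (z : V × V) (p : V × ℝ) :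
    ‖pk M g z p‖ₑ = ‖EE M (fun u => (g u : ℂ)) (pos M z p, p.2)‖ₑ := by
  rw [pk_eq M hM, enorm_mul, enorm_ee, one_mul]

lemma measurable_wp (hg : Win g) : Measurable (fun q : (V × V) × V => wp g q.1 q.2) := by
  have := hg.meas
  unfold wp; fun_prop

lemma measurable_pk (hg : Win g) : Measurable (fun q : (V × V) × (V × ℝ) => pk M g q.1 q.2) := by
  have h1 : StronglyMeasurable (fun q : ((V × V) × (V × ℝ)) × V => wp g q.1.1 q.2 * ee (ph M q.1.2 q.2)) := by
    apply Measurable.stronglyMeasurable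
    exact ((measurable_wp hg).comp (by fun_prop : Measurable (fun q : ((V × V) × (V × ℝ)) × V => (q.1.1, q.2)))).mul
      (measurable_ee.comp ((continuous_ph M).measurable.comp (by fun_prop : Measurable (fun q : ((V × V) × (V × ℝ)) × V => (q.1.2, q.2)))))
  exact h1.integral_prod_right.measurable

lemma pk_decay (hM : ∀ a b, ⟪M a, b⟫ = ⟪a, M b⟫) (hg : Win g) (N : ℕ) :
    ∃ C : ℝ, 0 < C ∧ ∀ z p, ‖pk M g z p‖ₑ ≤ ofReal (C * (1 + |p.2|) ^ (2 * N)) * ww N (pos M z p) := by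
  obtain ⟨C, hC, H⟩ := EE_decay M N hg.smoothC hg.hcsC
  exact ⟨C, hC, fun z p => by rw [enorm_pk M hM]; exact H _ _⟩

def VV (g : V → ℝ) (f : V → ℂ) (z : V × V) : ℂ := ∫ η, f η * g (η - z.2) * ee ⟪z.1, η⟫
def VS (g : V → ℝ) (c : V × V → ℂ) (η : V) : ℂ := ∫ z, c z * wp g z η

lemma measurable_VV (hg : Win g) {f : V → ℂ} (hf : Measurable f) : Measurable (VV g f) := by
  have := hg.meas
  have h1 : StronglyMeasurable (fun q : (V × V) × V => f q.2 * g (q.2 - q.1.2) * ee ⟪q.1.1, q.2⟫) := by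
    apply Measurable.stronglyMeasurable; fun_prop
  exact h1.integral_prod_right.measurable

lemma measurable_VS (hg : Win g) {c : V × V → ℂ} (hc : Measurable c) : Measurable (VS g c) := by
  have h1 : StronglyMeasurable (fun q : V × (V × V) => c q.2 * wp g q.2 q.1) := by
    apply Measurable.stronglyMeasurable
    exact (hc.comp measurable_snd).mul ((measurable_wp hg).comp measurable_swap)
  exact h1.integral_prod_right.measurable

lemma VV_zero (hg : Win g) {f : V → ℂ} {z : V × V} (h : ∀ η, f η ≠ 0 → 1 < ‖η - z.2‖) : VV g f z = 0 := by
  unfold VV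
  rw [← integral_zero V ℂ]; congr 1; ext η
  by_cases hf : f η = 0
  · simp [hf]
  · simp [hg.supp _ (h η hf)]

lemma VS_zero (hg : Win g) {c : V × V → ℂ} {η : V} (h : ∀ z, c z ≠ 0 → 1 < ‖η - z.2‖) : VS g c η = 0 := by
  unfold VS
  rw [← integral_zero (V × V) ℂ]; congr 1; ext z
  by_cases hf : c z = 0
  · simp [hf]
  · simp [wp, hg.supp _ (h z hf)]

lemma bdd_g (hg : Win g) : ∃ C : ℝ, ∀ u, ‖(g u : ℂ)‖ ≤ C :=
  hg.smoothC.continuous.bounded_above_of_compact_support hg.hcsC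

lemma VV_eq (f : V → ℂ) (x ξ : V) :
    VV g f (x, ξ) = 𝓕⁻ (fun η => f η * g (η - ξ)) x := by
  rw [VV, Real.fourierInv_eq]; congr 1; ext η
  rw [Circle.smul_def, smul_eq_mul, mul_comm, real_inner_comm]; rfl

lemma integrable_fg (hg : Win g) {f : V → ℂ} (hi : Integrable f) (ξ : V) :
    Integrable (fun η => f η * g (η - ξ)) := by
  obtain ⟨C, hC⟩ := bdd_g hg
  refine hi.mul_bdd (c := C) ?_ (by filter_upwards with x; exact hC _)
  exact ((hg.smoothC.continuous).comp (by fun_prop : Continuous fun η => η - ξ)).aestronglyMeasurable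

lemma nn_VV_le (hg : Win g) {f : V → ℂ} (hf : Measurable f) (hi : Integrable f) : nn (VV g f) ≤ nn f := by
  have hm := hg.meas
  have e1 : nn (VV g f) = ∫⁻ ξ, ∫⁻ x, ‖VV g f (x, ξ)‖ₑ ^ 2 := by
    unfold nn; rw [Measure.volume_eq_prod, lintegral_prod_symm' _ ((measurable_VV hg hf).enorm.pow_const 2)]
  have e2 : ∀ ξ, ∫⁻ x, ‖VV g f (x, ξ)‖ₑ ^ 2 ≤ ∫⁻ η, ‖f η‖ₑ ^ 2 * ‖(g (η - ξ) : ℂ)‖ₑ ^ 2 := fun ξ => by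
    simp_rw [VV_eq, Real.fourierInv_eq_fourier_neg]
    rw [lintegral_neg_V (f := fun x => ‖𝓕 (fun η => f η * g (η - ξ)) x‖ₑ ^ 2)]
    refine (plancherel_le (by fun_prop) (integrable_fg hg hi ξ)).trans_eq ?_
    simp [nn, enorm_mul, mul_pow]
  rw [e1]
  refine (lintegral_mono e2).trans ?_
  rw [lintegral_lintegral_swap (by fun_prop)]
  refine le_of_eq (lintegral_congr fun η => ?_)
  rw [lintegral_const_mul _ (by fun_prop)]
  have : ∫⁻ ξ, ‖(g (η - ξ) : ℂ)‖ₑ ^ 2 = 1 := by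
    rw [lintegral_sub_left_eq_self (fun u => ‖(g u : ℂ)‖ₑ ^ 2) η, hg.nn_eq]
  rw [this, mul_one]

lemma integrable_c_wp (hg : Win g) {c : V × V → ℂ} (hc : Measurable c) (hi : Integrable c) :
    Integrable (fun q : (V × V) × V => c q.1 * wp g q.1 q.2) (volume.prod volume) := by
  have hw := measurable_wp hg
  refine (integrable_prod_iff (by
    exact ((hc.comp measurable_fst).mul hw).aestronglyMeasurable)).mpr ⟨?_, ?_⟩
  · filter_upwards with z
    refine Integrable.const_mul ?_ _
    have : Integrable (fun η => (g (η - z.2) : ℂ)) := Integrable.comp_sub_right (f := fun u => (g u : ℂ)) hg.integrable.ofReal z.2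
    refine this.mono ((hw.comp (by fun_prop : Measurable fun η => (z, η))).aestronglyMeasurable) ?_
    simp [wp, norm_ee]
  · have : ∀ z : V × V, ∫ η, ‖c z * wp g z η‖ = ‖c z‖ * ∫ u, ‖g u‖ := fun z => by
      simp_rw [norm_mul]; rw [integral_const_mul]
      simp only [wp, norm_mul, norm_ee, mul_one, Complex.norm_real]
      rw [integral_sub_right_eq_self (fun u => ‖g u‖) z.2]
    simp_rw [this]
    exact hi.norm.mul_const _

lemma integrable_VS (hg : Win g) {c : V × V → ℂ} (hc : Measurable c) (hi : Integrable c) :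
    Integrable (VS g c) := (integrable_c_wp hg hc hi).integral_prod_right

lemma EE_VS (hg : Win g) {c : V × V → ℂ} (hc : Measurable c) (hi : Integrable c) (p : V × ℝ) :
    EE M (VS g c) p = ∫ z, c z * pk M g z p := by
  unfold EE VS pk
  simp_rw [← integral_mul_const]
  rw [integral_integral_swap]
  · unfold EE; congr 1; ext z; rw [← integral_const_mul]; congr 1; ext η; ring
  · refine Integrable.mono ((integrable_c_wp hg hc hi).swap) ?_ ?_
    · have hw := (measurable_wp hg).comp (measurable_swap (α := V) (β := V × V))
      have he : Measurable fun q : V × (V × V) => ee (ph M p q.1) :=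
        measurable_ee.comp ((continuous_ph M).measurable.comp (by fun_prop : Measurable fun q : V × (V × V) => (p, q.1)))
      exact (((hc.comp measurable_snd).mul hw).mul he).aestronglyMeasurable
    · filter_upwards with q
      simp [norm_ee, Function.uncurry]

lemma nn_VS_le (hg : Win g) {c : V × V → ℂ} (hc : Measurable c) (hi : Integrable c) :
    nn (VS g c) ≤ nn c := by
  have hm := hg.meas
  set Fc : V → V → ℂ := fun ξ η => 𝓕 (fun x => c (x, ξ)) η with hFc
  have hFm : Measurable (fun q : V × V => Fc q.1 q.2) := by
    have h1 : StronglyMeasurable (fun q : (V × V) × V => ee (-⟪q.2, q.1.2⟫) * c (q.2, q.1.1)) := by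
      apply Measurable.stronglyMeasurable
      fun_prop
    have := (h1.integral_prod_right' (ν := (volume : Measure V))).measurable
    convert this using 2 with q
    rw [hFc]; simp only [Real.fourier_eq]; rfl
  have hae := (Measure.volume_eq_prod V V ▸ hi : Integrable c (volume.prod volume)).prod_left_ae
  have e1 : ∀ η, VS g c η = ∫ ξ, (g (η - ξ) : ℂ) * Fc ξ η := by
    intro η
    unfold VS
    rw [Measure.volume_eq_prod, integral_prod_symm]
    · congr 1; ext ξ
      rw [hFc]; simp only [Real.fourier_eq]; rw [← integral_const_mul]; congr 1; ext x
      rw [Circle.smul_def]; simp only [wp, smul_eq_mul]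
      change _ = _ * (ee _ * _)
      ring
    · rw [← Measure.volume_eq_prod]
      obtain ⟨C, hC⟩ := bdd_g hg
      refine hi.mul_bdd (c := C) ((measurable_wp hg).comp (by fun_prop : Measurable fun z : V × V => (z, η))).aestronglyMeasurable ?_
      filter_upwards with z
      simpa [wp, norm_ee] using hC (η - z.2)
  have e2 : ∀ η, ‖VS g c η‖ₑ ^ 2 ≤ ∫⁻ ξ, ‖Fc ξ η‖ₑ ^ 2 := fun η => by
    rw [e1]
    have h1 : ‖∫ ξ, (g (η - ξ) : ℂ) * Fc ξ η‖ₑ ≤ ∫⁻ ξ, ‖(g (η - ξ) : ℂ)‖ₑ * ‖Fc ξ η‖ₑ :=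
      (enorm_integral_le_lintegral_enorm _).trans_eq (by simp [enorm_mul])
    have h2 := CS_sq (μ := (volume : Measure V)) (f := fun ξ => ‖(g (η - ξ) : ℂ)‖ₑ) (g := fun ξ => ‖Fc ξ η‖ₑ)
      (by fun_prop) ((hFm.comp (by fun_prop : Measurable fun ξ : V => (ξ, η))).enorm.aemeasurable)
    rw [lintegral_sub_left_eq_self (fun u => ‖(g u : ℂ)‖ₑ ^ 2) η, hg.nn_eq, one_mul] at h2
    exact (by gcongr : _ ≤ _).trans h2
  calc nn (VS g c) ≤ ∫⁻ η, ∫⁻ ξ, ‖Fc ξ η‖ₑ ^ 2 := lintegral_mono e2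
    _ = ∫⁻ ξ, ∫⁻ η, ‖Fc ξ η‖ₑ ^ 2 := by
        rw [lintegral_lintegral_swap]
        exact ((hFm.comp measurable_swap).enorm.pow_const 2).aemeasurable
    _ ≤ ∫⁻ ξ, ∫⁻ x, ‖c (x, ξ)‖ₑ ^ 2 := by
        apply lintegral_mono_ae
        filter_upwards [hae] with ξ hξ
        exact plancherel_le (hc.comp (by fun_prop)) hξ
    _ = nn c := by
        unfold nn; rw [Measure.volume_eq_prod, lintegral_prod_symm' _ (hc.enorm.pow_const 2)]

lemma lint_pos (N : ℕ) (ξ : V) (p : V × ℝ) : ∫⁻ x, ww N (pos M (x, ξ) p) = ∫⁻ v : V, ww N v := by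
  have : ∀ x, pos M (x, ξ) p = (p.1 + (2 * p.2) • M ξ) - x := fun x => by unfold pos; simp; abel
  simp_rw [this]
  exact lintegral_sub_left_eq_self (fun v => ww N v) _

set_option maxHeartbeats 800000 in
lemma integrable_VVpk (hM : ∀ a b, ⟪M a, b⟫ = ⟪a, M b⟫) (hg : Win g) {f : V → ℂ} (hf : Measurable f)
    (hi : Integrable f) (hn : nn f ≠ ⊤) {ρ : ℝ} (hs : ∀ η, ρ < ‖η‖ → f η = 0) (p : V × ℝ) :
    Integrable (fun z => VV g f z * pk M g z p) := by
  obtain ⟨C, hC, H⟩ := pk_decay M hM hg (Module.finrank ℝ V + 1)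
  set N := Module.finrank ℝ V + 1
  have hpm : Measurable fun z => pk M g z p := (measurable_pk M hg).comp (by fun_prop : Measurable fun z : V × V => (z, p))
  have hvm := measurable_VV hg hf
  refine ⟨(hvm.mul hpm).aestronglyMeasurable, ?_⟩
  set D := ofReal (C * (1 + |p.2|) ^ (2 * N))
  have hb : ∀ z : V × V, ‖VV g f z * pk M g z p‖ₑ ≤ ‖VV g f z‖ₑ ^ 2 +
      (closedBall (0:V) (ρ + 1)).indicator (fun _ => (1:ℝ≥0∞)) z.2 * (D ^ 2 * ww N (pos M z p)) := fun z => by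
    by_cases hz : z.2 ∈ closedBall (0:V) (ρ + 1)
    · rw [indicator_of_mem hz, one_mul, enorm_mul]
      have h1 : ‖pk M g z p‖ₑ ^ 2 ≤ D ^ 2 * ww N (pos M z p) := by
        refine (pow_le_pow_left' (H z p) 2).trans ?_
        rw [mul_pow]; gcongr; rw [sq]; exact mul_le_of_le_one_right' (ww_le_one _ _)
      refine le_trans ?_ (add_le_add_right h1 _)
      rcases le_total (‖VV g f z‖ₑ) (‖pk M g z p‖ₑ) with h | h
      · exact le_add_left (by rw [sq]; gcongr)
      · exact le_add_right (by rw [sq]; gcongr)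
    · have : VV g f z = 0 := VV_zero hg fun η hη => by
        have h1 : ‖η‖ ≤ ρ := by by_contra h; exact hη (hs η (not_le.mp h))
        have h2 : ρ + 1 < ‖z.2‖ := by simpa using hz
        have := norm_sub_norm_le z.2 η
        rw [norm_sub_rev] at this; linarith
      simp [this]
  refine lt_of_le_of_lt (lintegral_mono hb) ?_
  have hind : Measurable ((closedBall (0:V) (ρ + 1)).indicator (fun _ => (1:ℝ≥0∞))) :=
    measurable_const.indicator measurableSet_closedBall
  rw [lintegral_add_left (by fun_prop)]
  refine ENNReal.add_lt_top.mpr ⟨lt_of_le_of_lt (nn_VV_le hg hf hi) hn.lt_top, ?_⟩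
  rw [Measure.volume_eq_prod, lintegral_prod_symm' _ (by fun_prop)]
  have : ∀ ξ : V, ∫⁻ x : V, (closedBall (0:V) (ρ + 1)).indicator (fun _ => (1:ℝ≥0∞)) (x, ξ).2 * (D ^ 2 * ww N (pos M (x, ξ) p))
      = (closedBall (0:V) (ρ + 1)).indicator (fun _ => (1:ℝ≥0∞)) ξ * (D ^ 2 * ∫⁻ v : V, ww N v) := fun ξ => by
    dsimp only
    rw [lintegral_const_mul _ (by fun_prop), lintegral_const_mul _ (by fun_prop), lint_pos]
  simp_rw [this]
  rw [lintegral_mul_const _ hind, lintegral_indicator measurableSet_closedBall]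
  refine ENNReal.mul_lt_top (by simpa using measure_closedBall_lt_top) (ENNReal.mul_lt_top (by simp [D]) (ww_int_lt_top (by omega)))

lemma EE_recon (hM : ∀ a b, ⟪M a, b⟫ = ⟪a, M b⟫) (hg : Win g) {f : V → ℂ} (hf : Measurable f)
    (hi : Integrable f) (hn : nn f ≠ ⊤) {ρ : ℝ} (hs : ∀ η, ρ < ‖η‖ → f η = 0) (p : V × ℝ) :
    EE M f p = ∫ z, VV g f z * pk M g z p := by
  have hI := integrable_VVpk M hM hg hf hi hn hs p
  rw [Measure.volume_eq_prod] at hI ⊢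
  rw [integral_prod_symm _ hI]
  have key : ∀ ξ : V, ∫ x, VV g f (x, ξ) * pk M g (x, ξ) p = ∫ η, f η * ee (ph M p η) * ((g (η - ξ) ^ 2 : ℝ) : ℂ) := by
    intro ξ
    set k : V → ℂ := fun η => g (η - ξ) * ee (ph M p η) with hk
    have hks : ContDiff ℝ ∞ k := by
      refine (hg.smoothC.comp (contDiff_id.sub contDiff_const)).mul (contDiff_ee.comp ?_)
      exact ((innerSL ℝ p.1).contDiff).add (contDiff_const.mul (contDiff_QQ M))
    have hkc : HasCompactSupport k := by
      have : HasCompactSupport (fun η => (g (η - ξ) : ℂ)) := hg.hcsC.comp_homeomorph (Homeomorph.subRight ξ)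
      exact this.mul_right
    set K : SchwartzMap V ℂ := hkc.toSchwartzMap hks
    set Ki : SchwartzMap V ℂ := 𝓕⁻ K with hKi
    have hK : ∀ x, K x = k x := fun x => rfl
    have e1 : ∀ x, pk M g (x, ξ) p = (𝓕 K) x := fun x => by
      rw [SchwartzMap.fourier_coe, Real.fourier_eq]
      unfold pk EE wp; congr 1; ext η
      rw [Circle.smul_def, hK, hk]
      change _ = ee _ * _
      simp only [real_inner_comm]; ring
    set a : V → ℂ := fun η => f η * g (η - ξ) with ha
    have hai : Integrable a := integrable_fg hg hi ξ
    have e2 : ∫ x, VV g f (x, ξ) * pk M g (x, ξ) p = ∫ x, 𝓕 a x * Ki x := by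
      rw [← integral_neg_eq_self]
      congr 1; ext x
      rw [VV_eq, e1, Real.fourierInv_eq_fourier_neg, neg_neg, hKi, SchwartzMap.fourierInv_coe, Real.fourierInv_eq_fourier_neg, SchwartzMap.fourier_coe]
    have e3 := VectorFourier.integral_fourierIntegral_smul_eq_flip (μ := (volume : Measure V))
        (ν := (volume : Measure V)) (L := innerₗ V)
        Real.continuous_fourierChar (by exact continuous_inner) hai (SchwartzMap.integrable Ki)
    rw [flip_innerₗ] at e3
    rw [e2]
    have e5 : 𝓕 (⇑Ki) = ⇑K := by rw [← SchwartzMap.fourier_coe, hKi]; simp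
    have e4 : ∫ x, 𝓕 a x * Ki x = ∫ x, a x * 𝓕 (⇑Ki) x := e3
    rw [e4, e5]
    congr 1; ext η; rw [hK, hk, ha]; push_cast; ring
  simp_rw [key]
  rw [integral_integral_swap]
  · unfold EE; congr 1; ext η
    have e6 : ∫ ξ, ((g (η - ξ) ^ 2 : ℝ) : ℂ) = ((∫ ξ, g (η - ξ) ^ 2 : ℝ) : ℂ) := integral_ofReal (𝕜 := ℂ)
    rw [integral_const_mul, e6, integral_sub_left_eq_self (fun u => g u ^ 2) volume η, hg.int]; simp
  · have hm := hg.meas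
    have hee : Measurable fun η => ee (ph M p η) :=
      measurable_ee.comp ((continuous_ph M).measurable.comp (by fun_prop : Measurable fun q : V => (p, q)))
    refine Integrable.swap (f := fun q : V × V => f q.1 * ee (ph M p q.1) * ((g (q.1 - q.2) ^ 2 : ℝ) : ℂ)) ?_
    have hg2 : Integrable (fun u => g u ^ 2) := by
      by_contra h
      have := hg.int
      rw [integral_undef h] at this; norm_num at this
    refine (integrable_prod_iff (Measurable.aestronglyMeasurable (by fun_prop))).mpr ⟨?_, ?_⟩
    · filter_upwards with η
      refine Integrable.const_mul ?_ _
      exact (hg2.comp_sub_left η).ofReal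
    · have : ∀ η : V, ∫ ξ, ‖f η * ee (ph M p η) * ((g (η - ξ) ^ 2 : ℝ) : ℂ)‖ = ‖f η‖ := fun η => by
        simp_rw [norm_mul, norm_ee, mul_one]
        rw [integral_const_mul]
        have : ∀ ξ, ‖((g (η - ξ) ^ 2 : ℝ) : ℂ)‖ = g (η - ξ) ^ 2 := fun ξ => by simp
        simp_rw [this]
        rw [integral_sub_left_eq_self (fun u => g u ^ 2) volume η, hg.int, mul_one]
      simp_rw [this]; exact hi.norm

end HP
end

noncomputable section
open MeasureTheory Metric Set
open scoped ENNReal NNReal FourierTransform RealInnerProductSpace ContDiff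

namespace HP
open ENNReal (ofReal ofReal_mul ofReal_le_ofReal ofReal_pow ofReal_one ofReal_ne_top ofReal_pos ofReal_add)
set_option linter.unusedSectionVars false
variable {V : Type*} [NormedAddCommGroup V] [InnerProductSpace ℝ V] [FiniteDimensional ℝ V]
  [MeasurableSpace V] [BorelSpace V]

section fub
variable {Ω Ω' P : Type*} [MeasurableSpace Ω] [MeasurableSpace Ω'] [MeasurableSpace P] {μ : Measure Ω} {μ' : Measure Ω'}
  {ν : Measure P} [SFinite μ] [SFinite μ'] [SFinite ν]
open ComplexConjugate

lemma fub {U : Ω → ℂ} {U' : Ω' → ℂ} (hU : Integrable U μ) (hU' : Integrable U' μ') {T : Ω × P → ℂ} {T' : Ω' × P → ℂ}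
    (hT : Measurable T) (hT' : Measurable T') {C : ℝ} (hC : ∀ q, ‖T q‖ ≤ C) (hC' : ∀ q, ‖T' q‖ ≤ C) {χ : P → ℂ}
    (hχ : Integrable χ ν) :
    ∫ p, χ p * ((∫ w, U w * T (w, p) ∂μ) * conj (∫ w, U' w * T' (w, p) ∂μ')) ∂ν =
    ∫ q, U q.1 * conj (U' q.2) * ∫ p, χ p * (T (q.1, p) * conj (T' (q.2, p))) ∂ν ∂(μ.prod μ') := by
  have e1 : ∀ p, χ p * ((∫ w, U w * T (w, p) ∂μ) * conj (∫ w, U' w * T' (w, p) ∂μ')) =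
      ∫ q, χ p * (U q.1 * conj (U' q.2) * (T (q.1, p) * conj (T' (q.2, p)))) ∂(μ.prod μ') := fun p => by
    rw [integral_const_mul, ← integral_conj, ← integral_prod_mul]
    congr 2; ext q; simp only [map_mul]; ring
  simp_rw [e1]
  rw [integral_integral_swap]
  · congr 1; ext q; rw [← integral_const_mul]; congr 1; ext p; ring
  · have h1 : Integrable (fun q : P × (Ω × Ω') => χ q.1 * (U q.2.1 * conj (U' q.2.2))) (ν.prod (μ.prod μ')) := by
      refine hχ.mul_prod (hU.mul_prod (g := fun w => conj (U' w)) ?_)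
      exact (Complex.conjLIE.integrable_comp_iff).mpr hU'
    have h2 : Measurable (fun q : P × (Ω × Ω') => T (q.2.1, q.1) * conj (T' (q.2.2, q.1))) :=
      (hT.comp (by fun_prop)).mul (Complex.continuous_conj.measurable.comp (hT'.comp (by fun_prop)))
    refine (h1.mul_bdd (c := C * C) h2.aestronglyMeasurable ?_).congr ?_
    · filter_upwards with q
      rw [norm_mul, RCLike.norm_conj]
      have := (norm_nonneg _).trans (hC (q.2.1, q.1))
      exact mul_le_mul (hC _) (hC' _) (norm_nonneg _) this
    · filter_upwards with q
      simp only [Function.uncurry]; ring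

lemma fub_sq {U : Ω → ℂ} (hU : Integrable U μ) {T : Ω × P → ℂ}
    (hT : Measurable T) {C : ℝ} (hC : ∀ q, ‖T q‖ ≤ C) {χ : P → ℝ}
    (hχ : Integrable χ ν) (h0 : ∀ p, 0 ≤ χ p) :
    ∫⁻ p, ofReal (χ p) * ‖∫ w, U w * T (w, p) ∂μ‖ₑ ^ 2 ∂ν ≤
    ∫⁻ q, ‖U q.1‖ₑ * ‖U q.2‖ₑ * ‖∫ p, (χ p : ℂ) * (T (q.1, p) * conj (T (q.2, p))) ∂ν‖ₑ ∂(μ.prod μ) := by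
  have key := fub hU hU hT hT hC hC (hχ.ofReal (𝕜 := ℂ))
  set A : P → ℂ := fun p => ∫ w, U w * T (w, p) ∂μ with hA
  have hAb : ∀ p, ‖A p‖ ≤ C * ∫ w, ‖U w‖ ∂μ := fun p => by
    rw [← integral_const_mul]
    refine norm_integral_le_of_norm_le (hU.norm.const_mul C) ?_
    filter_upwards with w
    rw [norm_mul, mul_comm]; exact mul_le_mul_of_nonneg_right (hC _) (norm_nonneg _)
  have hAm : AEStronglyMeasurable A ν := by
    have h1 : AEStronglyMeasurable (fun q : P × Ω => U q.2 * T (q.2, q.1)) (ν.prod μ) :=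
      hU.1.comp_snd.mul (hT.comp measurable_swap).aestronglyMeasurable
    exact h1.integral_prod_right'
  have hI : Integrable (fun p => χ p * ‖A p‖ ^ 2) ν := by
    refine hχ.mul_bdd (c := (C * ∫ w, ‖U w‖ ∂μ) ^ 2) (hAm.norm.pow 2) ?_
    filter_upwards with p
    rw [Real.norm_of_nonneg (by positivity)]; gcongr; exact hAb p
  have e1 : ∫⁻ p, ofReal (χ p) * ‖A p‖ₑ ^ 2 ∂ν = ofReal (∫ p, χ p * ‖A p‖ ^ 2 ∂ν) := by
    rw [ofReal_integral_eq_lintegral_ofReal hI (by filter_upwards with p; have := h0 p; positivity)]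
    congr 1; ext p
    rw [ofReal_mul (h0 p), ofReal_pow (norm_nonneg _), ofReal_norm]
  have e2 : ((∫ p, χ p * ‖A p‖ ^ 2 ∂ν : ℝ) : ℂ) = ∫ p, (χ p : ℂ) * (A p * conj (A p)) ∂ν := by
    rw [← integral_complex_ofReal]; congr 1; ext p; rw [Complex.mul_conj, Complex.normSq_eq_norm_sq]; push_cast; ring
  rw [e1]
  calc _ ≤ ‖((∫ p, χ p * ‖A p‖ ^ 2 ∂ν : ℝ) : ℂ)‖ₑ := by
        rw [← ofReal_norm, Complex.norm_real]; exact ofReal_le_ofReal (le_abs_self _)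
    _ ≤ _ := by
        rw [e2]; erw [key]
        refine (enorm_integral_le_lintegral_enorm _).trans_eq ?_
        congr 1; ext q
        rw [enorm_mul, enorm_mul, ← ofReal_norm (conj (U q.2)), RCLike.norm_conj, ofReal_norm]
        rfl
end fub

structure Chi (X : V → ℝ) : Prop where
  cont : Continuous X
  nonneg : ∀ v, 0 ≤ X v
  dec : ∀ N, ∃ C : ℝ, 0 < C ∧ ∀ v, ofReal (X v) ≤ ofReal C * ww N v
  pos : ∃ s c : ℝ, 0 < s ∧ s ≤ 1 ∧ 0 < c ∧ ∀ v, ‖v‖ ≤ s → c ≤ X v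
  van : ∀ a, 2 < ‖a‖ → ∫ v, (X v : ℂ) * ee ⟪v, a⟫ = 0

lemma exists_chi : ∃ X : V → ℝ, Chi X := by
  let b : ContDiffBump (0 : V) := ⟨1/2, 1, by norm_num, by norm_num⟩
  have hb : ContDiff ℝ ∞ (fun u => (b u : ℂ)) := Complex.ofRealCLM.contDiff.comp b.contDiff
  have hbc : HasCompactSupport (fun u => (b u : ℂ)) := b.hasCompactSupport.comp_left (g := fun x : ℝ => (x : ℂ)) (by simp)
  have hsupp : ∀ u, 1 < ‖u‖ → b u = 0 := fun u hu => b.zero_of_le_dist (by simpa using hu.le)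
  set K : SchwartzMap V ℂ := hbc.toSchwartzMap hb
  have hK : ∀ x, K x = b x := fun x => rfl
  set Kf : SchwartzMap V ℂ := 𝓕 K with hKf
  have hKfe : ∀ v, Kf v = ∫ η, (b η : ℂ) * ee (-⟪v, η⟫) := fun v => by
    rw [hKf, SchwartzMap.fourier_coe, Real.fourier_eq]; congr 1; ext η
    rw [Circle.smul_def, hK, real_inner_comm, smul_eq_mul, mul_comm]; rfl
  have hc : Continuous (fun v => ‖Kf v‖ ^ 2) := (Kf.continuous.norm).pow 2
  refine ⟨fun v => ‖Kf v‖ ^ 2, hc, fun v => by positivity, fun N => ?_, ?_, fun a ha => ?_⟩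
  · obtain ⟨C, hC, H⟩ := EE_decay (LinearIsometryEquiv.refl ℝ V) N hb hbc
    refine ⟨C ^ 2, by positivity, fun v => ?_⟩
    have h1 : ‖Kf v‖ₑ ≤ ofReal C * ww N v := by
      have := H (-v) 0
      rw [ww_neg] at this
      simp only [abs_zero, add_zero, one_pow, mul_one] at this
      rw [hKfe]; unfold EE ph at this; simpa using this
    rw [ofReal_pow (norm_nonneg _), ofReal_norm]
    calc ‖Kf v‖ₑ ^ 2 ≤ (ofReal C * ww N v) ^ 2 := by gcongr
      _ = ofReal C ^ 2 * (ww N v * ww N v) := by ring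
      _ ≤ ofReal (C ^ 2) * (ww N v * 1) := by
          rw [ofReal_pow hC.le]; gcongr; exact ww_le_one _ _
      _ = _ := by rw [mul_one]
  · have h0 : 0 < ‖Kf 0‖ ^ 2 := by
      have : Kf 0 = ((∫ η, b η : ℝ) : ℂ) := by
        rw [hKfe, ← integral_complex_ofReal]; congr 1; ext η; simp [ee_zero]
      rw [this, Complex.norm_real]
      have := b.integral_pos (μ := volume)
      have h2 := norm_pos_iff.mpr this.ne'
      positivity
    have := (hc.continuousAt (x := 0)).eventually (lt_mem_nhds (half_lt_self h0))
    obtain ⟨s, hs, H⟩ := Metric.eventually_nhds_iff.mp this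
    refine ⟨min (s/2) 1, _, by positivity, min_le_right _ _, half_pos h0, fun v hv => (H ?_).le⟩
    rw [dist_zero_right]; have := hv.trans (min_le_left _ _); linarith
  · have hbs : ContDiff ℝ ∞ (fun u => (b (u + a) : ℂ)) := hb.comp (contDiff_id.add contDiff_const)
    have hbcs : HasCompactSupport (fun u => (b (u + a) : ℂ)) := hbc.comp_homeomorph (Homeomorph.addRight a)
    set L : SchwartzMap V ℂ := hbcs.toSchwartzMap hbs
    have hL : ∀ x, L x = b (x + a) := fun x => rfl
    have hLf : ∀ v, (𝓕 L) v = ee ⟪v, a⟫ * Kf v := fun v => by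
      rw [SchwartzMap.fourier_coe, Real.fourier_eq, hKfe, ← integral_const_mul]
      rw [← integral_add_right_eq_self (fun η => ee ⟪v, a⟫ * ((b η : ℂ) * ee (-⟪v, η⟫))) a]
      congr 1; ext η
      rw [Circle.smul_def, hL, smul_eq_mul, mul_left_comm, ← ee_add, inner_add_right, real_inner_comm]
      change ee _ * _ = _
      rw [mul_comm]; congr 2; ring
    have P := SchwartzMap.integral_inner_fourier_fourier K L
    have z : ∫ x, inner ℂ (K x) (L x) = 0 := by
      rw [← integral_zero V ℂ]; congr 1; ext x
      rw [hK, hL]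
      by_cases hx : 1 < ‖x‖
      · simp [hsupp x hx]
      · have : 1 < ‖x + a‖ := by
          have := norm_sub_norm_le a (-x); rw [norm_neg, sub_neg_eq_add, add_comm a] at this; linarith
        simp [hsupp _ this]
    rw [z] at P
    rw [← P]; congr 1; ext v
    rw [hLf, RCLike.inner_apply]
    change _ = _ * (starRingEnd ℂ) (Kf v)
    rw [mul_assoc, Complex.mul_conj, Complex.normSq_eq_norm_sq, mul_comm]
end HP
end

noncomputable section
open MeasureTheory Metric Set
open scoped ENNReal NNReal FourierTransform RealInnerProductSpace ContDiff

namespace HP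
open ENNReal (ofReal ofReal_mul ofReal_le_ofReal ofReal_pow ofReal_one ofReal_ne_top ofReal_pos ofReal_add)
set_option linter.unusedSectionVars false
variable {V : Type*} [NormedAddCommGroup V] [InnerProductSpace ℝ V] [FiniteDimensional ℝ V]
  [MeasurableSpace V] [BorelSpace V]
open ComplexConjugate

lemma lint_affine {f : V → ℝ≥0∞} (hf : Measurable f) {s : ℝ} (hs : s ≠ 0) (a : V) :
    ∫⁻ h, f (a + s • h) = ofReal (|s| ^ Module.finrank ℝ V)⁻¹ * ∫⁻ v, f v := by
  have h1 : ∫⁻ h, f (a + s • h) = ∫⁻ v, f (a + v) ∂(Measure.map (s • ·) (volume : Measure V)) :=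
    (lintegral_map (f := fun v => f (a + v)) (by fun_prop) (by fun_prop)).symm
  rw [h1, Measure.map_addHaar_smul _ hs, lintegral_smul_measure, smul_eq_mul]
  congr 1
  · rw [abs_inv, abs_pow]
  · exact lintegral_add_left_eq_self f a

lemma lint_affineR {f : ℝ → ℝ≥0∞} (hf : Measurable f) {s : ℝ} (hs : s ≠ 0) (a : ℝ) :
    ∫⁻ h, f (a + s * h) = ofReal |s|⁻¹ * ∫⁻ v, f v := by
  simpa using lint_affine hf hs a

lemma ww_mul_pow (A B : ℕ) (v : V) : ofReal ((1 + ‖v‖ ^ 2) ^ A) * ww (A + B) v = ww B v := by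
  rw [ww_add, ← mul_assoc]
  conv_rhs => rw [← one_mul (ww B v)]
  congr 1
  rw [ww, ← ofReal_mul (by positivity), mul_inv_cancel₀ (by positivity), ofReal_one]

variable (M : V ≃ₗᵢ[ℝ] V) {g : V → ℝ} {X1 : V → ℝ} {X2 : ℝ → ℝ}

def chi (X1 : V → ℝ) (X2 : ℝ → ℝ) (r : ℝ) (p0 p : V × ℝ) : ℝ := X1 (p.1 - p0.1) * X2 (r * (p.2 - p0.2))

lemma chi_cont (h1 : Chi X1) (h2 : Chi X2) (r : ℝ) : Continuous fun q : (V × ℝ) × (V × ℝ) => chi X1 X2 r q.1 q.2 := by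
  have := h1.cont; have := h2.cont; unfold chi; fun_prop

lemma chi_nonneg (h1 : Chi X1) (h2 : Chi X2) (r : ℝ) (p0 p) : 0 ≤ chi X1 X2 r p0 p :=
  mul_nonneg (h1.nonneg _) (h2.nonneg _)

lemma chi_van (h1 : Chi X1) (h2 : Chi X2) {r : ℝ} (hr : 0 < r) (p0 : V × ℝ) {a : V} {s : ℝ}
    (h : 2 < ‖a‖ ∨ 2 * r < |s|) : ∫ p : V × ℝ, (chi X1 X2 r p0 p : ℂ) * ee (⟪p.1, a⟫ + p.2 * s) = 0 := by
  have e : ∀ p : V × ℝ, (chi X1 X2 r p0 p : ℂ) * ee (⟪p.1, a⟫ + p.2 * s) =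
      ((X1 (p.1 - p0.1) : ℂ) * ee ⟪p.1, a⟫) * ((X2 (r * (p.2 - p0.2)) : ℂ) * ee (p.2 * s)) := fun p => by
    rw [ee_add, chi]; push_cast; ring
  simp_rw [e]
  rw [Measure.volume_eq_prod, integral_prod_mul (f := fun y => (X1 (y - p0.1) : ℂ) * ee ⟪y, a⟫)
    (g := fun t => (X2 (r * (t - p0.2)) : ℂ) * ee (t * s)), mul_eq_zero]
  rcases h with h | h
  · left
    rw [← integral_add_right_eq_self _ p0.1]
    simp_rw [add_sub_cancel_right, inner_add_left, ee_add, ← mul_assoc]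
    rw [integral_mul_const, h1.van a h, zero_mul]
  · right
    rw [← integral_add_right_eq_self _ p0.2]
    simp_rw [add_sub_cancel_right, add_mul, ee_add, ← mul_assoc]
    rw [integral_mul_const]
    have h3 := Measure.integral_comp_mul_left (fun u => (X2 u : ℂ) * ee ⟪u, s / r⟫) r
    have h4 : 2 < ‖s / r‖ := by
      rw [norm_div, Real.norm_eq_abs, Real.norm_eq_abs, abs_of_pos hr, lt_div_iff₀ hr]; exact h
    rw [h2.van _ h4, smul_zero] at h3
    have h5 : ∀ t, r * t * (s / r) = t * s := fun t => by field_simp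
    simp only [RCLike.inner_apply, conj_trivial, mul_comm (s / r), h5] at h3
    rw [h3, zero_mul]

lemma chi_le (h1 : Chi X1) (h2 : Chi X2) (A : ℕ) : ∃ C : ℝ, 0 < C ∧ ∀ r : ℝ, 0 < r → ∀ p0 : V × ℝ,
    ∫⁻ p, ofReal (chi X1 X2 r p0 p) * ofReal (((1 + ‖p.1 - p0.1‖ ^ 2) * (1 + (r * (p.2 - p0.2)) ^ 2)) ^ A)
     ≤ ofReal (C / r) := by
  obtain ⟨C1, hC1, H1⟩ := h1.dec (A + (Module.finrank ℝ V + 1))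
  obtain ⟨C2, hC2, H2⟩ := h2.dec (A + 1)
  set I1 := (∫⁻ v : V, ww (Module.finrank ℝ V + 1) v) with hI1
  set I2 := (∫⁻ v : ℝ, ww 1 v) with hI2
  have hI1t : I1 ≠ ⊤ := (ww_int_lt_top (by omega)).ne
  have hI2t : I2 ≠ ⊤ := (ww_int_lt_top (by simp)).ne
  refine ⟨C1 * C2 * I1.toReal * I2.toReal + 1, by positivity, fun r hr p0 => ?_⟩
  calc _ ≤ ∫⁻ p : V × ℝ, (ofReal C1 * ww (Module.finrank ℝ V + 1) (p.1 - p0.1)) *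
            (ofReal C2 * ww 1 (r * (p.2 - p0.2))) := by
        refine lintegral_mono fun p => ?_
        unfold chi
        have a1 := H1 (p.1 - p0.1)
        have a2 := H2 (r * (p.2 - p0.2))
        rw [ofReal_mul (h1.nonneg _), mul_pow, ofReal_mul (by positivity)]
        have e1 := ww_mul_pow A (Module.finrank ℝ V + 1) (p.1 - p0.1)
        have e2 := ww_mul_pow A 1 (r * (p.2 - p0.2))
        rw [Real.norm_eq_abs, sq_abs] at e2
        rw [← e1, ← e2]
        calc _ ≤ (ofReal C1 * ww (A + (Module.finrank ℝ V + 1)) (p.1 - p0.1)) * (ofReal C2 * ww (A + 1) (r * (p.2 - p0.2))) * _ := by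
                gcongr
          _ = _ := by ring
    _ = (ofReal C1 * I1) * (ofReal C2 * (ofReal r⁻¹ * I2)) := by
        rw [Measure.volume_eq_prod, lintegral_prod_mul (f := fun y => ofReal C1 * ww (Module.finrank ℝ V + 1) (y - p0.1))
          (g := fun t => ofReal C2 * ww 1 (r * (t - p0.2))) (by fun_prop) (by fun_prop)]
        rw [lintegral_const_mul _ (by fun_prop), lintegral_const_mul _ (by fun_prop),
          lintegral_sub_right_eq_self (fun v => ww (Module.finrank ℝ V + 1) v)]
        have := lint_affineR (measurable_ww 1) hr.ne' (-(r * p0.2))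
        rw [abs_of_pos hr] at this
        rw [← this]
        congr 4; ext t; congr 1; ring
    _ ≤ _ := by
        rw [← ENNReal.ofReal_toReal hI1t, ← ENNReal.ofReal_toReal hI2t, ← ofReal_mul (by positivity), ← ofReal_mul (by positivity),
          ← ofReal_mul (by positivity), ← ofReal_mul (by positivity)]
        simp only [ENNReal.toReal_ofReal ENNReal.toReal_nonneg]
        apply ofReal_le_ofReal
        rw [div_eq_mul_inv]
        have : 0 < r⁻¹ := by positivity
        nlinarith

lemma pk_le (hM : ∀ a b, ⟪M a, b⟫ = ⟪a, M b⟫) (hg : Win g) (N : ℕ) (r0 : ℝ) : ∃ C : ℝ, 0 < C ∧ ∀ r : ℝ, 1 ≤ r →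
    ∀ p0 : V × ℝ, |p0.2| ≤ 1 → ∀ z : V × V, ‖z.2‖ ≤ r0 * r → ∀ p : V × ℝ,
    ‖pk M g z p‖ₑ ≤ ofReal C * ofReal (((1 + ‖p.1 - p0.1‖ ^ 2) * (1 + (r * (p.2 - p0.2)) ^ 2)) ^ (3 * N)) * ww N (pos M z p0) := by
  obtain ⟨C, hC, H⟩ := pk_decay M hM hg N
  refine ⟨C * 3 ^ (2 * N) * (2 * (2 + 8 * r0 ^ 2)) ^ N, by positivity, fun r hr p0 hp0 z hz p => ?_⟩
  refine (H z p).trans ?_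
  set b := pos M z p0 - pos M z p with hb
  set v := p.1 - p0.1
  set s := r * (p.2 - p0.2) with hs
  have hbv : b = -v + (-(2 * (p.2 - p0.2))) • M z.2 := by
    simp only [hb, pos, v]; module
  have hnb : ‖b‖ ≤ ‖v‖ + 2 * r0 * |s| := by
    rw [hbv]
    refine (norm_add_le _ _).trans ?_
    rw [norm_neg, norm_smul, LinearIsometryEquiv.norm_map, norm_neg, Real.norm_eq_abs, abs_mul, abs_two, hs, abs_mul, abs_of_pos (by linarith : 0 < r)]
    have := mul_le_mul_of_nonneg_left hz (by positivity : 0 ≤ 2 * |p.2 - p0.2|)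
    linarith
  have h1 : 1 + ‖b‖ ^ 2 ≤ (2 + 8 * r0 ^ 2) * ((1 + ‖v‖ ^ 2) * (1 + s ^ 2)) := by
    have h2 : ‖b‖ ^ 2 ≤ (‖v‖ + 2 * r0 * |s|) ^ 2 := by gcongr
    have h3 := sq_abs s
    have : 0 ≤ (‖v‖ - 2 * r0 * |s|) ^ 2 := sq_nonneg _
    have h4 : (‖v‖ + 2 * r0 * |s|) ^ 2 ≤ 2 * ‖v‖ ^ 2 + 8 * r0 ^ 2 * s ^ 2 := by rw [← h3]; nlinarith
    have : 0 ≤ ‖v‖ ^ 2 * s ^ 2 := by positivity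
    have : 0 ≤ r0 ^ 2 * ‖v‖ ^ 2 * s ^ 2 := by positivity
    have : 0 ≤ r0 ^ 2 * ‖v‖ ^ 2 := by positivity
    nlinarith [sq_nonneg s, sq_nonneg ‖v‖, sq_nonneg r0]
  have h5 : 1 + |p.2| ≤ 3 * ((1 + ‖v‖ ^ 2) * (1 + s ^ 2)) := by
    have h6 : |p.2| ≤ 1 + |s| := by
      have : |p.2 - p0.2| ≤ |s| := by
        rw [hs, abs_mul, abs_of_pos (by linarith : 0 < r)]; exact le_mul_of_one_le_left (abs_nonneg _) hr
      have := abs_sub_abs_le_abs_sub p.2 p0.2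
      linarith
    have h7 : |s| ≤ 1 + s ^ 2 := by rw [← sq_abs]; nlinarith [sq_nonneg (|s| - 1)]
    nlinarith [mul_nonneg (sq_nonneg ‖v‖) (sq_nonneg s), sq_nonneg s, sq_nonneg ‖v‖]
  have h8 := peetre N (pos M z p) b
  rw [show pos M z p + b = pos M z p0 by simp [hb]] at h8
  set G := (1 + ‖v‖ ^ 2) * (1 + s ^ 2) with hG
  have hG0 : 0 < G := by positivity
  refine (mul_le_mul_right h8 _).trans ?_
  rw [← mul_assoc, ← ofReal_mul (by positivity), ← ofReal_mul (by positivity)]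
  gcongr ofReal ?_ * _
  calc C * (1 + |p.2|) ^ (2 * N) * (2 * (1 + ‖b‖ ^ 2)) ^ N ≤ C * (3 * G) ^ (2 * N) * (2 * ((2 + 8 * r0 ^ 2) * G)) ^ N := by gcongr
    _ = _ := by rw [show 3 * N = 2 * N + N by ring, pow_add G, ← mul_assoc 2, mul_pow, mul_pow _ G]; ring

def Rs (r0 r : ℝ) (ζ ζ' : (V × V) × (V × V)) : Prop := ‖ζ.1.2 - ζ.2.2 - ζ'.1.2 + ζ'.2.2‖ ≤ 6 ∧
  |QQ M ζ.1.2 - QQ M ζ.2.2 - QQ M ζ'.1.2 + QQ M ζ'.2.2| ≤ (6 + 8 * r0) * r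

lemma pk2_eq (hg : Win g) (z1 z2 : V × V) (p : V × ℝ) : pk M g z1 p * conj (pk M g z2 p) =
    ∫ η : V × V, (wp g z1 η.1 * conj (wp g z2 η.2)) * ee (ph M p η.1 - ph M p η.2) := by
  unfold pk EE
  rw [← integral_conj, ← integral_prod_mul, Measure.volume_eq_prod]
  congr 1; ext η
  rw [map_mul, conj_ee, sub_eq_add_neg, ee_add]; ring

lemma integrable_wp (hg : Win g) (z : V × V) : Integrable (wp g z) := by
  have : Integrable (fun η => (g (η - z.2) : ℂ)) := Integrable.comp_sub_right (f := fun u => (g u : ℂ)) hg.integrable.ofReal z.2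
  refine this.mono (((measurable_wp hg).comp (by fun_prop : Measurable fun η => (z, η))).aestronglyMeasurable) ?_
  simp [wp, norm_ee]

lemma QQ_lip (hM : ∀ a b, ⟪M a, b⟫ = ⟪a, M b⟫) {a b : V} {c : ℝ} (hb : ‖b‖ ≤ c) (h : ‖a - b‖ ≤ 1) : |QQ M a - QQ M b| ≤ 2 * c + 1 := by
  have e : QQ M a - QQ M b = 2 * ⟪M b, a - b⟫ + QQ M (a - b) := by
    have := QQ_add M hM b (a - b)
    rw [add_sub_cancel] at this; rw [this]; ring
  have h1 : |⟪M b, a - b⟫| ≤ c := (abs_real_inner_le_norm _ _).trans (by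
    rw [M.norm_map]; nlinarith [norm_nonneg (a - b), norm_nonneg b])
  have h2 : |QQ M (a - b)| ≤ 1 := (abs_real_inner_le_norm _ _).trans (by
    rw [M.norm_map]; nlinarith [norm_nonneg (a - b)])
  rw [e]; rw [abs_le] at *; constructor <;> linarith

lemma integrable_chi (h1 : Chi X1) (h2 : Chi X2) {r : ℝ} (hr : 0 < r) (p0 : V × ℝ) : Integrable (chi X1 X2 r p0) := by
  obtain ⟨C, hC, H⟩ := chi_le h1 h2 0
  have hc : Continuous (chi X1 X2 r p0) := (chi_cont h1 h2 r).comp (by fun_prop : Continuous fun p => (p0, p))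
  refine ⟨hc.aestronglyMeasurable, ?_⟩
  refine lt_of_le_of_lt (lintegral_mono fun p => ?_) ((H r hr p0).trans_lt ENNReal.ofReal_lt_top)
  simp [← ofReal_norm, abs_of_nonneg (chi_nonneg h1 h2 r p0 p)]

def Ker (g : V → ℝ) (X1 : V → ℝ) (X2 : ℝ → ℝ) (r : ℝ) (p0 : V × ℝ) (ζ ζ' : (V × V) × (V × V)) : ℂ :=
  ∫ p, (chi X1 X2 r p0 p : ℂ) * ((pk M g ζ.1 p * conj (pk M g ζ.2 p)) * conj (pk M g ζ'.1 p * conj (pk M g ζ'.2 p)))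

lemma Ker_zero (hM : ∀ a b, ⟪M a, b⟫ = ⟪a, M b⟫) (hg : Win g) (h1 : Chi X1) (h2 : Chi X2) {r0 r : ℝ} (hr : 1 ≤ r) (p0 : V × ℝ)
    {ζ ζ' : (V × V) × (V × V)} (k1 : ‖ζ.1.2‖ ≤ r0 * r) (k2 : ‖ζ.2.2‖ ≤ r0 * r) (k3 : ‖ζ'.1.2‖ ≤ r0 * r) (k4 : ‖ζ'.2.2‖ ≤ r0 * r)
    (h : ¬ Rs M r0 r ζ ζ') : Ker M g X1 X2 r p0 ζ ζ' = 0 := by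
  unfold Ker
  simp_rw [pk2_eq M hg]
  have hw : ∀ z z' : V × V, Integrable (fun η : V × V => wp g z η.1 * conj (wp g z' η.2)) := fun z z' =>
    (integrable_wp hg z).mul_prod (g := fun w => conj (wp g z' w)) ((Complex.conjLIE.integrable_comp_iff).mpr (integrable_wp hg z'))
  have hph : Measurable (fun q : (V × V) × (V × ℝ) => ee (ph M q.2 q.1.1 - ph M q.2 q.1.2)) := by
    refine measurable_ee.comp (Measurable.sub ?_ ?_)
    · exact (continuous_ph M).measurable.comp (by fun_prop : Measurable fun q : (V × V) × (V × ℝ) => (q.2, q.1.1))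
    · exact (continuous_ph M).measurable.comp (by fun_prop : Measurable fun q : (V × V) × (V × ℝ) => (q.2, q.1.2))
  have key := fub (hw ζ.1 ζ.2) (hw ζ'.1 ζ'.2) hph hph (C := 1) (fun q => (norm_ee _).le) (fun q => (norm_ee _).le)
    ((integrable_chi h1 h2 (by linarith : 0 < r) p0).ofReal (𝕜 := ℂ))
  refine key.trans ?_
  rw [← integral_zero ((V × V) × (V × V)) ℂ]
  congr 1; ext ⟨⟨a, b⟩, ⟨a', b'⟩⟩
  simp only
  by_cases hz : wp g ζ.1 a = 0 ∨ wp g ζ.2 b = 0 ∨ wp g ζ'.1 a' = 0 ∨ wp g ζ'.2 b' = 0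
  · rcases hz with hz | hz | hz | hz <;> simp [hz]
  push Not at hz
  have hs : ∀ z η, wp g z η ≠ 0 → ‖η - z.2‖ ≤ 1 := fun z η hh => by
    by_contra hc; exact hh (by simp [wp, hg.supp _ (not_le.mp hc)])
  obtain ⟨q1, q2, q3, q4⟩ := hz
  replace q1 := hs _ _ q1
  replace q2 := hs _ _ q2
  replace q3 := hs _ _ q3
  replace q4 := hs _ _ q4
  refine mul_eq_zero_of_right _ ?_
  have e : ∀ p : V × ℝ, ee (ph M p a - ph M p b) * conj (ee (ph M p a' - ph M p b')) =
      ee (⟪p.1, a - b - a' + b'⟫ + p.2 * (QQ M a - QQ M b - QQ M a' + QQ M b')) := fun p => by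
    rw [conj_ee, ← ee_add]; congr 1; unfold ph; simp only [inner_sub_right, inner_add_right]; ring
  have := chi_van h1 h2 (by linarith : 0 < r) p0 (a := a - b - a' + b') (s := QQ M a - QQ M b - QQ M a' + QQ M b') ?_
  · rw [← this]; congr 1; ext p; rw [← e p]; rfl
  by_contra hc
  push Not at hc
  refine h ⟨?_, ?_⟩
  · have : ζ.1.2 - ζ.2.2 - ζ'.1.2 + ζ'.2.2 = (a - b - a' + b') - (a - ζ.1.2) + (b - ζ.2.2) + (a' - ζ'.1.2) - (b' - ζ'.2.2) := by abel
    rw [this]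
    refine (norm_sub_le _ _).trans ?_
    have := norm_add_le ((a - b - a' + b') - (a - ζ.1.2) + (b - ζ.2.2)) (a' - ζ'.1.2)
    have := norm_add_le ((a - b - a' + b') - (a - ζ.1.2)) (b - ζ.2.2)
    have := norm_sub_le (a - b - a' + b') (a - ζ.1.2)
    linarith [hc.1]
  · have l1 := QQ_lip M hM k1 q1
    have l2 := QQ_lip M hM k2 q2
    have l3 := QQ_lip M hM k3 q3
    have l4 := QQ_lip M hM k4 q4
    have := hc.2
    rw [abs_le] at *
    constructor <;> nlinarith

lemma enorm_conj (z : ℂ) : ‖conj z‖ₑ = ‖z‖ₑ := by rw [← ofReal_norm, RCLike.norm_conj, ofReal_norm]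

open Classical in
lemma Ker_le (hM : ∀ a b, ⟪M a, b⟫ = ⟪a, M b⟫) (hg : Win g) (h1 : Chi X1) (h2 : Chi X2) (N : ℕ) (r0 : ℝ) :
    ∃ C : ℝ, 0 < C ∧ ∀ r : ℝ, 1 ≤ r → ∀ p0 : V × ℝ, |p0.2| ≤ 1 → ∀ ζ ζ' : (V × V) × (V × V),
    ‖ζ.1.2‖ ≤ r0 * r → ‖ζ.2.2‖ ≤ r0 * r → ‖ζ'.1.2‖ ≤ r0 * r → ‖ζ'.2.2‖ ≤ r0 * r →
    ‖Ker M g X1 X2 r p0 ζ ζ'‖ₑ ≤ ofReal (C / r) * ((if Rs M r0 r ζ ζ' then 1 else 0) *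
      ((ww N (pos M ζ.1 p0) * ww N (pos M ζ.2 p0)) * (ww N (pos M ζ'.1 p0) * ww N (pos M ζ'.2 p0)))) := by
  obtain ⟨C, hC, H⟩ := pk_le M hM hg N r0
  obtain ⟨C2, hC2, H2⟩ := chi_le h1 h2 (3 * N * 4)
  refine ⟨C ^ 4 * C2, by positivity, fun r hr p0 hp0 ζ ζ' k1 k2 k3 k4 => ?_⟩
  split_ifs with h
  swap
  · rw [Ker_zero M hM hg h1 h2 hr p0 k1 k2 k3 k4 h]; simp
  rw [one_mul]
  unfold Ker
  refine (enorm_integral_le_lintegral_enorm _).trans ?_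
  set W := (ww N (pos M ζ.1 p0) * ww N (pos M ζ.2 p0)) * (ww N (pos M ζ'.1 p0) * ww N (pos M ζ'.2 p0)) with hW
  calc _ ≤ ∫⁻ p, (ofReal C ^ 4 * W) * (ofReal (chi X1 X2 r p0 p) * ofReal (((1 + ‖p.1 - p0.1‖ ^ 2) * (1 + (r * (p.2 - p0.2)) ^ 2)) ^ (3 * N * 4))) := by
        refine lintegral_mono fun p => ?_
        simp only [enorm_mul, map_mul, enorm_conj, Complex.conj_conj]
        have := H r hr p0 hp0
        rw [← ofReal_norm, Complex.norm_real, Real.norm_of_nonneg (chi_nonneg h1 h2 r p0 p), pow_mul _ _ 4, ofReal_pow (by positivity)]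
        refine (mul_le_mul_right (mul_le_mul' (mul_le_mul' (this _ k1 p) (this _ k2 p)) (mul_le_mul' (this _ k3 p) (this _ k4 p))) _).trans_eq ?_
        rw [hW]; ring
    _ ≤ (ofReal C ^ 4 * W) * ofReal (C2 / r) := by
        rw [lintegral_const_mul' _ _ (by
          have := fun z => ww_ne_top N (pos M z p0)
          exact ENNReal.mul_ne_top (by simp) (ENNReal.mul_ne_top (ENNReal.mul_ne_top (this _) (this _)) (ENNReal.mul_ne_top (this _) (this _))))]
        gcongr; exact H2 r (by linarith) p0
    _ = _ := by
        rw [mul_div_assoc, ofReal_mul (by positivity), ofReal_pow hC.le]; ring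
end HP
end

noncomputable section
open MeasureTheory Metric Set
open scoped ENNReal NNReal FourierTransform RealInnerProductSpace ContDiff

namespace HP
open ENNReal (ofReal ofReal_mul ofReal_le_ofReal ofReal_pow ofReal_one ofReal_ne_top ofReal_pos ofReal_add)
set_option linter.unusedSectionVars false
variable {V : Type*} [NormedAddCommGroup V] [InnerProductSpace ℝ V] [FiniteDimensional ℝ V]
  [MeasurableSpace V] [BorelSpace V]
open ComplexConjugate

def pm (J : Set ℝ) : Measure (V × ℝ) := (volume : Measure (V × ℝ)).restrict (univ ×ˢ J)
instance (J : Set ℝ) : SFinite (pm (V := V) J) := by unfold pm; infer_instance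

variable (M : V ≃ₗᵢ[ℝ] V)
def DD (A : V × V → ℝ≥0∞) (p : V × ℝ) : ℝ≥0∞ := ∫⁻ z, A z ^ 2 * ww (Module.finrank ℝ V + 2) (pos M z p)
def mm (A : V × V → ℝ≥0∞) (J : Set ℝ) (z : V × V) : ℝ≥0∞ :=
  ∫⁻ p, DD M A p * ww (Module.finrank ℝ V + 2) (pos M z p) ∂(pm J)

def WI (V : Type*) [NormedAddCommGroup V] [InnerProductSpace ℝ V] [FiniteDimensional ℝ V]
  [MeasurableSpace V] [BorelSpace V] : ℝ≥0∞ := ∫⁻ v : V, ww (Module.finrank ℝ V + 1) v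
def WR : ℝ≥0∞ := ∫⁻ v : ℝ, ww 1 v
lemma WR_ne : WR ≠ ⊤ := (ww_int_lt_top (by simp)).ne
lemma WI_ne : WI V ≠ ⊤ := (ww_int_lt_top (by omega)).ne
lemma ex_ofReal {a : ℝ≥0∞} (h : a ≠ ⊤) : ∃ I : ℝ, 0 ≤ I ∧ a = ofReal I :=
  ⟨a.toReal, ENNReal.toReal_nonneg, (ENNReal.ofReal_toReal h).symm⟩
lemma lint_ww_le {N : ℕ} (h : Module.finrank ℝ V + 1 ≤ N) : ∫⁻ v : V, ww N v ≤ WI V :=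
  lintegral_mono fun v => ww_anti h v

lemma measurable_DD {A : V × V → ℝ≥0∞} (hA : Measurable A) : Measurable (DD M A) := by
  unfold DD
  exact Measurable.lintegral_prod_right' (f := fun q : (V × ℝ) × (V × V) => A q.2 ^ 2 * ww _ (pos M q.2 q.1)) (by fun_prop)
lemma measurable_mm {A : V × V → ℝ≥0∞} (hA : Measurable A) (J) : Measurable (mm M A J) := by
  have := measurable_DD M hA
  unfold mm
  exact Measurable.lintegral_prod_right' (f := fun q : (V × V) × (V × ℝ) => DD M A q.2 * ww _ (pos M q.1 q.2)) (by fun_prop)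

lemma ww_conv (N : ℕ) (a b : V) : ∫⁻ x, ww N (a - x) * ww (N + (Module.finrank ℝ V + 1)) (b - x) ≤
    ofReal (2 ^ N) * WI V * ww N (a - b) := by
  calc _ ≤ ∫⁻ x, (ofReal (2 ^ N) * ww N (a - b)) * ww (Module.finrank ℝ V + 1) (b - x) := by
        refine lintegral_mono fun x => ?_
        have h := peetre N (a - x) (-(b - x))
        rw [show a - x + -(b - x) = a - b by abel, norm_neg, mul_pow, ofReal_mul (by positivity)] at h
        refine (mul_le_mul_left h _).trans_eq ?_
        rw [← ww_mul_pow N (Module.finrank ℝ V + 1) (b - x)]; ring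
    _ = _ := by
        rw [lintegral_const_mul _ (by fun_prop), lintegral_sub_left_eq_self (fun v => ww (Module.finrank ℝ V + 1) v)]
        unfold WI; ring

lemma ww_dir (N : ℕ) {u e : V} {κ c : ℝ} (he : ‖e‖ = 1) (h : |⟪u, e⟫ - κ| ≤ c) :
    ww (N + 1) u ≤ ofReal (2 + 2 * c ^ 2) * ww 1 κ * ww N u := by
  rw [ww_add, mul_comm]
  gcongr
  unfold ww
  rw [← ofReal_mul (by positivity)]
  apply ofReal_le_ofReal
  rw [pow_one, pow_one, Real.norm_eq_abs, sq_abs, ← div_eq_mul_inv, inv_eq_one_div, div_le_div_iff₀ (by positivity) (by positivity)]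
  have h1 : |⟪u, e⟫| ≤ ‖u‖ := by simpa [he] using abs_real_inner_le_norm u e
  have h2 : ⟪u, e⟫ ^ 2 ≤ ‖u‖ ^ 2 := sq_le_sq' (by linarith [(abs_le.mp h1).1]) (abs_le.mp h1).2
  have h3 : (⟪u, e⟫ - κ) ^ 2 ≤ c ^ 2 := sq_le_sq' (by linarith [(abs_le.mp h).1]) (abs_le.mp h).2
  nlinarith [sq_nonneg (⟪u, e⟫ + (⟪u, e⟫ - κ)), mul_nonneg (sq_nonneg c) (sq_nonneg ‖u‖)]

lemma lint_M {f : V → ℝ≥0∞} (hf : Measurable f) {s : ℝ} (hs : s ≠ 0) (a c : V) :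
    ∫⁻ h, f (a + s • M (h - c)) = ofReal (|s| ^ Module.finrank ℝ V)⁻¹ * ∫⁻ v, f v := by
  rw [lintegral_sub_right_eq_self (fun h => f (a + s • M h)), ← lint_affine hf hs a]
  exact M.measurePreserving.lintegral_comp (f := fun h => f (a + s • h)) (by fun_prop)

lemma tube_line (hM : ∀ a b, ⟪M a, b⟫ = ⟪a, M b⟫) (z : V × V) (p0 : V × ℝ) (ξ1 e : V) {s : ℝ} (hs : 0 < s) (h : s ≤ |2 * ⟪M (z.2 - ξ1), e⟫|)
    (J : Set ℝ) :
    ∫⁻ p, ww (Module.finrank ℝ V + 2) (pos M z p) * ww 1 ⟪p.1 - p0.1 + (2 * (p.2 - p0.2)) • M ξ1, e⟫ ∂(pm J) ≤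
      ofReal s⁻¹ * (WI V * WR) := by
  have hMm : Measurable M := M.continuous.measurable
  unfold pm
  refine (setLIntegral_le_lintegral _ _).trans ?_
  rw [Measure.volume_eq_prod, lintegral_prod_symm' _ (by fun_prop)]
  set N := Module.finrank ℝ V + 2
  set s' := -(2 * ⟪M (z.2 - ξ1), e⟫) with hs'
  have hs0 : s' ≠ 0 := by
    rintro h0; rw [← abs_neg, ← hs', h0, abs_zero] at h; linarith
  have e1 : ∀ t : ℝ, ∫⁻ y, ww N (pos M z (y, t)) * ww 1 ⟪y - p0.1 + (2 * (t - p0.2)) • M ξ1, e⟫ =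
      ∫⁻ v, ww N v * ww 1 (⟪v + z.1 - p0.1 - (2 * p0.2) • M ξ1, e⟫ + s' * t) := fun t => by
    rw [← lintegral_add_right_eq_self _ (z.1 - (2 * t) • M z.2)]
    refine lintegral_congr fun v => ?_
    congr 2
    · unfold pos; module
    · rw [hs', map_sub]; simp only [inner_add_left, inner_sub_left, inner_smul_left]; simp; ring
  dsimp only
  simp_rw [e1]
  rw [lintegral_lintegral_swap (by fun_prop)]
  have e2 : ∀ v : V, ∫⁻ t : ℝ, ww N v * ww 1 (⟪v + z.1 - p0.1 - (2 * p0.2) • M ξ1, e⟫ + s' * t) =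
      ww N v * (ofReal |s'|⁻¹ * ∫⁻ v : ℝ, ww 1 v) := fun v => by
    rw [lintegral_const_mul _ (by fun_prop), lint_affineR (measurable_ww 1) hs0]
  simp_rw [e2]
  rw [lintegral_mul_const _ (by fun_prop)]
  calc _ ≤ WI V * (ofReal s⁻¹ * WR) := by
        gcongr
        · exact lint_ww_le (by omega)
        · rw [hs', abs_neg]; exact h
        · exact le_rfl
    _ = _ := by ring

open Classical in
def ri (r0 r : ℝ) (ζ ζ' : (V × V) × (V × V)) : ℝ≥0∞ := if Rs M r0 r ζ ζ' ∧ ‖ζ'.1.2‖ ≤ r0 * r then 1 else 0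

lemma measurable_ri (r0 r : ℝ) : Measurable fun q : ((V × V) × (V × V)) × ((V × V) × (V × V)) => ri M r0 r q.1 q.2 := by
  have hQ := measurable_QQ M
  unfold ri
  refine Measurable.ite ?_ measurable_const measurable_const
  unfold Rs
  exact ((measurableSet_le (by fun_prop : Measurable fun q : ((V × V) × (V × V)) × ((V × V) × (V × V)) =>
      ‖q.1.1.2 - q.1.2.2 - q.2.1.2 + q.2.2.2‖) measurable_const).inter
    (measurableSet_le (by fun_prop : Measurable fun q : ((V × V) × (V × V)) × ((V × V) × (V × V)) =>
      |QQ M q.1.1.2 - QQ M q.1.2.2 - QQ M q.2.1.2 + QQ M q.2.2.2|) measurable_const)).inter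
    (measurableSet_le (by fun_prop : Measurable fun q : ((V × V) × (V × V)) × ((V × V) × (V × V)) => ‖q.2.1.2‖) measurable_const)

lemma Rs_lin (hM : ∀ a b, ⟪M a, b⟫ = ⟪a, M b⟫) {r0 r : ℝ} (hr0 : 0 < r0) (hr : 1 ≤ r) {ζ ζ' : (V × V) × (V × V)} (h : Rs M r0 r ζ ζ')
    (k1 : ‖ζ.1.2‖ ≤ r0 * r) (k2 : ‖ζ.2.2‖ ≤ r0 * r) (k3 : ‖ζ'.1.2‖ ≤ r0 * r) :
    |⟪M (ζ'.1.2 - ζ.1.2), ζ.2.2 - ζ.1.2⟫| ≤ (21 + 22 * r0) * r := by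
  obtain ⟨⟨x1, a⟩, ⟨x2, b⟩⟩ := ζ
  obtain ⟨⟨x1', a'⟩, ⟨x2', b'⟩⟩ := ζ'
  obtain ⟨h1, h2⟩ := h
  simp only at *
  set o := a - b - a' + b' with ho
  set hh := a' - a with hhh
  have ea : a' = a + hh := by simp [hhh]
  have eb : b' = b + (hh + o) := by rw [ho, hhh]; abel
  have hhn : ‖hh‖ ≤ 2 * r0 * r := (norm_sub_le _ _).trans (by linarith)
  rw [ea, eb, QQ_add M hM a, QQ_add M hM b, QQ_add M hM hh, inner_add_right] at h2
  have c1 : |⟪M b, o⟫| ≤ r0 * r * 6 := (abs_real_inner_le_norm _ _).trans (by rw [M.norm_map]; gcongr)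
  have c2 : |⟪M hh, o⟫| ≤ 2 * r0 * r * 6 := (abs_real_inner_le_norm _ _).trans (by rw [M.norm_map]; gcongr)
  have c3 : |QQ M o| ≤ 6 * 6 := (abs_real_inner_le_norm _ _).trans (by rw [M.norm_map]; gcongr)
  have e : ⟪M hh, b - a⟫ = ⟪M b, hh⟫ - ⟪M a, hh⟫ := by
    rw [inner_sub_right, real_inner_comm, ← hM, real_inner_comm a, ← hM]
  rw [e]
  rw [abs_le] at *
  constructor <;> nlinarith

lemma inner_p (hM : ∀ a b, ⟪M a, b⟫ = ⟪a, M b⟫) {r0 l : ℝ} (hl : 0 < l) : ∃ C : ℝ, 0 < C ∧ ∀ r τ : ℝ, 1 ≤ r → 0 < τ →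
    ∀ ξ1 ξ2 : V, l * r ^ 2 ≤ |⟪M (ξ2 - ξ1), ξ2 - ξ1⟫| → ∀ p0 p : V × ℝ, τ ≤ |p.2 - p0.2| → |p.2 - p0.2| ≤ 1 →
    ∫⁻ z : V × V, {ξ | |⟪M (ξ - ξ1), ξ2 - ξ1⟫| ≤ (21 + 22 * r0) * r}.indicator 1 z.2 * (ww (Module.finrank ℝ V + 2) (pos M z p) *
      ww (Module.finrank ℝ V + 2 + (Module.finrank ℝ V + 1)) (pos M z p0)) ≤
    ofReal (C * (τ ^ Module.finrank ℝ V)⁻¹) * ww 1 ⟪p.1 - p0.1 + (2 * (p.2 - p0.2)) • M ξ1, ‖ξ2 - ξ1‖⁻¹ • (ξ2 - ξ1)⟫ := by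
  set c := 2 * (21 + 22 * r0) / √l with hc
  set n := Module.finrank ℝ V
  obtain ⟨I, hI0, hI⟩ := ex_ofReal (WI_ne (V := V))
  refine ⟨(2 ^ (n + 2) * (2 + 2 * c ^ 2)) * I * I + 1, by positivity, fun r τ hr hτ ξ1 ξ2 hl1 p0 p hp1 hp2 => ?_⟩
  have hMm : Measurable M := M.continuous.measurable
  set w := ξ2 - ξ1 with hw
  have hsl : 0 < √l := Real.sqrt_pos.mpr hl
  have hwn : √l * r ≤ ‖w‖ := by
    have h1 : l * r ^ 2 ≤ ‖w‖ ^ 2 := hl1.trans ((abs_real_inner_le_norm _ _).trans_eq (by rw [M.norm_map, sq]))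
    have : (√l * r) ^ 2 ≤ ‖w‖ ^ 2 := by rw [mul_pow, Real.sq_sqrt hl.le]; exact h1
    exact le_of_sq_le_sq this (norm_nonneg _)
  have hw0 : 0 < ‖w‖ := lt_of_lt_of_le (by positivity) hwn
  set e := ‖w‖⁻¹ • w with he
  have hen : ‖e‖ = 1 := by rw [he, norm_smul, norm_inv, norm_norm, inv_mul_cancel₀ hw0.ne']
  set S := {ξ : V | |⟪M (ξ - ξ1), w⟫| ≤ (21 + 22 * r0) * r} with hS
  have hSm : MeasurableSet S := measurableSet_le (by fun_prop) measurable_const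
  have hind : Measurable (S.indicator (1 : V → ℝ≥0∞)) := measurable_one.indicator hSm
  set τ' := p.2 - p0.2 with hτ'
  set Y := p.1 - p0.1 + (2 * τ') • M ξ1 with hY
  have hτ0 : 2 * τ' ≠ 0 := by
    intro h0; have : τ' = 0 := by linarith
    rw [this, abs_zero] at hp1; linarith
  have key : ∀ ξ, ∫⁻ x, S.indicator 1 (x, ξ).2 * (ww (n + 2) (pos M (x, ξ) p) * ww (n + 2 + (n + 1)) (pos M (x, ξ) p0)) ≤
      (ofReal (2 ^ (n + 2)) * WI V * (ofReal (2 + 2 * c ^ 2) * ww 1 ⟪Y, e⟫)) * ww (n + 1) (Y + (2 * τ') • M (ξ - ξ1)) := fun ξ => by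
    dsimp only
    rw [lintegral_const_mul _ (by fun_prop)]
    by_cases hξ : ξ ∈ S
    swap
    · rw [indicator_of_notMem hξ, zero_mul]; exact zero_le
    rw [indicator_of_mem hξ, Pi.one_apply, one_mul]
    have e1 : ∀ (x : V) (q : V × ℝ), pos M (x, ξ) q = (q.1 + (2 * q.2) • M ξ) - x := fun x q => by unfold pos; simp; abel
    simp_rw [e1]
    refine (ww_conv (n + 2) _ _).trans ?_
    have e2 : p.1 + (2 * p.2) • M ξ - (p0.1 + (2 * p0.2) • M ξ) = Y + (2 * τ') • M (ξ - ξ1) := by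
      rw [hY, hτ', map_sub]; module
    rw [e2, mul_assoc _ (_ * _) (ww _ _)]
    gcongr
    refine ww_dir (n + 1) hen ?_
    rw [inner_add_left, add_sub_cancel_left, he, inner_smul_left, inner_smul_right, abs_mul, abs_mul, hc]
    have h1 : |‖w‖⁻¹| * |⟪M (ξ - ξ1), w⟫| ≤ (21 + 22 * r0) / √l := by
      rw [abs_inv, abs_norm, ← div_eq_inv_mul, div_le_div_iff₀ hw0 hsl]
      have h2 : |⟪M (ξ - ξ1), w⟫| ≤ (21 + 22 * r0) * r := hξ
      have h3 : 0 ≤ 21 + 22 * r0 := by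
        by_contra hneg
        have := abs_nonneg ⟪M (ξ - ξ1), w⟫
        nlinarith
      nlinarith [mul_le_mul_of_nonneg_right h2 hsl.le]
    have h4 : |(starRingEnd ℝ) (2 * τ')| ≤ 2 := by simp only [conj_trivial, abs_mul, abs_two]; linarith
    calc _ ≤ 2 * ((21 + 22 * r0) / √l) := by gcongr
      _ = _ := by ring
  rw [Measure.volume_eq_prod, lintegral_prod_symm' _ (by fun_prop)]
  refine (lintegral_mono key).trans ?_
  rw [lintegral_const_mul _ (by fun_prop), lint_M M (measurable_ww _) hτ0]
  have h5 : (|2 * τ'| ^ n)⁻¹ ≤ (τ ^ n)⁻¹ := by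
    gcongr; rw [abs_mul, abs_two]; linarith [abs_nonneg τ']
  change _ * (_ * WI V) ≤ _
  rw [hI]
  calc _ = ofReal (2 ^ (n + 2)) * ofReal I * ofReal (2 + 2 * c ^ 2) * (ofReal (|2 * τ'| ^ n)⁻¹ * ofReal I) * ww 1 ⟪Y, e⟫ := by ring
    _ ≤ _ := by
      rw [← ofReal_mul (by positivity), ← ofReal_mul (by positivity), ← ofReal_mul (by positivity), ← ofReal_mul (by positivity)]
      refine mul_le_mul_left (ofReal_le_ofReal ?_) _
      have : 0 ≤ (τ ^ n)⁻¹ := by positivity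
      calc _ ≤ 2 ^ (n + 2) * I * (2 + 2 * c ^ 2) * ((τ ^ n)⁻¹ * I) := by gcongr
        _ ≤ _ := by nlinarith

lemma inner_le (hM : ∀ a b, ⟪M a, b⟫ = ⟪a, M b⟫) {r0 l : ℝ} (hr0 : 0 < r0) (hl : 0 < l) : ∃ C : ℝ, 0 < C ∧ ∀ r τ : ℝ, 1 ≤ r → 0 < τ →
    ∀ T1 T2 : Set V, (∀ ξ ∈ T1, ‖ξ‖ ≤ r0 * r) → (∀ ξ ∈ T2, ‖ξ‖ ≤ r0 * r) →
    (∀ ξ1 ∈ T1, ∀ ξ2 ∈ T2, ∀ ξ3 ∈ T2, l * r ^ 2 ≤ |⟪M (ξ3 - ξ1), ξ2 - ξ1⟫|) →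
    ∀ A : V × V → ℝ≥0∞, Measurable A → (∀ z, A z ≠ 0 → z.2 ∈ T2) →
    ∀ J : Set ℝ, MeasurableSet J → ∀ p0 : V × ℝ, (∀ t ∈ J, τ ≤ |t - p0.2| ∧ |t - p0.2| ≤ 1) →
    ∀ ζ : (V × V) × (V × V), ζ.1.2 ∈ T1 → ζ.2.2 ∈ T2 →
    ∫⁻ ζ', ri M r0 r ζ ζ' * (mm M A J ζ'.1 * (ww (Module.finrank ℝ V + 2 + (Module.finrank ℝ V + 1)) (pos M ζ'.1 p0) *
      ww (Module.finrank ℝ V + 2 + (Module.finrank ℝ V + 1)) (pos M ζ'.2 p0))) ≤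
    ofReal (C * (τ ^ Module.finrank ℝ V)⁻¹ / r) * ∫⁻ z, A z ^ 2 := by
  obtain ⟨C, hC, H⟩ := inner_p M hM (r0 := r0) hl
  set n := Module.finrank ℝ V
  set B := (volume (closedBall (0:V) 6)) with hB
  have hBt : B ≠ ⊤ := measure_closedBall_lt_top.ne
  obtain ⟨I, hI0, hI⟩ := ex_ofReal (WI_ne (V := V))
  obtain ⟨b, hb0, hb⟩ := ex_ofReal hBt
  obtain ⟨k, hk0, hk⟩ := ex_ofReal WR_ne
  refine ⟨b * I * C * (r0 / l) * I * k + 1, by positivity,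
    fun r τ hr hτ T1 T2 hT1 hT2 hsep A hA hAs J hJ p0 hp0 ζ hζ1 hζ2 => ?_⟩
  have hMm : Measurable M := M.continuous.measurable
  set ξ1 := ζ.1.2
  set ξ2 := ζ.2.2
  set w := ξ2 - ξ1 with hw
  set S := {ξ : V | |⟪M (ξ - ξ1), w⟫| ≤ (21 + 22 * r0) * r} with hS
  have hSm : MeasurableSet S := measurableSet_le (by fun_prop) measurable_const
  have hind : Measurable (S.indicator (1 : V → ℝ≥0∞)) := measurable_one.indicator hSm
  have hmm := measurable_mm M hA J
  have hDD := measurable_DD M hA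
  have hri := measurable_ri M r0 r
  set N' := n + 2 + (n + 1) with hN'
  set Bi : V → ℝ≥0∞ := (closedBall (0:V) 6).indicator 1 with hBi
  have hBim : Measurable Bi := measurable_one.indicator measurableSet_closedBall
  have a1 : ∀ ζ' : (V × V) × (V × V), ri M r0 r ζ ζ' ≤ S.indicator 1 ζ'.1.2 * Bi (ζ'.2.2 - (ζ'.1.2 + w)) := fun ζ' => by
    unfold ri
    split_ifs with h
    swap
    · exact zero_le
    have m1 : ζ'.1.2 ∈ S := Rs_lin M hM hr0 hr h.1 (hT1 _ hζ1) (hT2 _ hζ2) h.2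
    have m2 : ζ'.2.2 - (ζ'.1.2 + w) ∈ closedBall (0:V) 6 := by
      rw [mem_closedBall_zero_iff]
      have := h.1.1
      rwa [show ζ.1.2 - ζ.2.2 - ζ'.1.2 + ζ'.2.2 = ζ'.2.2 - (ζ'.1.2 + w) by rw [hw]; simp only [ξ1, ξ2]; abel] at this
    rw [hBi, indicator_of_mem m1, indicator_of_mem m2]; simp
  have a2 : ∀ z1 : V × V, ∫⁻ z2 : V × V, Bi (z2.2 - (z1.2 + w)) * ww N' (pos M z2 p0) ≤ B * WI V := fun z1 => by
    rw [Measure.volume_eq_prod, lintegral_prod_symm' _ (by fun_prop)]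
    dsimp only
    calc _ = ∫⁻ ξ, Bi (ξ - (z1.2 + w)) * ∫⁻ v : V, ww N' v := by
          refine lintegral_congr fun ξ => ?_
          rw [lintegral_const_mul _ (by fun_prop), lint_pos]
      _ = B * ∫⁻ v : V, ww N' v := by
          rw [lintegral_mul_const _ (by fun_prop), lintegral_sub_right_eq_self (fun v => Bi v), hBi, lintegral_indicator_one measurableSet_closedBall]
      _ ≤ _ := by gcongr; exact lint_ww_le (by omega)
  have a3 : ∀ p ∈ univ ×ˢ J, ∫⁻ z : V × V, S.indicator 1 z.2 * (ww (n + 2) (pos M z p) * ww N' (pos M z p0)) ≤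
     ofReal (C * (τ ^ n)⁻¹) * ww 1 ⟪p.1 - p0.1 + (2 * (p.2 - p0.2)) • M ξ1, ‖w‖⁻¹ • w⟫ := fun p hp =>
    H r τ hr hτ ξ1 ξ2 (hsep _ hζ1 _ hζ2 _ hζ2) p0 p (hp0 _ hp.2).1 (hp0 _ hp.2).2
  have hwn : ‖w‖ ≤ 2 * r0 * r := (norm_sub_le _ _).trans (by linarith [hT1 _ hζ1, hT2 _ hζ2])
  have hw0 : 0 < ‖w‖ := by
    by_contra h
    have h0 : w = 0 := by simpa using h
    have := hsep _ hζ1 _ hζ2 _ hζ2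
    rw [← hw, h0] at this; simp at this; nlinarith [mul_pos hl (by positivity : 0 < r ^ 2)]
  have a4 : ∀ z : V × V, A z ^ 2 * ∫⁻ p, ww (n + 2) (pos M z p) * ww 1 ⟪p.1 - p0.1 + (2 * (p.2 - p0.2)) • M ξ1, ‖w‖⁻¹ • w⟫ ∂(pm J)
      ≤ A z ^ 2 * (ofReal (l * r / r0)⁻¹ * (WI V * WR)) := fun z => by
    by_cases hz : A z = 0
    · simp [hz]
    gcongr
    refine tube_line M hM z p0 ξ1 _ (by positivity) ?_ J
    have := hsep _ hζ1 _ hζ2 _ (hAs z hz)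
    rw [inner_smul_right, abs_mul, abs_mul, abs_inv, abs_norm, abs_two, ← mul_assoc, mul_comm 2, mul_assoc, ← div_eq_inv_mul, div_le_div_iff₀ hr0 hw0]
    nlinarith [mul_le_mul_of_nonneg_left hwn (by positivity : 0 ≤ l * r)]
  calc _ ≤ ∫⁻ ζ' : (V × V) × (V × V), (S.indicator 1 ζ'.1.2 * (mm M A J ζ'.1 * ww N' (pos M ζ'.1 p0))) * (Bi (ζ'.2.2 - (ζ'.1.2 + w)) * ww N' (pos M ζ'.2 p0)) := by
        refine lintegral_mono fun ζ' => ?_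
        refine (mul_le_mul_left (a1 ζ') _).trans_eq (by ring)
    _ ≤ ∫⁻ z1 : V × V, (S.indicator 1 z1.2 * (mm M A J z1 * ww N' (pos M z1 p0))) * (B * WI V) := by
        rw [Measure.volume_eq_prod (V × V), lintegral_prod _ (by fun_prop)]
        refine lintegral_mono fun z1 => ?_
        dsimp only
        rw [lintegral_const_mul _ (by fun_prop)]
        gcongr; exact a2 z1
    _ = (B * WI V) * ∫⁻ z : V × V, ∫⁻ p, DD M A p * (S.indicator 1 z.2 * (ww (n + 2) (pos M z p) * ww N' (pos M z p0))) ∂(pm J) := by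
        rw [← lintegral_const_mul _ (Measurable.lintegral_prod_right' (f := fun q : (V × V) × (V × ℝ) => DD M A q.2 * (S.indicator 1 q.1.2 * (ww (n + 2) (pos M q.1 q.2) * ww N' (pos M q.1 p0)))) (by fun_prop))]
        refine lintegral_congr fun z => ?_
        rw [mul_comm]; congr 1
        unfold mm
        rw [← lintegral_mul_const _ (by fun_prop), ← lintegral_const_mul _ (by fun_prop)]
        refine lintegral_congr fun p => by ring
    _ ≤ (B * WI V) * ∫⁻ p, DD M A p * (ofReal (C * (τ ^ n)⁻¹) * ww 1 ⟪p.1 - p0.1 + (2 * (p.2 - p0.2)) • M ξ1, ‖w‖⁻¹ • w⟫) ∂(pm J) := by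
        rw [lintegral_lintegral_swap (by fun_prop)]
        refine mul_le_mul_right (lintegral_mono_ae ?_) _
        unfold pm
        filter_upwards [ae_restrict_mem (MeasurableSet.univ.prod hJ)] with p hp
        rw [lintegral_const_mul _ (by fun_prop)]
        gcongr; exact a3 p hp
    _ = (B * WI V) * (ofReal (C * (τ ^ n)⁻¹) * ∫⁻ z, A z ^ 2 * ∫⁻ p, ww (n + 2) (pos M z p) * ww 1 ⟪p.1 - p0.1 + (2 * (p.2 - p0.2)) • M ξ1, ‖w‖⁻¹ • w⟫ ∂(pm J)) := by
        congr 1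
        have : ∀ z : V × V, A z ^ 2 * ∫⁻ p, ww (n + 2) (pos M z p) * ww 1 ⟪p.1 - p0.1 + (2 * (p.2 - p0.2)) • M ξ1, ‖w‖⁻¹ • w⟫ ∂(pm J) =
          ∫⁻ p, A z ^ 2 * (ww (n + 2) (pos M z p) * ww 1 ⟪p.1 - p0.1 + (2 * (p.2 - p0.2)) • M ξ1, ‖w‖⁻¹ • w⟫) ∂(pm J) := fun z =>
          (lintegral_const_mul _ (by fun_prop)).symm
        simp_rw [this]
        rw [lintegral_lintegral_swap (by fun_prop), ← lintegral_const_mul _ (Measurable.lintegral_prod_right' (f := fun q : (V × ℝ) × (V × V) => A q.2 ^ 2 * (ww (n + 2) (pos M q.2 q.1) * ww 1 ⟪q.1.1 - p0.1 + (2 * (q.1.2 - p0.2)) • M ξ1, ‖w‖⁻¹ • w⟫)) (by fun_prop))]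
        refine lintegral_congr fun p => ?_
        unfold DD
        rw [mul_left_comm, ← lintegral_mul_const _ (by fun_prop)]
        congr 1; refine lintegral_congr fun z => by ring
    _ ≤ (B * WI V) * (ofReal (C * (τ ^ n)⁻¹) * ((∫⁻ z, A z ^ 2) * (ofReal (l * r / r0)⁻¹ * (WI V * WR)))) := by
        rw [← lintegral_mul_const _ (by fun_prop)]
        exact mul_le_mul_right (mul_le_mul_right (lintegral_mono a4) _) _
    _ ≤ _ := by
        rw [hI, hb, hk]
        calc _ = (ofReal b * ofReal I * (ofReal (C * (τ ^ n)⁻¹) * (ofReal (l * r / r0)⁻¹ * (ofReal I * ofReal k)))) * ∫⁻ z, A z ^ 2 := by ring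
          _ ≤ _ := by
            rw [← ofReal_mul (by positivity), ← ofReal_mul (by positivity), ← ofReal_mul (by positivity), ← ofReal_mul (by positivity), ← ofReal_mul (by positivity)]
            refine mul_le_mul_left (ofReal_le_ofReal ?_) _
            have : 0 < (τ ^ n)⁻¹ / r := by positivity
            have e : b * I * (C * (τ ^ n)⁻¹ * ((l * r / r0)⁻¹ * (I * k))) = b * I * C * (r0 / l) * I * k * ((τ ^ n)⁻¹ / r) := by
              field_simp
            rw [e, mul_div_assoc]; nlinarith
end HP
end

noncomputable section
open MeasureTheory Metric Set
open scoped ENNReal NNReal FourierTransform RealInnerProductSpace ContDiff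

namespace HP
open ENNReal (ofReal ofReal_mul ofReal_le_ofReal ofReal_pow ofReal_one ofReal_ne_top ofReal_pos ofReal_add)
set_option linter.unusedSectionVars false
variable {V : Type*} [NormedAddCommGroup V] [InnerProductSpace ℝ V] [FiniteDimensional ℝ V]
  [MeasurableSpace V] [BorelSpace V]
open ComplexConjugate

lemma mm_mono (M : V ≃ₗᵢ[ℝ] V) {A : V × V → ℝ≥0∞} {J J' : Set ℝ} (h : J ⊆ J') (z) : mm M A J z ≤ mm M A J' z :=
  lintegral_mono_set (prod_mono subset_rfl h)

lemma amgm {m m' i i' X Y : ℝ≥0∞} (h : m * i ≤ 1) (h' : m' * i' ≤ 1) :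
    (m * i * X) * (m' * i' * Y) ≤ m' * i * X ^ 2 + m * i' * Y ^ 2 := by
  rcases le_total (m * i' * Y) X with hX | hX
  · refine le_add_right ?_
    calc _ = m' * i * X * (m * i' * Y) := by ring
      _ ≤ m' * i * X * X := by gcongr
      _ = _ := by ring
  · refine le_add_left ?_
    calc _ = (m * i) * (m' * i') * X * Y := by ring
      _ ≤ 1 * 1 * (m * i' * Y) * Y := by gcongr
      _ = _ := by ring

variable (M : V ≃ₗᵢ[ℝ] V) {g : V → ℝ} {X1 : V → ℝ} {X2 : ℝ → ℝ}

lemma chi_lower (h1 : Chi X1) (h2 : Chi X2) : ∃ c : ℝ, 0 < c ∧ ∀ r a L : ℝ, 0 < r → 1 ≤ L * r → ∀ p : V × ℝ, p.2 ∈ Ico a (a + L) →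
    ofReal (c / r) ≤ ∫⁻ p0, ofReal (chi X1 X2 r p0 p) ∂(pm (Ico a (a + L))) := by
  obtain ⟨s1, c1, hs1, hs1', hc1, H1⟩ := h1.pos
  obtain ⟨s2, c2, hs2, hs2', hc2, H2⟩ := h2.pos
  obtain ⟨b, hb0, hb⟩ := ex_ofReal (measure_closedBall_lt_top (μ := (volume : Measure V)) (x := 0) (r := s1)).ne
  have hbp : 0 < b := by
    have := measure_closedBall_pos (volume : Measure V) 0 hs1
    rw [hb] at this; exact ENNReal.ofReal_pos.mp this
  refine ⟨c1 * c2 * (b * (s2 / 2)), by positivity, fun r a L hr hL p hp => ?_⟩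
  have main : ∀ t1, Ico t1 (t1 + s2 / (2 * r)) ⊆ Ico a (a + L) → (∀ t ∈ Ico t1 (t1 + s2 / (2 * r)), |p.2 - t| ≤ s2 / r) →
      ofReal (c1 * c2 * (b * (s2 / 2)) / r) ≤ ∫⁻ p0, ofReal (chi X1 X2 r p0 p) ∂(pm (Ico a (a + L))) := by
    intro t1 hsub hd
    calc _ = ∫⁻ p0 in closedBall p.1 s1 ×ˢ Ico t1 (t1 + s2 / (2 * r)), ofReal (c1 * c2) := by
          rw [setLIntegral_const, Measure.volume_eq_prod, Measure.prod_prod, Measure.addHaar_closedBall_center, hb, Real.volume_Ico,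
            ← ofReal_mul (by positivity), ← ofReal_mul (by positivity)]
          congr 1; field_simp; ring
      _ ≤ ∫⁻ p0 in closedBall p.1 s1 ×ˢ Ico t1 (t1 + s2 / (2 * r)), ofReal (chi X1 X2 r p0 p) := by
          refine setLIntegral_mono' (measurableSet_closedBall.prod measurableSet_Ico) fun p0 hp0 => ofReal_le_ofReal ?_
          unfold chi
          refine mul_le_mul (H1 _ ?_) (H2 _ ?_) hc2.le (h1.nonneg _)
          · rw [← dist_eq_norm, dist_comm]; exact hp0.1
          · rw [Real.norm_eq_abs, abs_mul, abs_of_pos hr]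
            have := hd _ hp0.2
            rw [le_div_iff₀ hr] at this; linarith
      _ ≤ _ := lintegral_mono_set (prod_mono (subset_univ _) hsub)
  have hL2 : s2 / (2 * r) ≤ L / 2 := by rw [div_le_div_iff₀ (by positivity) (by norm_num)]; nlinarith
  have hh : s2 / (2 * r) ≤ s2 / r := by gcongr; linarith
  have hh0 : 0 < s2 / (2 * r) := by positivity
  obtain ⟨hp1, hp2⟩ := hp
  by_cases hc : p.2 ≤ a + L / 2
  · refine main p.2 (fun t ht => ⟨by linarith [ht.1], by linarith [ht.2]⟩) fun t ht => ?_
    rw [abs_le]; constructor <;> linarith [ht.1, ht.2]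
  · refine main (p.2 - s2 / (2 * r)) (fun t ht => ⟨by linarith [ht.1], by linarith [ht.2]⟩) fun t ht => ?_
    rw [abs_le]; constructor <;> linarith [ht.1, ht.2]

lemma pk_bdd (hg : Win g) : ∃ C : ℝ, ∀ z p, ‖pk M g z p‖ ≤ C := by
  refine ⟨∫ u, ‖g u‖, fun z p => ?_⟩
  unfold pk EE
  refine (norm_integral_le_integral_norm _).trans_eq ?_
  simp only [wp, norm_mul, norm_ee, mul_one, Complex.norm_real]
  exact integral_sub_right_eq_self (fun u => ‖g u‖) z.2

lemma Rs_symm {r0 r : ℝ} {ζ ζ' : (V × V) × (V × V)} (h : Rs M r0 r ζ ζ') : Rs M r0 r ζ' ζ := by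
  refine ⟨?_, ?_⟩
  · have := h.1; rw [← norm_neg] at this
    rwa [show ζ'.1.2 - ζ'.2.2 - ζ.1.2 + ζ.2.2 = -(ζ.1.2 - ζ.2.2 - ζ'.1.2 + ζ'.2.2) by abel]
  · have := h.2; rw [← abs_neg] at this
    rwa [show QQ M ζ'.1.2 - QQ M ζ'.2.2 - QQ M ζ.1.2 + QQ M ζ.2.2 = -(QQ M ζ.1.2 - QQ M ζ.2.2 - QQ M ζ'.1.2 + QQ M ζ'.2.2) by ring]

lemma lint_sym {X : Type*} [MeasureSpace X] [SFinite (volume : Measure X)] {F : X → X → ℝ≥0∞}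
    (h : Measurable fun q : X × X => F q.1 q.2) (c : ℝ≥0∞) :
    ∫⁻ q : X × X, c * (F q.1 q.2 + F q.2 q.1) = c * (2 * ∫⁻ q : X × X, F q.1 q.2) := by
  have hs : Measurable fun q : X × X => F q.2 q.1 := h.comp measurable_swap
  have ha : Measurable fun q : X × X => F q.1 q.2 + F q.2 q.1 := h.add hs
  rw [lintegral_const_mul _ ha, lintegral_add_left h, two_mul]
  congr 2
  rw [Measure.volume_eq_prod]
  exact lintegral_prod_swap (fun q : X × X => F q.1 q.2)

set_option maxHeartbeats 1000000 in
lemma cross (hM : ∀ a b, ⟪M a, b⟫ = ⟪a, M b⟫) (hg : Win g) {r0 l : ℝ} (hr0 : 0 < r0) (hl : 0 < l) : ∃ C : ℝ, 0 < C ∧ ∀ r τ : ℝ, 1 ≤ r → 0 < τ →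
    ∀ T1 T2 : Set V, (∀ ξ ∈ T1, ‖ξ‖ ≤ r0 * r) → (∀ ξ ∈ T2, ‖ξ‖ ≤ r0 * r) →
    (∀ ξ1 ∈ T1, ∀ ξ2 ∈ T2, ∀ ξ3 ∈ T2, l * r ^ 2 ≤ |⟪M (ξ3 - ξ1), ξ2 - ξ1⟫|) →
    ∀ A1 A2 : V × V → ℝ≥0∞, Measurable A1 → Measurable A2 → (∀ z, A1 z ≠ 0 → z.2 ∈ T1) → (∀ z, A2 z ≠ 0 → z.2 ∈ T2) →
    ∀ J : Set ℝ, MeasurableSet J → J ⊆ Icc 0 1 → ∀ a L : ℝ, 1 ≤ L * r → Ico a (a + L) ⊆ Icc 0 1 →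
    (∀ t ∈ J, ∀ t0 ∈ Ico a (a + L), τ ≤ |t - t0|) →
    ∀ u1 u2 : V × V → ℂ, Measurable u1 → Measurable u2 → Integrable u1 → Integrable u2 →
    (∀ z, ‖u1 z‖ₑ ≤ mm M A2 J z / mm M A2 (Icc 0 1) z * A1 z) → (∀ z, ‖u2 z‖ₑ ≤ A2 z) →
    ∫⁻ p, (‖EE M (VS g u1) p‖ₑ * ‖EE M (VS g u2) p‖ₑ) ^ 2 ∂(pm (Ico a (a + L))) ≤
      ofReal (C * (τ ^ Module.finrank ℝ V)⁻¹ / r) * ((∫⁻ z, A1 z ^ 2) * ∫⁻ z, A2 z ^ 2) := by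
  obtain ⟨X1, h1⟩ := exists_chi (V := V)
  obtain ⟨X2, h2⟩ := exists_chi (V := ℝ)
  set n := Module.finrank ℝ V
  set N' := n + 2 + (n + 1) with hN'
  obtain ⟨Ck, hCk, HK⟩ := Ker_le M hM hg h1 h2 N' r0
  obtain ⟨Ci, hCi, HI⟩ := inner_le M hM hr0 hl
  obtain ⟨c, hc, HL⟩ := chi_lower h1 h2
  obtain ⟨Cp, HP⟩ := pk_bdd M hg
  refine ⟨2 * Ck * Ci / c, by positivity, fun r τ hr hτ T1 T2 hT1 hT2 hsep A1 A2 hA1 hA2 hs1 hs2 J hJ hJI a L hL hLI hJL u1 u2 hu1 hu2 hi1 hi2 hb1 hb2 => ?_⟩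
  have hrp : 0 < r := by linarith
  set J' := Ico a (a + L) with hJ'
  set m := mm M A2 (Icc 0 1) with hm
  have hmM : Measurable m := measurable_mm M hA2 _
  have hmJ : Measurable (mm M A2 J) := measurable_mm M hA2 _
  have hDD := measurable_DD M hA2
  have hri := measurable_ri M r0 r
  set U : (V × V) × (V × V) → ℂ := fun ζ => u1 ζ.1 * conj (u2 ζ.2) with hU
  have hUi : Integrable U := hi1.mul_prod (g := fun w => conj (u2 w)) ((Complex.conjLIE.integrable_comp_iff).mpr hi2)
  set T : ((V × V) × (V × V)) × (V × ℝ) → ℂ := fun q => pk M g q.1.1 q.2 * conj (pk M g q.1.2 q.2) with hT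
  have hpkm := measurable_pk M hg
  have hTm : Measurable T := (hpkm.comp (by fun_prop : Measurable fun q : ((V × V) × (V × V)) × (V × ℝ) => (q.1.1, q.2))).mul
    (Complex.continuous_conj.measurable.comp (hpkm.comp (by fun_prop : Measurable fun q : ((V × V) × (V × V)) × (V × ℝ) => (q.1.2, q.2))))
  have hTb : ∀ q, ‖T q‖ ≤ Cp * Cp := fun q => by
    rw [hT]; simp only [norm_mul, RCLike.norm_conj]
    exact mul_le_mul (HP _ _) (HP _ _) (norm_nonneg _) ((norm_nonneg _).trans (HP q.1.1 q.2))
  have hG : ∀ p, (‖EE M (VS g u1) p‖ₑ * ‖EE M (VS g u2) p‖ₑ) = ‖∫ ζ, U ζ * T (ζ, p)‖ₑ := fun p => by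
    rw [EE_VS M hg hu1 hi1, EE_VS M hg hu2 hi2, ← enorm_conj (∫ z, u2 z * _), ← enorm_mul, ← integral_conj, ← integral_prod_mul, Measure.volume_eq_prod]
    congr 2; ext ζ; rw [hU, hT]; simp only [map_mul]; ring
  set Φ : (V × ℝ) → ((V × V) × (V × V)) → ((V × V) × (V × V)) → ℝ≥0∞ := fun p0 ζ ζ' =>
    (mm M A2 J ζ'.1 * (m ζ.1)⁻¹ * (A1 ζ.1 * A2 ζ.2) ^ 2) * (ri M r0 r ζ ζ' *
      ((ww N' (pos M ζ.1 p0) * ww N' (pos M ζ.2 p0)) * (ww N' (pos M ζ'.1 p0) * ww N' (pos M ζ'.2 p0)))) with hΦ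
  have hUb : ∀ ζ, ‖U ζ‖ₑ ≤ mm M A2 J ζ.1 * (m ζ.1)⁻¹ * (A1 ζ.1 * A2 ζ.2) := fun ζ => by
    rw [hU]; simp only [enorm_mul, enorm_conj]
    refine (mul_le_mul' (hb1 _) (hb2 _)).trans_eq ?_
    rw [div_eq_mul_inv]; ring
  have hmi : ∀ J₁ ⊆ Icc (0:ℝ) 1, ∀ z, mm M A2 J₁ z * (m z)⁻¹ ≤ 1 := fun J₁ hJ₁ z => by
    rw [← div_eq_mul_inv]; exact ENNReal.div_le_of_le_mul (by rw [one_mul]; exact mm_mono M hJ₁ z)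
  have hpt : ∀ p0 : V × ℝ, p0.2 ∈ J' → ∀ ζ ζ', ‖U ζ‖ₑ * ‖U ζ'‖ₑ * ‖Ker M g X1 X2 r p0 ζ ζ'‖ₑ ≤
      ofReal (Ck / r) * (Φ p0 ζ ζ' + Φ p0 ζ' ζ) := fun p0 hp0 ζ ζ' => by
    by_cases hz : A1 ζ.1 * A2 ζ.2 = 0
    · have := hUb ζ; rw [hz, mul_zero] at this; rw [nonpos_iff_eq_zero.mp this]; simp
    by_cases hz' : A1 ζ'.1 * A2 ζ'.2 = 0
    · have := hUb ζ'; rw [hz', mul_zero] at this; rw [nonpos_iff_eq_zero.mp this]; simp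
    have m1 := hT1 _ (hs1 _ (left_ne_zero_of_mul hz))
    have m2 := hT2 _ (hs2 _ (right_ne_zero_of_mul hz))
    have m3 := hT1 _ (hs1 _ (left_ne_zero_of_mul hz'))
    have m4 := hT2 _ (hs2 _ (right_ne_zero_of_mul hz'))
    have k := HK r hr p0 (by have := hLI hp0; rw [abs_of_nonneg this.1]; exact this.2) ζ ζ' m1 m2 m3 m4
    by_cases hR : Rs M r0 r ζ ζ'
    swap
    · rw [if_neg hR, zero_mul, mul_zero] at k; rw [nonpos_iff_eq_zero.mp k]; simp
    rw [if_pos hR, one_mul] at k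
    have e1 : ri M r0 r ζ ζ' = 1 := by unfold ri; exact if_pos ⟨hR, m3⟩
    have e2 : ri M r0 r ζ' ζ = 1 := by unfold ri; exact if_pos ⟨Rs_symm M hR, m1⟩
    simp only [hΦ, e1, e2, one_mul]
    set W := ww N' (pos M ζ.1 p0) * ww N' (pos M ζ.2 p0)
    set W' := ww N' (pos M ζ'.1 p0) * ww N' (pos M ζ'.2 p0)
    calc _ ≤ (mm M A2 J ζ.1 * (m ζ.1)⁻¹ * (A1 ζ.1 * A2 ζ.2)) * (mm M A2 J ζ'.1 * (m ζ'.1)⁻¹ * (A1 ζ'.1 * A2 ζ'.2)) * (ofReal (Ck / r) * (W * W')) := by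
          gcongr; exacts [hUb _, hUb _]
      _ ≤ (mm M A2 J ζ'.1 * (m ζ.1)⁻¹ * (A1 ζ.1 * A2 ζ.2) ^ 2 + mm M A2 J ζ.1 * (m ζ'.1)⁻¹ * (A1 ζ'.1 * A2 ζ'.2) ^ 2) * (ofReal (Ck / r) * (W * W')) := by
          gcongr; exact amgm (hmi J hJI _) (hmi J hJI _)
      _ = _ := by ring
  have hΦm : ∀ p0, Measurable fun q : ((V × V) × (V × V)) × ((V × V) × (V × V)) => Φ p0 q.1 q.2 := fun p0 => by
    simp only [hΦ]; fun_prop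
  set cin := ofReal (Ci * (τ ^ n)⁻¹ / r) * ∫⁻ z, A2 z ^ 2 with hcin
  set Ψ : (V × ℝ) → (V × V) × (V × V) → ℝ≥0∞ := fun p0 ζ => (m ζ.1)⁻¹ * (A1 ζ.1 * A2 ζ.2) ^ 2 * (ww (n + 2) (pos M ζ.1 p0) * ww (n + 2) (pos M ζ.2 p0)) with hΨ
  have hΦi : ∀ p0 : V × ℝ, p0.2 ∈ J' → ∫⁻ q : ((V × V) × (V × V)) × ((V × V) × (V × V)), Φ p0 q.1 q.2 ≤ cin * ∫⁻ ζ, Ψ p0 ζ := fun p0 hp0 => by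
    rw [Measure.volume_eq_prod, lintegral_prod _ (hΦm p0).aemeasurable, ← lintegral_const_mul _ (by simp only [hΨ]; fun_prop)]
    refine lintegral_mono fun ζ => ?_
    simp only [hΦ, hΨ]
    by_cases hz : A1 ζ.1 * A2 ζ.2 = 0
    · simp [hz]
    have k := HI r τ hr hτ T1 T2 hT1 hT2 hsep A2 hA2 hs2 J hJ p0 (fun t ht => ⟨hJL t ht _ hp0, by
      have a1 := hJI ht; have a2 := hLI hp0; rw [abs_le]; constructor <;> linarith [a1.1, a1.2, a2.1, a2.2]⟩) ζ
      (hs1 _ (left_ne_zero_of_mul hz)) (hs2 _ (right_ne_zero_of_mul hz))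
    have hriζ : Measurable fun ζ' => ri M r0 r ζ ζ' := hri.comp (by fun_prop : Measurable fun ζ' => (ζ, ζ'))
    calc _ = ∫⁻ ζ', ((m ζ.1)⁻¹ * (A1 ζ.1 * A2 ζ.2) ^ 2 * (ww N' (pos M ζ.1 p0) * ww N' (pos M ζ.2 p0))) * (ri M r0 r ζ ζ' * (mm M A2 J ζ'.1 * (ww N' (pos M ζ'.1 p0) * ww N' (pos M ζ'.2 p0)))) := by
          refine lintegral_congr fun ζ' => by ring
      _ ≤ ((m ζ.1)⁻¹ * (A1 ζ.1 * A2 ζ.2) ^ 2 * (ww N' (pos M ζ.1 p0) * ww N' (pos M ζ.2 p0))) * cin := by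
          rw [lintegral_const_mul _ (by fun_prop)]; gcongr
      _ ≤ ((m ζ.1)⁻¹ * (A1 ζ.1 * A2 ζ.2) ^ 2 * (ww (n + 2) (pos M ζ.1 p0) * ww (n + 2) (pos M ζ.2 p0))) * cin := by
          gcongr <;> exact ww_anti (by omega) _
      _ = _ := mul_comm _ _
  have hΨi : ∫⁻ p0, (∫⁻ ζ, Ψ p0 ζ) ∂(pm J') ≤ ∫⁻ z, A1 z ^ 2 := by
    have e1 : ∀ p0, ∫⁻ ζ, Ψ p0 ζ = ∫⁻ z, ((m z)⁻¹ * A1 z ^ 2) * (DD M A2 p0 * ww (n + 2) (pos M z p0)) := fun p0 => by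
      rw [Measure.volume_eq_prod, lintegral_prod _ (by simp only [hΨ]; fun_prop)]
      refine lintegral_congr fun z => ?_
      unfold DD
      rw [← lintegral_mul_const _ (by fun_prop), ← lintegral_const_mul _ (by fun_prop)]
      refine lintegral_congr fun z2 => ?_
      simp only [hΨ]; ring
    simp_rw [e1]
    rw [lintegral_lintegral_swap (by fun_prop)]
    refine lintegral_mono fun z => ?_
    rw [lintegral_const_mul _ (by fun_prop)]
    change _ * mm M A2 J' z ≤ _
    calc _ = (mm M A2 J' z * (m z)⁻¹) * A1 z ^ 2 := by ring
      _ ≤ 1 * A1 z ^ 2 := by gcongr; exact hmi J' hLI z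
      _ = _ := one_mul _
  have hp0 : ∀ p0 : V × ℝ, p0.2 ∈ J' → ∫⁻ p, ofReal (chi X1 X2 r p0 p) * ‖∫ ζ, U ζ * T (ζ, p)‖ₑ ^ 2 ≤
      ofReal (2 * Ck / r) * cin * ∫⁻ ζ, Ψ p0 ζ := fun p0 hp0 => by
    refine (fub_sq hUi hTm hTb (integrable_chi h1 h2 hrp p0) (chi_nonneg h1 h2 r p0)).trans ?_
    calc _ ≤ ∫⁻ q : ((V × V) × (V × V)) × ((V × V) × (V × V)), ofReal (Ck / r) * (Φ p0 q.1 q.2 + Φ p0 q.2 q.1) :=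
          lintegral_mono fun q => hpt p0 hp0 q.1 q.2
      _ = ofReal (Ck / r) * (2 * ∫⁻ q : ((V × V) × (V × V)) × ((V × V) × (V × V)), Φ p0 q.1 q.2) := lint_sym (hΦm p0) _
      _ ≤ ofReal (Ck / r) * (2 * (cin * ∫⁻ ζ, Ψ p0 ζ)) := by gcongr; exact hΦi p0 hp0
      _ = _ := by
          rw [mul_div_assoc, ofReal_mul (by norm_num), ENNReal.ofReal_ofNat]; ring
  have hH : Measurable fun p => ‖∫ ζ, U ζ * T (ζ, p)‖ₑ ^ 2 := by
    simp_rw [← hG]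
    exact ((measurable_EE M (measurable_VS hg hu1)).enorm.mul (measurable_EE M (measurable_VS hg hu2)).enorm).pow_const 2
  have hchm : Measurable fun q : (V × ℝ) × (V × ℝ) => ofReal (chi X1 X2 r q.1 q.2) :=
    ENNReal.measurable_ofReal.comp (chi_cont h1 h2 r).measurable
  simp_rw [hG]
  have fin : ofReal (c / r) * ∫⁻ p, ‖∫ ζ, U ζ * T (ζ, p)‖ₑ ^ 2 ∂(pm J') ≤ ofReal (2 * Ck / r) * cin * ∫⁻ z, A1 z ^ 2 := by
    calc _ ≤ ∫⁻ p, (∫⁻ p0, ofReal (chi X1 X2 r p0 p) ∂(pm J')) * ‖∫ ζ, U ζ * T (ζ, p)‖ₑ ^ 2 ∂(pm J') := by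
          rw [← lintegral_const_mul _ hH]
          refine lintegral_mono_ae ?_
          unfold pm
          filter_upwards [ae_restrict_mem (MeasurableSet.univ.prod measurableSet_Ico)] with p hp
          gcongr; exact HL r a L hrp hL p hp.2
      _ ≤ ∫⁻ p, (∫⁻ p0, ofReal (chi X1 X2 r p0 p) ∂(pm J')) * ‖∫ ζ, U ζ * T (ζ, p)‖ₑ ^ 2 := setLIntegral_le_lintegral _ _
      _ = ∫⁻ p, (∫⁻ p0, ofReal (chi X1 X2 r p0 p) * ‖∫ ζ, U ζ * T (ζ, p)‖ₑ ^ 2 ∂(pm J')) := by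
          refine lintegral_congr fun p => ?_
          have hs : Measurable fun p0 => ofReal (chi X1 X2 r p0 p) := hchm.comp (by fun_prop : Measurable fun p0 => (p0, p))
          rw [lintegral_mul_const _ hs]
      _ = ∫⁻ p0, (∫⁻ p, ofReal (chi X1 X2 r p0 p) * ‖∫ ζ, U ζ * T (ζ, p)‖ₑ ^ 2) ∂(pm J') := by
          refine lintegral_lintegral_swap (Measurable.aemeasurable ?_)
          exact (hchm.comp measurable_swap).mul (hH.comp measurable_fst)
      _ ≤ ∫⁻ p0, ofReal (2 * Ck / r) * cin * (∫⁻ ζ, Ψ p0 ζ) ∂(pm J') := by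
          refine lintegral_mono_ae ?_
          unfold pm
          filter_upwards [ae_restrict_mem (MeasurableSet.univ.prod measurableSet_Ico)] with p hp
          exact hp0 p hp.2
      _ ≤ _ := by
          rw [lintegral_const_mul _ (Measurable.lintegral_prod_right' (f := fun q : (V × ℝ) × ((V × V) × (V × V)) => Ψ q.1 q.2) (by simp only [hΨ]; fun_prop))]
          gcongr
  have hcr : 0 < c / r := by positivity
  rw [mul_comm, ← ENNReal.le_div_iff_mul_le (Or.inl (ENNReal.ofReal_pos.mpr hcr).ne') (Or.inl ofReal_ne_top)] at fin
  refine fin.trans_eq ?_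
  rw [hcin, div_eq_mul_inv, ← ENNReal.ofReal_inv_of_pos hcr]
  rw [show 2 * Ck * Ci / c * (τ ^ n)⁻¹ / r = (2 * Ck / r) * (Ci * (τ ^ n)⁻¹ / r) * (c / r)⁻¹ by field_simp, ofReal_mul (by positivity), ofReal_mul (by positivity)]
  ring
end HP
end

noncomputable section
open MeasureTheory Metric Set
open scoped ENNReal NNReal FourierTransform RealInnerProductSpace ContDiff

namespace HP
open ENNReal (ofReal ofReal_mul ofReal_le_ofReal ofReal_pow ofReal_one ofReal_ne_top ofReal_pos ofReal_add)
set_option linter.unusedSectionVars false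
variable {V : Type*} [NormedAddCommGroup V] [InnerProductSpace ℝ V] [FiniteDimensional ℝ V]
  [MeasurableSpace V] [BorelSpace V]
open ComplexConjugate

lemma le_of_sq {a b : ℝ≥0∞} (h : a ^ 2 ≤ b ^ 2) : a ≤ b :=
  le_of_not_gt fun k => (ENNReal.pow_lt_pow_left two_ne_zero k).not_ge h

variable (M : V ≃ₗᵢ[ℝ] V) {g : V → ℝ}

def Sep (r l : ℝ) (S1 S2 : Set V) : Prop := ∀ ξ1 ∈ S1, ∀ ξ2 ∈ S2, ∀ ξ3 ∈ S2, l * r ^ 2 ≤ |⟪M (ξ3 - ξ1), ξ2 - ξ1⟫|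

def Wt (α r : ℝ) (W : V × ℝ → ℝ≥0∞) : Prop := Measurable W ∧ (∀ p, W p ≤ 1) ∧ ∀ (y0 : V) (t1 s : ℝ), 1 ≤ s →
  ∫⁻ p in closedBall y0 (s / r) ×ˢ Icc (t1 - s / r ^ 2) (t1 + s / r ^ 2), W p ≤ ofReal ((r ^ (Module.finrank ℝ V + 2))⁻¹ * s ^ α)

def Bil (α γ : ℝ) : Prop := ∀ r0 l : ℝ, 0 < r0 → 0 < l → ∃ C : ℝ, 0 < C ∧ ∀ r T t0 : ℝ, 1 ≤ r → 0 < T → 1 ≤ r ^ 2 * T →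
  ∀ S1 S2 : Set V, (∀ ξ ∈ S1, ‖ξ‖ ≤ r0 * r) → (∀ ξ ∈ S2, ‖ξ‖ ≤ r0 * r) → Sep M r l S1 S2 → Sep M r l S2 S1 →
  ∀ W : V × ℝ → ℝ≥0∞, Wt α r W → ∀ f1 f2 : V → ℂ, Measurable f1 → Measurable f2 → Integrable f1 → Integrable f2 →
  (∀ ξ, f1 ξ ≠ 0 → ξ ∈ S1) → (∀ ξ, f2 ξ ≠ 0 → ξ ∈ S2) →
  ∫⁻ p, ‖EE M f1 p‖ₑ * ‖EE M f2 p‖ₑ * W p ∂(pm (Ico t0 (t0 + T))) ≤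
    ofReal (C * (r ^ 2)⁻¹ * (r ^ 2 * T) ^ γ) * (nn f1 + nn f2)

def an (A : V × V → ℝ≥0∞) (J : Set ℝ) (z : V × V) : ℝ≥0∞ := mm M A J z / mm M A (Icc 0 1) z

lemma pm_eq (J : Set ℝ) : (pm J : Measure (V × ℝ)) = (volume : Measure V).prod (volume.restrict J) := by
  unfold pm
  rw [Measure.volume_eq_prod, ← Measure.prod_restrict, Measure.restrict_univ]

lemma mm_pos {A : V × V → ℝ≥0∞} (hA : Measurable A) (h : ∫⁻ z, A z ^ 2 ≠ 0) (z) : mm M A (Icc 0 1) z ≠ 0 := by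
  have hD := measurable_DD M hA
  have hDp : ∀ p, DD M A p ≠ 0 := fun p => by
    unfold DD
    intro h0
    rw [lintegral_eq_zero_iff (by fun_prop)] at h0
    apply h
    rw [lintegral_eq_zero_iff (by fun_prop)]
    filter_upwards [h0] with z hz
    simpa [(ww_pos _ _).ne'] using hz
  unfold mm
  rw [← pos_iff_ne_zero, lintegral_pos_iff_support (by fun_prop)]
  have : (Function.support fun p => DD M A p * ww (Module.finrank ℝ V + 2) (pos M z p)) = univ := by
    ext p; simpa using ⟨hDp p, (ww_pos _ _).ne'⟩
  rw [this, pm_eq, ← univ_prod_univ, Measure.prod_prod]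
  simpa using NeZero.ne (volume : Measure V)

lemma mm_fin {A : V × V → ℝ≥0∞} (hA : Measurable A) (h : ∫⁻ z, A z ^ 2 ≠ ⊤) (z) : mm M A (Icc 0 1) z ≠ ⊤ := by
  refine ne_top_of_le_ne_top (b := (∫⁻ z, A z ^ 2) * WI V) (ENNReal.mul_ne_top h WI_ne) ?_
  unfold mm
  calc _ ≤ ∫⁻ p, (∫⁻ z, A z ^ 2) * ww (Module.finrank ℝ V + 2) (pos M z p) ∂(pm (Icc 0 1)) := by
        refine lintegral_mono fun p => mul_le_mul_left (lintegral_mono fun z => ?_) _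
        exact mul_le_of_le_one_right' (ww_le_one _ _)
    _ ≤ _ := by
        rw [lintegral_const_mul _ (by fun_prop)]
        gcongr
        rw [pm_eq, lintegral_prod_symm' _ (by fun_prop)]
        calc _ ≤ ∫⁻ t in Icc (0:ℝ) 1, WI V := by
              refine lintegral_mono fun t => ?_
              have : ∀ y, pos M z (y, t) = y + (-z.1 + (2 * t) • M z.2) := fun y => by unfold pos; simp; abel
              simp_rw [this]
              rw [lintegral_add_right_eq_self (fun v => ww (Module.finrank ℝ V + 2) v)]
              exact lint_ww_le (by omega)
          _ = _ := by simp

lemma an_le (A : V × V → ℝ≥0∞) {J : Set ℝ} (h : J ⊆ Icc 0 1) (z) : an M A J z ≤ 1 :=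
  ENNReal.div_le_of_le_mul (by rw [one_mul]; exact mm_mono M h z)

lemma measurable_an {A : V × V → ℝ≥0∞} (hA : Measurable A) (J) : Measurable (an M A J) :=
  (measurable_mm M hA J).div (measurable_mm M hA _)

lemma an_add {A : V × V → ℝ≥0∞} (hA : Measurable A) (h0 : ∫⁻ z, A z ^ 2 ≠ 0) (h1 : ∫⁻ z, A z ^ 2 ≠ ⊤)
    {J : Set ℝ} (hJ : MeasurableSet J) (hJI : J ⊆ Icc 0 1) (z) : an M A J z + an M A (Icc 0 1 \ J) z = 1 := by
  unfold an
  rw [← ENNReal.add_div, show mm M A J z + mm M A (Icc 0 1 \ J) z = mm M A (Icc 0 1) z from ?_,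
    ENNReal.div_self (mm_pos M hA h0 z) (mm_fin M hA h1 z)]
  unfold mm
  rw [← lintegral_add_measure]
  congr 1
  unfold pm
  rw [← Measure.restrict_union _ (MeasurableSet.univ.prod (measurableSet_Icc.diff hJ)), ← prod_union, union_diff_cancel hJI]
  rw [disjoint_prod]; exact Or.inr disjoint_sdiff_right

def Nk (K k : ℕ) : Set ℝ := Ioo (((k:ℝ) - 1) / K) (((k:ℝ) + 2) / K) ∩ Icc 0 1

lemma an_sum (A : V × V → ℝ≥0∞) (hA : Measurable A) {K : ℕ} (hK : 1 ≤ K) (z) :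
    ∑ k ∈ Finset.range K, an M A (Nk K k) z ≤ 3 := by
  have hD := measurable_DD M hA
  have hKp : (0:ℝ) < K := by exact_mod_cast hK
  unfold an
  simp_rw [div_eq_mul_inv]
  rw [← Finset.sum_mul, ← div_eq_mul_inv]
  refine ENNReal.div_le_of_le_mul ?_
  unfold mm
  set H : V × ℝ → ℝ≥0∞ := fun p => DD M A p * ww (Module.finrank ℝ V + 2) (pos M z p) with hH
  have hHm : Measurable H := by fun_prop
  have hNm : ∀ k, MeasurableSet (univ ×ˢ Nk K k : Set (V × ℝ)) := fun k => MeasurableSet.univ.prod (measurableSet_Ioo.inter measurableSet_Icc)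
  unfold pm
  simp_rw [← lintegral_indicator (hNm _)]
  rw [← lintegral_finsetSum _ (fun k _ => hHm.indicator (hNm k)), ← lintegral_const_mul _ hHm,
    ← lintegral_indicator (MeasurableSet.univ.prod measurableSet_Icc)]
  refine lintegral_mono fun p => ?_
  by_cases hp : p.2 ∈ Icc (0:ℝ) 1
  · rw [indicator_of_mem (show p ∈ univ ×ˢ Icc (0:ℝ) 1 from ⟨trivial, hp⟩)]
    have : ∀ k ∈ Finset.range K, (univ ×ˢ Nk K k : Set (V × ℝ)).indicator H p ≤ if k ∈ Finset.Icc (⌊p.2 * K⌋₊ - 1) (⌊p.2 * K⌋₊ + 1) then H p else 0 := fun k _ => by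
      by_cases hk : p ∈ (univ ×ˢ Nk K k : Set (V × ℝ))
      · rw [indicator_of_mem hk, if_pos]
        have := hk.2.1
        have h1 : ((k:ℝ) - 1) < p.2 * K := by rw [← div_lt_iff₀ hKp]; exact this.1
        have h2 : p.2 * K < k + 2 := by rw [← lt_div_iff₀ hKp]; exact this.2
        have h3 := Nat.floor_le (mul_nonneg hp.1 hKp.le)
        have h4 := Nat.lt_floor_add_one (p.2 * K)
        rw [Finset.mem_Icc]
        constructor
        · have : (⌊p.2 * K⌋₊ : ℝ) < (k + 2 : ℕ) := by push_cast; linarith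
          have := Nat.cast_lt.mp this; omega
        · have : (k : ℝ) < (⌊p.2 * K⌋₊ + 2 : ℕ) := by push_cast; linarith
          have := Nat.cast_lt.mp this; omega
      · rw [indicator_of_notMem hk]; exact zero_le
    refine (Finset.sum_le_sum this).trans ?_
    rw [← Finset.sum_filter, Finset.sum_const, nsmul_eq_mul]
    gcongr
    have : ((Finset.range K).filter (· ∈ Finset.Icc (⌊p.2 * K⌋₊ - 1) (⌊p.2 * K⌋₊ + 1))).card ≤ 3 := by
      refine (Finset.card_le_card (t := Finset.Icc (⌊p.2 * K⌋₊ - 1) (⌊p.2 * K⌋₊ + 1)) fun k hk => (Finset.mem_filter.mp hk).2).trans ?_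
      rw [Nat.card_Icc]; omega
    exact_mod_cast this
  · rw [Finset.sum_eq_zero]
    · exact zero_le
    · intro k _; refine indicator_of_notMem ?_ _; intro h; exact hp h.2.2

lemma far_term (hM : ∀ a b, ⟪M a, b⟫ = ⟪a, M b⟫) (hg : Win g) {α r0 l : ℝ} (hr0 : 0 < r0) (hl : 0 < l) : ∃ C : ℝ, 0 < C ∧ ∀ (r : ℝ) (K : ℕ), 1 ≤ r → 1 ≤ K → (K : ℝ) ≤ r →
    ∀ T1 T2 : Set V, (∀ ξ ∈ T1, ‖ξ‖ ≤ r0 * r) → (∀ ξ ∈ T2, ‖ξ‖ ≤ r0 * r) → Sep M r l T1 T2 →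
    ∀ W, Wt α r W → ∀ A1 A2 : V × V → ℝ≥0∞, Measurable A1 → Measurable A2 → (∀ z, A1 z ≠ 0 → z.2 ∈ T1) → (∀ z, A2 z ≠ 0 → z.2 ∈ T2) →
    ∀ k < K, ∀ u1 u2 : V × V → ℂ, Measurable u1 → Measurable u2 → Integrable u1 → Integrable u2 →
    (∀ z, ‖u1 z‖ₑ ≤ an M A2 (Icc 0 1 \ Nk K k) z * A1 z) → (∀ z, ‖u2 z‖ₑ ≤ A2 z) → ∀ q,
    ∫⁻ p in closedBall q r ×ˢ Ico ((k:ℝ) / K) ((k:ℝ) / K + (K:ℝ)⁻¹), ‖EE M (VS g u1) p‖ₑ * ‖EE M (VS g u2) p‖ₑ * W p ≤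
      ofReal (C * (r ^ 2)⁻¹ * (√((K:ℝ) ^ Module.finrank ℝ V) * r ^ (α - (Module.finrank ℝ V : ℝ) / 2 + 1 / 2))) * ((∫⁻ z, A1 z ^ 2) + ∫⁻ z, A2 z ^ 2) := by
  obtain ⟨C, hC, H⟩ := cross M hM hg hr0 hl
  refine ⟨√C, by positivity, fun r K hr hK hKr T1 T2 hT1 hT2 hS W hW A1 A2 hA1 hA2 hs1 hs2 k hk u1 u2 hu1 hu2 hi1 hi2 hb1 hb2 q => ?_⟩
  have hrp : 0 < r := by linarith
  have hKp : (0:ℝ) < K := by exact_mod_cast hK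
  set n := Module.finrank ℝ V
  have hI : Ico ((k:ℝ) / K) ((k:ℝ) / K + (K:ℝ)⁻¹) ⊆ Icc 0 1 := fun t ht => by
    have : ((k:ℝ) + 1) ≤ K := by exact_mod_cast hk
    refine ⟨le_trans (by positivity) ht.1, ht.2.le.trans ?_⟩
    rw [← one_div, ← add_div, div_le_one hKp]; exact this
  have key := H r (K:ℝ)⁻¹ hr (by positivity) T1 T2 hT1 hT2 hS A1 A2 hA1 hA2 hs1 hs2 (Icc 0 1 \ Nk K k)
    (measurableSet_Icc.diff (measurableSet_Ioo.inter measurableSet_Icc)) diff_subset ((k:ℝ) / K) (K:ℝ)⁻¹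
    (by rw [inv_mul_eq_div, le_div_iff₀ hKp]; linarith) hI
    (fun t ht t0 ht0 => by
      by_contra hcon; push Not at hcon
      rw [abs_lt] at hcon
      refine ht.2 ⟨⟨?_, ?_⟩, ht.1⟩
      · rw [sub_div, one_div]; linarith [hcon.1, ht0.1]
      · rw [show ((k:ℝ) + 2) / K = (k:ℝ) / K + (K:ℝ)⁻¹ + (K:ℝ)⁻¹ by field_simp; ring]; linarith [hcon.2, ht0.2])
    u1 u2 hu1 hu2 hi1 hi2 hb1 hb2
  apply le_of_sq
  have hE1 := measurable_EE M (measurable_VS hg hu1)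
  have hE2 := measurable_EE M (measurable_VS hg hu2)
  refine (CS_sq (by fun_prop) hW.1.aemeasurable).trans ?_
  have k1 : ∫⁻ p in closedBall q r ×ˢ Ico ((k:ℝ) / K) ((k:ℝ) / K + (K:ℝ)⁻¹), (‖EE M (VS g u1) p‖ₑ * ‖EE M (VS g u2) p‖ₑ) ^ 2 ≤ _ :=
    (lintegral_mono_set (prod_mono (subset_univ _) subset_rfl)).trans key
  have k2 : ∫⁻ p in closedBall q r ×ˢ Ico ((k:ℝ) / K) ((k:ℝ) / K + (K:ℝ)⁻¹), W p ^ 2 ≤ ofReal ((r ^ (n + 2))⁻¹ * (r ^ 2) ^ α) := by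
    refine le_trans ?_ (hW.2.2 q 0 (r ^ 2) (by nlinarith))
    rw [show r ^ 2 / r = r by field_simp, div_self (by positivity)]
    refine (lintegral_mono_set (prod_mono subset_rfl (hI.trans (Icc_subset_Icc (a₂ := 0 - 1) (b₂ := 0 + 1) (by norm_num) (by norm_num))))).trans ?_
    refine lintegral_mono fun p => ?_
    rw [sq]; exact mul_le_of_le_one_right' (hW.2.1 p)
  refine (mul_le_mul' k1 k2).trans ?_
  set X1 := ∫⁻ z, A1 z ^ 2
  set X2 := ∫⁻ z, A2 z ^ 2
  have e : C * ((K:ℝ)⁻¹ ^ n)⁻¹ / r * ((r ^ (n + 2))⁻¹ * (r ^ 2) ^ α) = (√C * (r ^ 2)⁻¹ * (√((K:ℝ) ^ n) * r ^ (α - (n : ℝ) / 2 + 1 / 2))) ^ 2 := by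
    simp only [mul_pow]
    rw [Real.sq_sqrt hC.le, Real.sq_sqrt (by positivity), inv_pow, inv_inv, ← Real.rpow_natCast (r ^ _) 2, ← Real.rpow_natCast r 2, ← Real.rpow_natCast r (n + 2), ← Real.rpow_mul hrp.le, ← Real.rpow_mul hrp.le, ← Real.rpow_neg hrp.le, ← Real.rpow_neg hrp.le, ← Real.rpow_natCast (r ^ _) 2, ← Real.rpow_mul hrp.le,
      div_eq_mul_inv, ← Real.rpow_neg_one r]
    have : r ^ (-1:ℝ) * (r ^ (-((n + 2 : ℕ) : ℝ)) * r ^ ((2:ℕ) * α)) = r ^ (-((2:ℕ):ℝ) * (2:ℕ)) * r ^ ((α - (n:ℝ) / 2 + 1 / 2) * (2:ℕ)) := by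
      rw [← Real.rpow_add hrp, ← Real.rpow_add hrp, ← Real.rpow_add hrp]; congr 1; push_cast; ring
    calc _ = C * (K:ℝ) ^ n * (r ^ (-1:ℝ) * (r ^ (-((n + 2 : ℕ) : ℝ)) * r ^ ((2:ℕ) * α))) := by ring
      _ = _ := by rw [this]; ring
  rw [mul_right_comm, ← ofReal_mul (by positivity), e, ofReal_pow (by positivity), mul_pow]
  gcongr
  rw [sq]; gcongr <;> simp

end HP
end

noncomputable section
open MeasureTheory Metric Set
open scoped ENNReal NNReal FourierTransform RealInnerProductSpace ContDiff

namespace HP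
open ENNReal (ofReal ofReal_mul ofReal_le_ofReal ofReal_pow ofReal_one ofReal_ne_top ofReal_pos ofReal_add)
set_option linter.unusedSectionVars false
variable {V : Type*} [NormedAddCommGroup V] [InnerProductSpace ℝ V] [FiniteDimensional ℝ V]
  [MeasurableSpace V] [BorelSpace V]
open ComplexConjugate
variable (M : V ≃ₗᵢ[ℝ] V) {g : V → ℝ}

lemma integrable_upk (hg : Win g) {u : V × V → ℂ} (hi : Integrable u) (p) : Integrable fun z => u z * pk M g z p := by
  obtain ⟨C, hC⟩ := pk_bdd M hg
  exact hi.mul_bdd (c := C) (((measurable_pk M hg).comp (by fun_prop : Measurable fun z : V × V => (z, p))).aestronglyMeasurable) (Filter.Eventually.of_forall fun z => hC z p)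

lemma EE_VS_add (hg : Win g) {c u v : V × V → ℂ} (hu : Measurable u) (hv : Measurable v) (hiu : Integrable u) (hiv : Integrable v)
    (h : ∀ z, c z = u z + v z) (p) : EE M (VS g c) p = EE M (VS g u) p + EE M (VS g v) p := by
  have hc : c = u + v := funext h
  subst hc
  rw [EE_VS M hg (hu.add hv) (hiu.add hiv), EE_VS M hg hu hiu, EE_VS M hg hv hiv, ← integral_add (integrable_upk M hg hiu p) (integrable_upk M hg hiv p)]
  congr 1; ext z; rw [Pi.add_apply]; ring

lemma EE_VS_zero (hg : Win g) {c : V × V → ℂ} (hc : Measurable c) (hi : Integrable c) (h : nn c = 0) (p) : EE M (VS g c) p = 0 := by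
  rw [EE_VS M hg hc hi]
  refine integral_eq_zero_of_ae ?_
  unfold nn at h
  rw [lintegral_eq_zero_iff (by fun_prop)] at h
  filter_upwards [h] with z hz
  have : c z = 0 := by simpa using hz
  simp [this]

def uc (A : V × V → ℝ≥0∞) (J : Set ℝ) (c : V × V → ℂ) (z : V × V) : ℂ := ((an M A J z).toReal : ℂ) * c z

section uc
variable {A : V × V → ℝ≥0∞} {J : Set ℝ} {c : V × V → ℂ}
lemma measurable_uc (hA : Measurable A) (J) (hc : Measurable c) : Measurable (uc M A J c) := by
  have := measurable_an M hA J
  unfold uc; fun_prop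
lemma enorm_uc (hJ : J ⊆ Icc 0 1) (z) : ‖uc M A J c z‖ₑ = an M A J z * ‖c z‖ₑ := by
  unfold uc
  rw [enorm_mul]; congr 1
  rw [← ofReal_norm, Complex.norm_real, Real.norm_of_nonneg ENNReal.toReal_nonneg,
    ENNReal.ofReal_toReal (ne_top_of_le_ne_top ENNReal.one_ne_top (an_le M A hJ z))]
lemma enorm_uc_le (hJ : J ⊆ Icc 0 1) (z) : ‖uc M A J c z‖ₑ ≤ ‖c z‖ₑ := by
  rw [enorm_uc M hJ]; exact mul_le_of_le_one_left' (an_le M A hJ z)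
lemma integrable_uc (hA : Measurable A) (hJ : J ⊆ Icc 0 1) (hc : Measurable c) (hi : Integrable c) : Integrable (uc M A J c) :=
  hi.mono (measurable_uc M hA J hc).aestronglyMeasurable (Filter.Eventually.of_forall fun z => by
    have := enorm_uc_le M (A := A) hJ (c := c) z
    rwa [enorm_le_iff_norm_le] at this)
lemma uc_add (hA : Measurable A) (hJ : J ⊆ Icc 0 1) (h0 : ∫⁻ z, A z ^ 2 ≠ 0) (h1 : ∫⁻ z, A z ^ 2 ≠ ⊤) (hJm : MeasurableSet J) (z) :
    c z = uc M A J c z + uc M A (Icc 0 1 \ J) c z := by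
  unfold uc
  rw [← add_mul, ← Complex.ofReal_add, ← ENNReal.toReal_add, an_add M hA h0 h1 hJm hJ]
  · simp
  · exact ne_top_of_le_ne_top ENNReal.one_ne_top (an_le M A hJ z)
  · exact ne_top_of_le_ne_top ENNReal.one_ne_top (an_le M A diff_subset z)
end uc

lemma loc (hM : ∀ a b, ⟪M a, b⟫ = ⟪a, M b⟫) (hg : Win g) {α γ r0 l : ℝ} (hB : Bil M α γ) (hr0 : 0 < r0) (hl : 0 < l) : ∃ C : ℝ, 0 < C ∧ ∀ (r : ℝ) (K : ℕ), 1 ≤ r → 1 ≤ K → (K : ℝ) ≤ r →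
    ∀ T1 T2 : Set V, (∀ ξ ∈ T1, ‖ξ‖ ≤ r0 * r) → (∀ ξ ∈ T2, ‖ξ‖ ≤ r0 * r) → Sep M r l T1 T2 → Sep M r l T2 T1 →
    ∀ W, Wt α r W → ∀ c1 c2 : V × V → ℂ, Measurable c1 → Measurable c2 → Integrable c1 → Integrable c2 →
    (∀ z, c1 z ≠ 0 → ∀ η, ‖η - z.2‖ ≤ 1 → η ∈ T1) → (∀ z, c2 z ≠ 0 → ∀ η, ‖η - z.2‖ ≤ 1 → η ∈ T2) → ∀ q,
    ∫⁻ p in closedBall q r ×ˢ Ico (0:ℝ) 1, ‖EE M (VS g c1) p‖ₑ * ‖EE M (VS g c2) p‖ₑ * W p ≤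
      ofReal (C * (r ^ 2)⁻¹ * ((r ^ 2 * (K:ℝ)⁻¹) ^ γ + K * √((K:ℝ) ^ Module.finrank ℝ V) * r ^ (α - (Module.finrank ℝ V : ℝ) / 2 + 1 / 2))) * (nn c1 + nn c2) := by
  obtain ⟨Cf, hCf, HF⟩ := far_term M hM hg (α := α) hr0 hl
  obtain ⟨Cb, hCb, HB⟩ := hB r0 l hr0 hl
  refine ⟨3 * Cb + 2 * Cf, by positivity, fun r K hr hK hKr T1 T2 hT1 hT2 hS12 hS21 W hW c1 c2 hc1 hc2 hi1 hi2 hs1 hs2 q => ?_⟩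
  have hrp : 0 < r := by linarith
  have hKp : (0:ℝ) < K := by exact_mod_cast hK
  set n := Module.finrank ℝ V
  by_cases z1 : nn c1 = 0
  · simp [EE_VS_zero M hg hc1 hi1 z1]
  by_cases z2 : nn c2 = 0
  · simp [EE_VS_zero M hg hc2 hi2 z2]
  set X := (r ^ 2 * (K:ℝ)⁻¹) ^ γ with hX
  set Y := √((K:ℝ) ^ n) * r ^ (α - (n : ℝ) / 2 + 1 / 2) with hY
  have hX0 : 0 < X := by positivity
  have hY0 : 0 < Y := by positivity
  by_cases t1 : nn c1 = ⊤
  · rw [t1, top_add, ENNReal.mul_top (ENNReal.ofReal_pos.mpr (by rw [mul_assoc (K:ℝ)]; positivity)).ne']; exact le_top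
  by_cases t2 : nn c2 = ⊤
  · rw [t2, add_top, ENNReal.mul_top (ENNReal.ofReal_pos.mpr (by rw [mul_assoc (K:ℝ)]; positivity)).ne']; exact le_top
  set A1 : V × V → ℝ≥0∞ := fun z => ‖c1 z‖ₑ with hA1
  set A2 : V × V → ℝ≥0∞ := fun z => ‖c2 z‖ₑ with hA2
  have mA1 : Measurable A1 := hc1.enorm
  have mA2 : Measurable A2 := hc2.enorm
  have NI : ∀ k, Nk K k ⊆ Icc 0 1 := fun k => inter_subset_right
  have NM : ∀ k, MeasurableSet (Nk K k) := fun k => measurableSet_Ioo.inter measurableSet_Icc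
  have supp : ∀ (A : V × V → ℝ≥0∞) (c : V × V → ℂ) (T : Set V) (J : Set ℝ), (∀ z, c z ≠ 0 → ∀ η, ‖η - z.2‖ ≤ 1 → η ∈ T) → ∀ ξ, VS g (uc M A J c) ξ ≠ 0 → ξ ∈ T := fun A c T J hs ξ hξ => by
    by_contra hcon
    refine hξ (VS_zero hg fun z hz => ?_)
    by_contra h2; push Not at h2
    exact hcon (hs z (right_ne_zero_of_mul hz) ξ h2)
  have hz1 : ∀ z, A1 z ≠ 0 → z.2 ∈ T1 := fun z hz => hs1 z (by simpa [hA1] using hz) _ (by simp)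
  have hz2 : ∀ z, A2 z ≠ 0 → z.2 ∈ T2 := fun z hz => hs2 z (by simpa [hA2] using hz) _ (by simp)
  have piece : ∀ k < K, ∫⁻ p in closedBall q r ×ˢ Ico ((k:ℝ) / K) ((k:ℝ) / K + (K:ℝ)⁻¹), ‖EE M (VS g c1) p‖ₑ * ‖EE M (VS g c2) p‖ₑ * W p ≤
      ofReal (Cb * (r ^ 2)⁻¹ * X) * (nn (uc M A2 (Nk K k) c1) + nn (uc M A1 (Nk K k) c2)) +
      (ofReal (Cf * (r ^ 2)⁻¹ * Y) * (nn c1 + nn c2) + ofReal (Cf * (r ^ 2)⁻¹ * Y) * (nn c1 + nn c2)) := fun k hk => by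
    set u1 := uc M A2 (Nk K k) c1
    set u2 := uc M A1 (Nk K k) c2
    set v1 := uc M A2 (Icc 0 1 \ Nk K k) c1 with hv1
    set v2 := uc M A1 (Icc 0 1 \ Nk K k) c2 with hv2
    have mu1 : Measurable u1 := measurable_uc M mA2 _ hc1
    have mu2 : Measurable u2 := measurable_uc M mA1 _ hc2
    have mv1 : Measurable v1 := measurable_uc M mA2 _ hc1
    have mv2 : Measurable v2 := measurable_uc M mA1 _ hc2
    have iu1 : Integrable u1 := integrable_uc M mA2 (NI k) hc1 hi1
    have iu2 : Integrable u2 := integrable_uc M mA1 (NI k) hc2 hi2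
    have iv1 : Integrable v1 := integrable_uc M mA2 diff_subset hc1 hi1
    have iv2 : Integrable v2 := integrable_uc M mA1 diff_subset hc2 hi2
    have a1 := EE_VS_add M hg mu1 mv1 iu1 iv1 (uc_add M mA2 (NI k) z2 t2 (NM k))
    have a2 := EE_VS_add M hg mu2 mv2 iu2 iv2 (uc_add M mA1 (NI k) z1 t1 (NM k))
    have mE : ∀ u, Measurable u → Measurable (EE M (VS g u)) := fun u hu => measurable_EE M (measurable_VS hg hu)
    have m1 := mE u1 mu1
    have m2 := mE u2 mu2
    have m3 := mE v1 mv1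
    have m4 := mE v2 mv2
    have m5 := mE c2 hc2
    have mW := hW.1
    have near := HB r (K:ℝ)⁻¹ ((k:ℝ) / K) hr (by positivity) (by rw [← div_eq_mul_inv, le_div_iff₀ hKp]; nlinarith) T1 T2 hT1 hT2 hS12 hS21 W hW
      (VS g u1) (VS g u2) (measurable_VS hg mu1) (measurable_VS hg mu2) (integrable_VS hg mu1 iu1) (integrable_VS hg mu2 iu2) (supp _ _ _ _ hs1) (supp _ _ _ _ hs2)
    have f1 := HF r K hr hK hKr T1 T2 hT1 hT2 hS12 W hW A1 A2 mA1 mA2 hz1 hz2 k hk v1 c2 mv1 hc2 iv1 hi2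
      (fun z => (enorm_uc M diff_subset z).le) (fun z => le_rfl) q
    have f2 := HF r K hr hK hKr T2 T1 hT2 hT1 hS21 W hW A2 A1 mA2 mA1 hz2 hz1 k hk v2 u1 mv2 mu1 iv2 iu1
      (fun z => (enorm_uc M diff_subset z).le) (fun z => enorm_uc_le M (NI k) z) q
    rw [add_comm (∫⁻ z, A2 z ^ 2)] at f2
    calc _ ≤ ∫⁻ p in closedBall q r ×ˢ Ico ((k:ℝ) / K) ((k:ℝ) / K + (K:ℝ)⁻¹), (‖EE M (VS g u1) p‖ₑ * ‖EE M (VS g u2) p‖ₑ * W p +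
          (‖EE M (VS g v1) p‖ₑ * ‖EE M (VS g c2) p‖ₑ * W p + ‖EE M (VS g v2) p‖ₑ * ‖EE M (VS g u1) p‖ₑ * W p)) := by
          refine lintegral_mono fun p => ?_
          have b1 : ‖EE M (VS g c1) p‖ₑ ≤ ‖EE M (VS g u1) p‖ₑ + ‖EE M (VS g v1) p‖ₑ := by rw [a1]; exact enorm_add_le _ _
          have b2 : ‖EE M (VS g c2) p‖ₑ ≤ ‖EE M (VS g u2) p‖ₑ + ‖EE M (VS g v2) p‖ₑ := by rw [a2]; exact enorm_add_le _ _
          calc _ ≤ (‖EE M (VS g u1) p‖ₑ + ‖EE M (VS g v1) p‖ₑ) * ‖EE M (VS g c2) p‖ₑ * W p := by gcongr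
            _ = ‖EE M (VS g u1) p‖ₑ * ‖EE M (VS g c2) p‖ₑ * W p + ‖EE M (VS g v1) p‖ₑ * ‖EE M (VS g c2) p‖ₑ * W p := by ring
            _ ≤ ‖EE M (VS g u1) p‖ₑ * (‖EE M (VS g u2) p‖ₑ + ‖EE M (VS g v2) p‖ₑ) * W p + ‖EE M (VS g v1) p‖ₑ * ‖EE M (VS g c2) p‖ₑ * W p := by gcongr
            _ = _ := by ring
      _ ≤ _ := by
          rw [lintegral_add_left (by fun_prop), lintegral_add_left (by fun_prop)]
          refine add_le_add ?_ (add_le_add f1 f2)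
          refine (lintegral_mono_set (prod_mono (subset_univ _) subset_rfl)).trans (near.trans ?_)
          gcongr
          · exact nn_VS_le hg mu1 iu1
          · exact nn_VS_le hg mu2 iu2
  have nsum : ∀ (A : V × V → ℝ≥0∞) (c : V × V → ℂ), Measurable A → Measurable c → ∑ k : Fin K, nn (uc M A (Nk K k) c) ≤ 3 * nn c := fun A c hA hc => by
    unfold nn
    rw [← lintegral_finsetSum _ (fun k _ => by have := measurable_uc M hA (Nk K k) hc; fun_prop), ← lintegral_const_mul _ (by fun_prop)]
    refine lintegral_mono fun z => ?_
    calc _ ≤ ∑ k : Fin K, an M A (Nk K k) z * ‖c z‖ₑ ^ 2 := by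
          refine Finset.sum_le_sum fun k _ => ?_
          rw [enorm_uc M (NI k), mul_pow]; gcongr
          rw [sq]; exact mul_le_of_le_one_left' (an_le M A (NI k) z)
      _ ≤ _ := by
          rw [← Finset.sum_mul]; gcongr
          rw [← Finset.sum_range (fun k => an M A (Nk K k) z)]
          exact an_sum M A hA hK z
  have cover : closedBall q r ×ˢ Ico (0:ℝ) 1 ⊆ ⋃ k : Fin K, closedBall q r ×ˢ Ico (((k:ℕ):ℝ) / K) (((k:ℕ):ℝ) / K + (K:ℝ)⁻¹) := fun p hp => by
    have h0 : 0 ≤ p.2 * K := mul_nonneg hp.2.1 hKp.le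
    have h1 : p.2 * K < K := by nlinarith [hp.2.2]
    rw [mem_iUnion]
    refine ⟨⟨⌊p.2 * K⌋₊, by rw [Nat.floor_lt h0]; exact h1⟩, hp.1, ?_, ?_⟩
    · rw [div_le_iff₀ hKp]; exact Nat.floor_le h0
    · rw [← one_div, ← add_div, lt_div_iff₀ hKp]; exact Nat.lt_floor_add_one _
  calc _ ≤ ∑ k : Fin K, ∫⁻ p in closedBall q r ×ˢ Ico (((k:ℕ):ℝ) / K) (((k:ℕ):ℝ) / K + (K:ℝ)⁻¹), ‖EE M (VS g c1) p‖ₑ * ‖EE M (VS g c2) p‖ₑ * W p := by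
        refine (lintegral_mono_set cover).trans ?_
        refine (lintegral_iUnion_le _ _).trans_eq ?_
        rw [tsum_fintype]
    _ ≤ ∑ k : Fin K, (ofReal (Cb * (r ^ 2)⁻¹ * X) * (nn (uc M A2 (Nk K k) c1) + nn (uc M A1 (Nk K k) c2)) +
      (ofReal (Cf * (r ^ 2)⁻¹ * Y) * (nn c1 + nn c2) + ofReal (Cf * (r ^ 2)⁻¹ * Y) * (nn c1 + nn c2))) :=
        Finset.sum_le_sum fun k _ => piece k k.2
    _ ≤ ofReal (Cb * (r ^ 2)⁻¹ * X) * (3 * nn c1 + 3 * nn c2) + ofReal (K * (2 * (Cf * (r ^ 2)⁻¹ * Y))) * (nn c1 + nn c2) := by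
        rw [Finset.sum_add_distrib, ← Finset.mul_sum, Finset.sum_add_distrib, Finset.sum_const, Finset.card_univ, Fintype.card_fin, nsmul_eq_mul, ← add_mul, ← ofReal_add (by positivity) (by positivity), ← mul_assoc, ← ENNReal.ofReal_natCast K, ← ofReal_mul (by positivity), ← two_mul]
        gcongr
        · exact nsum _ _ mA2 hc1
        · exact nsum _ _ mA1 hc2
    _ = ofReal (3 * (Cb * (r ^ 2)⁻¹ * X) + K * (2 * (Cf * (r ^ 2)⁻¹ * Y))) * (nn c1 + nn c2) := by
        rw [← mul_add, ofReal_add (by positivity) (by positivity), ofReal_mul (by norm_num : (0:ℝ) ≤ 3), ENNReal.ofReal_ofNat]; ring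
    _ ≤ _ := by
        gcongr
        rw [mul_assoc (K:ℝ), ← hY]
        have p1 : 0 ≤ (r ^ 2)⁻¹ * X := by positivity
        have p2 : 0 ≤ (r ^ 2)⁻¹ * (K * Y) := by positivity
        nlinarith [mul_nonneg hCf.le p1, mul_nonneg hCb.le p2]

def sc (ρ : ℝ) (ξ0 : V) (t0 : ℝ) (f : V → ℂ) (η : V) : ℂ := f (ξ0 + ρ • η) * ee (t0 * QQ M (ξ0 + ρ • η))

lemma measurable_sc (ρ : ℝ) (ξ0 : V) (t0 : ℝ) {f : V → ℂ} (hf : Measurable f) : Measurable (sc M ρ ξ0 t0 f) := by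
  have := measurable_ee
  have := (continuous_QQ M).measurable
  unfold sc; fun_prop

lemma integrable_sc {ρ : ℝ} (hρ : 0 < ρ) (ξ0 : V) (t0 : ℝ) {f : V → ℂ} (hf : Measurable f) (hi : Integrable f) : Integrable (sc M ρ ξ0 t0 f) := by
  have h1 : Integrable fun η => f (ξ0 + ρ • η) := (hi.comp_add_left ξ0).comp_smul hρ.ne'
  refine h1.mono (measurable_sc M ρ ξ0 t0 hf).aestronglyMeasurable (Filter.Eventually.of_forall fun η => ?_)
  simp [sc, norm_ee]

lemma enorm_sc (ρ : ℝ) (ξ0 : V) (t0 : ℝ) (f : V → ℂ) (η) : ‖sc M ρ ξ0 t0 f η‖ₑ = ‖f (ξ0 + ρ • η)‖ₑ := by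
  simp [sc, enorm_mul, enorm_ee]

lemma nn_sc {ρ : ℝ} (hρ : 0 < ρ) (ξ0 : V) (t0 : ℝ) {f : V → ℂ} (hf : Measurable f) :
    nn (sc M ρ ξ0 t0 f) = ofReal (ρ ^ Module.finrank ℝ V)⁻¹ * nn f := by
  unfold nn
  simp_rw [enorm_sc]
  rw [lint_affine (f := fun v => ‖f v‖ₑ ^ 2) (by fun_prop) hρ.ne', abs_of_pos hρ]

lemma EE_sc (hM : ∀ a b, ⟪M a, b⟫ = ⟪a, M b⟫) {ρ : ℝ} (hρ : 0 < ρ) (ξ0 : V) (t0 : ℝ) (f : V → ℂ) (y : V) (t : ℝ) :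
    ‖EE M f (y, t0 + t)‖ₑ = ofReal (ρ ^ Module.finrank ℝ V) * ‖EE M (sc M ρ ξ0 t0 f) (ρ • (y + (2 * t) • M ξ0), ρ ^ 2 * t)‖ₑ := by
  have e1 : EE M f (y, t0 + t) = (ρ ^ Module.finrank ℝ V : ℝ) • ∫ η, f (ξ0 + ρ • η) * ee (ph M (y, t0 + t) (ξ0 + ρ • η)) := by
    have h1 := Measure.integral_comp_smul (volume : Measure V) (fun v => f (ξ0 + v) * ee (ph M (y, t0 + t) (ξ0 + v))) ρ
    rw [h1, integral_add_left_eq_self (fun v => f v * ee (ph M (y, t0 + t) v)), abs_of_pos (by positivity), smul_smul, mul_inv_cancel₀ (by positivity), one_smul]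
    rfl
  have e2 : ∀ η, f (ξ0 + ρ • η) * ee (ph M (y, t0 + t) (ξ0 + ρ • η)) = ee (⟪y, ξ0⟫ + t * QQ M ξ0) * (sc M ρ ξ0 t0 f η * ee (ph M (ρ • (y + (2 * t) • M ξ0), ρ ^ 2 * t) η)) := fun η => by
    have : ph M (y, t0 + t) (ξ0 + ρ • η) = (⟪y, ξ0⟫ + t * QQ M ξ0) + (t0 * QQ M (ξ0 + ρ • η) + ph M (ρ • (y + (2 * t) • M ξ0), ρ ^ 2 * t) η) := by
      unfold ph
      rw [QQ_add M hM]
      simp only [inner_add_left, inner_add_right, inner_smul_left, inner_smul_right, QQ, map_smul]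
      simp
      ring
    rw [this, ee_add (⟪y, ξ0⟫ + t * QQ M ξ0), ee_add (t0 * _)]; unfold sc; ring
  rw [e1, enorm_smul]
  simp_rw [e2]
  rw [integral_const_mul, enorm_mul, enorm_ee, one_mul]
  congr 1
  rw [Real.enorm_eq_ofReal (by positivity)]

lemma triv {T t0 : ℝ} (hT : 0 ≤ T) {W : V × ℝ → ℝ≥0∞} (hW : ∀ p, W p ≤ 1) {f1 f2 : V → ℂ} (h1 : Measurable f1) (h2 : Measurable f2) (i1 : Integrable f1) (i2 : Integrable f2) :
    ∫⁻ p, ‖EE M f1 p‖ₑ * ‖EE M f2 p‖ₑ * W p ∂(pm (Ico t0 (t0 + T))) ≤ ofReal T * (nn f1 + nn f2) := by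
  have m1 := measurable_EE M h1
  have m2 := measurable_EE M h2
  calc _ ≤ ∫⁻ p, (‖EE M f1 p‖ₑ ^ 2 + ‖EE M f2 p‖ₑ ^ 2) ∂(pm (Ico t0 (t0 + T))) := by
        refine lintegral_mono fun p => ?_
        refine (mul_le_of_le_one_right' (hW p)).trans ?_
        rcases le_total ‖EE M f1 p‖ₑ ‖EE M f2 p‖ₑ with h | h
        · exact le_add_left (by rw [sq]; gcongr)
        · exact le_add_right (by rw [sq]; gcongr)
    _ ≤ ∫⁻ t in Ico t0 (t0 + T), (nn f1 + nn f2) := by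
        rw [pm_eq, lintegral_prod_symm' _ (by fun_prop)]
        refine lintegral_mono fun t => ?_
        have : Measurable fun y => ‖EE M f1 (y, t)‖ₑ ^ 2 := by fun_prop
        dsimp only
        rw [lintegral_add_left this]
        exact add_le_add (EE_plancherel M h1 i1 t) (EE_plancherel M h2 i2 t)
    _ = _ := by simp [mul_comm]

def Bil1 (α γ : ℝ) : Prop := ∀ r0 l : ℝ, 0 < r0 → 0 < l → ∃ C : ℝ, 0 < C ∧ ∀ r : ℝ, 1 ≤ r →
  ∀ S1 S2 : Set V, (∀ ξ ∈ S1, ‖ξ‖ ≤ r0 * r) → (∀ ξ ∈ S2, ‖ξ‖ ≤ r0 * r) → Sep M r l S1 S2 → Sep M r l S2 S1 →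
  ∀ W : V × ℝ → ℝ≥0∞, Wt α r W → ∀ f1 f2 : V → ℂ, Measurable f1 → Measurable f2 → Integrable f1 → Integrable f2 →
  (∀ ξ, f1 ξ ≠ 0 → ξ ∈ S1) → (∀ ξ, f2 ξ ≠ 0 → ξ ∈ S2) →
  ∫⁻ p, ‖EE M f1 p‖ₑ * ‖EE M f2 p‖ₑ * W p ∂(pm (Ico 0 1)) ≤
    ofReal (C * (r ^ 2)⁻¹ * (r ^ 2) ^ γ) * (nn f1 + nn f2)

lemma lint_P {f : V × ℝ → ℝ≥0∞} (hf : Measurable f) {θ : ℝ} (hθ : 0 < θ) (t0 : ℝ) :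
    ∫⁻ p : V × ℝ, f (θ • p.1, t0 + θ ^ 2 * p.2) = ofReal (θ ^ (Module.finrank ℝ V + 2))⁻¹ * ∫⁻ p, f p := by
  rw [Measure.volume_eq_prod, lintegral_prod_symm' _ (by fun_prop), lintegral_prod_symm' _ hf]
  have h1 : ∀ t, ∫⁻ y : V, f (θ • y, t0 + θ ^ 2 * t) = ofReal (θ ^ Module.finrank ℝ V)⁻¹ * ∫⁻ y, f (y, t0 + θ ^ 2 * t) := fun t => by
    have := lint_affine (f := fun y => f (y, t0 + θ ^ 2 * t)) (by fun_prop) hθ.ne' 0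
    simpa [abs_of_pos hθ] using this
  have hm : Measurable fun t => ∫⁻ y, f (y, t) := Measurable.lintegral_prod_left' hf
  dsimp only
  simp_rw [h1]
  have hm2 : Measurable fun t => ∫⁻ y, f (y, t0 + θ ^ 2 * t) := hm.comp (by fun_prop : Measurable fun t : ℝ => t0 + θ ^ 2 * t)
  rw [lintegral_const_mul _ hm2, lint_affineR (f := fun t => ∫⁻ y, f (y, t)) hm (by positivity), ← mul_assoc, ← ofReal_mul (by positivity), abs_of_pos (by positivity), ← mul_inv, pow_add]

lemma bil_of_one (hM : ∀ a b, ⟪M a, b⟫ = ⟪a, M b⟫) {α γ : ℝ} (h : Bil1 M α γ) : Bil M α γ := by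
  intro r0 l hr0 hl
  obtain ⟨C, hC, H⟩ := h r0 l hr0 hl
  refine ⟨C, hC, fun r T t0 hr hT hrT S1 S2 hS1 hS2 h12 h21 W hW f1 f2 m1 m2 i1 i2 s1 s2 => ?_⟩
  set n := Module.finrank ℝ V with hn
  set θ := √T with hθ
  have hθ0 : 0 < θ := Real.sqrt_pos.mpr hT
  have hθ2 : θ ^ 2 = T := Real.sq_sqrt hT.le
  have hrp : 0 < r := by linarith
  have hr' : 1 ≤ r * θ := by rw [← hθ2, ← mul_pow] at hrT; exact (one_le_sq_iff₀ (by positivity)).mp hrT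
  have hbd : ∀ S : Set V, (∀ ξ ∈ S, ‖ξ‖ ≤ r0 * r) → ∀ ξ ∈ {η : V | θ⁻¹ • η ∈ S}, ‖ξ‖ ≤ r0 * (r * θ) := fun S hS ξ hξ => by
    have := hS _ hξ
    rw [norm_smul, norm_inv, Real.norm_of_nonneg hθ0.le, inv_mul_le_iff₀ hθ0] at this
    linarith
  have hsp : ∀ S S' : Set V, Sep M r l S S' → Sep M (r * θ) l {η : V | θ⁻¹ • η ∈ S} {η : V | θ⁻¹ • η ∈ S'} := fun S S' hS a ha b hb c hc => by
    have := hS _ ha _ hb _ hc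
    rw [← smul_sub, ← smul_sub, map_smul, inner_smul_left, inner_smul_right, abs_mul, abs_mul] at this
    simp only [conj_trivial, abs_of_pos (inv_pos.mpr hθ0)] at this
    rw [← mul_assoc, ← mul_inv, inv_mul_eq_div, le_div_iff₀ (by positivity)] at this
    rw [mul_pow]; linarith
  have hW' : Wt α (r * θ) fun p : V × ℝ => W (θ • p.1, t0 + θ ^ 2 * p.2) := by
    have mW := hW.1
    refine ⟨by fun_prop, fun p => hW.2.1 _, fun y0 t1 s hs => ?_⟩
    have k := hW.2.2 (θ • y0) (t0 + θ ^ 2 * t1) s hs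
    have ms : MeasurableSet (closedBall (θ • y0) (s / r) ×ˢ Icc (t0 + θ ^ 2 * t1 - s / r ^ 2) (t0 + θ ^ 2 * t1 + s / r ^ 2) : Set (V × ℝ)) := measurableSet_closedBall.prod measurableSet_Icc
    rw [← lintegral_indicator ms] at k
    rw [← lintegral_indicator (measurableSet_closedBall.prod measurableSet_Icc)]
    calc _ ≤ ∫⁻ p : V × ℝ, (closedBall (θ • y0) (s / r) ×ˢ Icc (t0 + θ ^ 2 * t1 - s / r ^ 2) (t0 + θ ^ 2 * t1 + s / r ^ 2)).indicator W (θ • p.1, t0 + θ ^ 2 * p.2) := by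
          refine lintegral_mono fun p => ?_
          by_cases hp : p ∈ closedBall y0 (s / (r * θ)) ×ˢ Icc (t1 - s / (r * θ) ^ 2) (t1 + s / (r * θ) ^ 2)
          swap
          · rw [indicator_of_notMem hp]; exact zero_le
          rw [indicator_of_mem hp, indicator_of_mem]
          obtain ⟨hp1, hp2⟩ := hp
          rw [mem_closedBall, dist_eq_norm, le_div_iff₀ (by positivity)] at hp1
          refine ⟨?_, ?_⟩
          · rw [mem_closedBall, dist_eq_norm, ← smul_sub, norm_smul, Real.norm_of_nonneg hθ0.le, le_div_iff₀ hrp]; linarith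
          · have e : s / (r * θ) ^ 2 * θ ^ 2 = s / r ^ 2 := by field_simp
            constructor <;> nlinarith [hp2.1, hp2.2, sq_pos_of_pos hθ0]
      _ = _ := lint_P (mW.indicator ms) hθ0 t0
      _ ≤ ofReal (θ ^ (n + 2))⁻¹ * ofReal ((r ^ (n + 2))⁻¹ * s ^ α) := by gcongr
      _ = ofReal (((r * θ) ^ (n + 2))⁻¹ * s ^ α) := by rw [← ofReal_mul (by positivity), mul_pow, mul_inv]; ring_nf
  have hsup : ∀ (S : Set V) (f : V → ℂ), (∀ ξ, f ξ ≠ 0 → ξ ∈ S) → ∀ ξ, sc M θ⁻¹ 0 t0 f ξ ≠ 0 → ξ ∈ {η : V | θ⁻¹ • η ∈ S} := fun S f hf ξ hξ => by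
    have := hf _ (left_ne_zero_of_mul hξ)
    simpa using this
  have hθi : 0 < θ⁻¹ := inv_pos.mpr hθ0
  have key := H (r * θ) hr' _ _ (hbd S1 hS1) (hbd S2 hS2) (hsp _ _ h12) (hsp _ _ h21) _ hW' (sc M θ⁻¹ 0 t0 f1) (sc M θ⁻¹ 0 t0 f2)
    (measurable_sc M _ _ _ m1) (measurable_sc M _ _ _ m2) (integrable_sc M hθi _ _ m1 i1) (integrable_sc M hθi _ _ m2 i2) (hsup _ _ s1) (hsup _ _ s2)
  have mE1 := measurable_EE M m1
  have mE2 := measurable_EE M m2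
  have mF1 := measurable_EE M (measurable_sc M θ⁻¹ 0 t0 m1)
  have mF2 := measurable_EE M (measurable_sc M θ⁻¹ 0 t0 m2)
  have mW := hW.1
  have hE : ∀ (f : V → ℂ) (x : V) (s : ℝ), ‖EE M f (θ • x, t0 + θ ^ 2 * s)‖ₑ = ofReal (θ⁻¹ ^ n) * ‖EE M (sc M θ⁻¹ 0 t0 f) (x, s)‖ₑ := fun f x s => by
    rw [EE_sc M hM hθi 0 t0 f]
    congr 3
    ext
    · simp [smul_smul, inv_mul_cancel₀ hθ0.ne']
    · simp; field_simp
  have mI : MeasurableSet (univ ×ˢ Ico t0 (t0 + T) : Set (V × ℝ)) := MeasurableSet.univ.prod measurableSet_Ico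
  have LHS : ofReal (θ ^ (n + 2))⁻¹ * ∫⁻ p, ‖EE M f1 p‖ₑ * ‖EE M f2 p‖ₑ * W p ∂(pm (Ico t0 (t0 + T))) =
      ofReal (θ⁻¹ ^ n * θ⁻¹ ^ n) * ∫⁻ p, ‖EE M (sc M θ⁻¹ 0 t0 f1) p‖ₑ * ‖EE M (sc M θ⁻¹ 0 t0 f2) p‖ₑ * W (θ • p.1, t0 + θ ^ 2 * p.2) ∂(pm (Ico 0 1)) := by
    unfold pm
    rw [← lintegral_indicator mI, ← lint_P (by fun_prop) hθ0 t0, ← lintegral_const_mul _ (by fun_prop), ← lintegral_indicator (MeasurableSet.univ.prod measurableSet_Ico)]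
    refine lintegral_congr fun p => ?_
    by_cases hp : p.2 ∈ Ico (0:ℝ) 1
    · rw [indicator_of_mem (show p ∈ univ ×ˢ Ico (0:ℝ) 1 from ⟨trivial, hp⟩), indicator_of_mem, hE, hE, ofReal_mul (by positivity)]
      · ring
      · refine ⟨trivial, ?_, ?_⟩
        · nlinarith [hp.1]
        · have := hp.2; rw [hθ2]; dsimp only; nlinarith
    · rw [indicator_of_notMem (show p ∉ univ ×ˢ Ico (0:ℝ) 1 from fun h => hp h.2), indicator_of_notMem]
      rintro ⟨-, h1, h2⟩
      refine hp ⟨?_, ?_⟩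
      · rw [hθ2] at h1; dsimp only at h1; by_contra hc; push Not at hc; nlinarith
      · rw [hθ2] at h2; dsimp only at h2; by_contra hc; push Not at hc; nlinarith
  have hu : ofReal (θ ^ (n + 2)) * ofReal (θ ^ (n + 2))⁻¹ = 1 := by
    rw [← ofReal_mul (by positivity), mul_inv_cancel₀ (by positivity), ofReal_one]
  rw [← one_mul (∫⁻ p, _ ∂_), ← hu, mul_assoc, LHS]
  refine (mul_le_mul_right (mul_le_mul_right key _) _).trans_eq ?_
  rw [nn_sc M hθi _ _ m1, nn_sc M hθi _ _ m2, ← mul_add]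
  simp only [← mul_assoc]
  rw [← ofReal_mul (by positivity), ← ofReal_mul (by positivity), ← ofReal_mul (by positivity)]
  congr 2
  rw [mul_pow r θ 2, hθ2, ← hn, pow_add, hθ2]
  field_simp
  rw [one_div, inv_pow, mul_inv_cancel₀ (by positivity)]

def cq (g : V → ℝ) (f : V → ℂ) (R : ℝ) (q : V) (z : V × V) : ℂ := {z : V × V | ‖z.1 - q‖ ≤ R}.indicator (VV g f) z

lemma measurable_cq (hg : Win g) {f : V → ℂ} (hf : Measurable f) (R q) : Measurable (cq g f R q) :=
  (measurable_VV hg hf).indicator (measurableSet_le (by fun_prop) (by fun_prop))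

lemma VV_supp (hg : Win g) {f : V → ℂ} {S : Set V} (hs : ∀ ξ, f ξ ≠ 0 → ξ ∈ S) {z} (h : VV g f z ≠ 0) : ∃ ξ ∈ S, ‖ξ - z.2‖ ≤ 1 := by
  by_contra hc
  push Not at hc
  exact h (VV_zero hg fun η hη => hc η (hs η hη))

lemma integrable_cq (hg : Win g) {f : V → ℂ} (hf : Measurable f) (hi : Integrable f) {ρ : ℝ} (hs : ∀ ξ, f ξ ≠ 0 → ‖ξ‖ ≤ ρ) (R q) :
    Integrable (cq g f R q) := by
  obtain ⟨C, hC⟩ := bdd_g hg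
  have hb : ∀ z, ‖VV g f z‖ ≤ C * ∫ η, ‖f η‖ := fun z => by
    refine (norm_integral_le_integral_norm _).trans ?_
    rw [← integral_const_mul]
    refine integral_mono_of_nonneg (Filter.Eventually.of_forall fun _ => norm_nonneg _) (hi.norm.const_mul _) (Filter.Eventually.of_forall fun η => ?_)
    dsimp only
    rw [norm_mul, norm_mul, norm_ee, mul_one, mul_comm]
    gcongr; exact hC _
  have hB : MeasurableSet (closedBall q R ×ˢ closedBall (0:V) (ρ + 1)) := measurableSet_closedBall.prod measurableSet_closedBall
  have hc : Integrable ((closedBall q R ×ˢ closedBall (0:V) (ρ + 1)).indicator fun _ : V × V => C * ∫ η, ‖f η‖) := by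
    rw [integrable_indicator_iff hB]
    refine integrableOn_const ?_
    rw [Measure.volume_eq_prod, Measure.prod_prod]
    exact ENNReal.mul_ne_top measure_closedBall_lt_top.ne measure_closedBall_lt_top.ne
  refine hc.mono' (measurable_cq hg hf R q).aestronglyMeasurable (Filter.Eventually.of_forall fun z => ?_)
  by_cases h : z ∈ closedBall q R ×ˢ closedBall (0:V) (ρ + 1)
  · rw [indicator_of_mem h]
    exact (norm_indicator_le_norm_self _ _).trans (hb z)
  · rw [indicator_of_notMem h, norm_le_zero_iff]
    by_contra h0
    unfold cq at h0
    have h1 := mem_of_indicator_ne_zero h0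
    rw [indicator_of_mem h1] at h0
    obtain ⟨ξ, hξ, h2⟩ := VV_supp hg (S := {ξ | ‖ξ‖ ≤ ρ}) hs h0
    refine h ⟨by simpa [dist_eq_norm] using h1, ?_⟩
    rw [mem_closedBall_zero_iff]
    have := norm_sub_norm_le z.2 ξ
    rw [norm_sub_rev] at this
    have : ‖ξ‖ ≤ ρ := hξ
    linarith

set_option maxHeartbeats 1000000 in
lemma tail (hM : ∀ a b, ⟪M a, b⟫ = ⟪a, M b⟫) (hg : Win g) {r0 : ℝ} (hr0 : 0 < r0) : ∃ C : ℝ, 0 < C ∧ ∀ r : ℝ, 1 ≤ r → ∀ f : V → ℂ,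
    Measurable f → Integrable f → nn f ≠ ⊤ → (∀ ξ, f ξ ≠ 0 → ‖ξ‖ ≤ r0 * r) → ∀ (q : V) (p : V × ℝ), ‖p.1 - q‖ ≤ r → |p.2| ≤ 1 →
    ‖EE M f p - EE M (VS g (cq g f ((4 * r0 + 6) * r) q)) p‖ₑ ^ 2 ≤
      ofReal (C * (r ^ (Module.finrank ℝ V + 4))⁻¹) * ∫⁻ z, ‖VV g f z‖ₑ ^ 2 * ww (Module.finrank ℝ V + 1) (z.1 - q) := by
  set n := Module.finrank ℝ V with hn
  obtain ⟨C, hC, H⟩ := pk_decay M hM hg ((n + 1) + (n + 1) + (n + 1))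
  set N := (n + 1) + (n + 1) + (n + 1) with hN
  obtain ⟨I, hI, eI⟩ := ex_ofReal (WI_ne (V := V))
  obtain ⟨o, ho, eo⟩ := ex_ofReal (measure_ball_lt_top (μ := (volume : Measure V)) (x := 0) (r := 1)).ne
  refine ⟨(C * 2 ^ (2 * N) * 4 ^ N) ^ 2 * (o * (r0 + 1) ^ n * I) + 1, by positivity, fun r hr f hf hi hnf hs q p hp hp2 => ?_⟩
  have hrp : 0 < r := by linarith
  have hmV := measurable_VV hg hf
  have hmc := measurable_cq hg hf ((4 * r0 + 6) * r) q
  have hic := integrable_cq hg hf hi hs ((4 * r0 + 6) * r) q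
  have hs' : ∀ η, r0 * r < ‖η‖ → f η = 0 := fun η hη => by by_contra h; exact absurd (hs η h) (not_le.mpr hη)
  rw [EE_recon M hM hg hf hi hnf hs' p, EE_VS M hg hmc hic p, ← integral_sub (integrable_VVpk M hM hg hf hi hnf hs' p) (integrable_upk M hg hic p)]
  set B : Set V := closedBall 0 ((r0 + 1) * r) with hB
  set k : ℝ := C * 2 ^ (2 * N) * 4 ^ N * (r ^ (2 * (n + 1)))⁻¹ with hk
  have pw : ∀ z, ‖VV g f z * pk M g z p - cq g f ((4 * r0 + 6) * r) q z * pk M g z p‖ₑ ≤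
      ofReal k * ((‖VV g f z‖ₑ * ww (n + 1) (z.1 - q)) * (B.indicator (fun _ => 1) z.2 * ww (n + 1) (z.1 - q))) := fun z => by
    by_cases h1 : ‖z.1 - q‖ ≤ (4 * r0 + 6) * r
    · have : cq g f ((4 * r0 + 6) * r) q z = VV g f z := indicator_of_mem (s := {z : V × V | ‖z.1 - q‖ ≤ (4 * r0 + 6) * r}) h1 _
      rw [this, sub_self, enorm_zero]; exact zero_le
    by_cases h0 : VV g f z = 0
    · have : cq g f ((4 * r0 + 6) * r) q z = 0 := by unfold cq; simp [indicator, h0]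
      rw [this, h0]; simp
    have : cq g f ((4 * r0 + 6) * r) q z = 0 := indicator_of_notMem (s := {z : V × V | ‖z.1 - q‖ ≤ (4 * r0 + 6) * r}) h1 _
    rw [this, zero_mul, sub_zero, enorm_mul]
    obtain ⟨ξ, hξ, h2⟩ := VV_supp hg (S := {ξ | ‖ξ‖ ≤ r0 * r}) hs h0
    have h3 : ‖z.2‖ ≤ (r0 + 1) * r := by
      have := norm_sub_norm_le z.2 ξ
      rw [norm_sub_rev] at this
      have : ‖ξ‖ ≤ r0 * r := hξ
      nlinarith
    rw [indicator_of_mem (show z.2 ∈ B by simpa [hB] using h3), one_mul]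
    push Not at h1
    have h4 : ‖z.1 - q‖ ≤ 2 * ‖pos M z p‖ := by
      have e : z.1 - q = (p.1 - q) + (2 * p.2) • M z.2 - pos M z p := by unfold pos; abel
      have a1 := norm_sub_le ((p.1 - q) + (2 * p.2) • M z.2) (pos M z p)
      rw [← e] at a1
      have a2 := norm_add_le (p.1 - q) ((2 * p.2) • M z.2)
      rw [norm_smul, M.norm_map, Real.norm_eq_abs, abs_mul, abs_two] at a2
      have : |p.2| * ‖z.2‖ ≤ 1 * ((r0 + 1) * r) := by gcongr
      nlinarith
    have h5 : ww N (pos M z p) ≤ ofReal (4 ^ N) * ww N (z.1 - q) := ww_le_of (by norm_num) (by nlinarith [norm_nonneg (z.1 - q)])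
    have h6 : ww (n + 1) (z.1 - q) ≤ ofReal (r ^ (2 * (n + 1)))⁻¹ := by
      unfold ww
      apply ofReal_le_ofReal
      rw [pow_mul]
      gcongr
      have : r ≤ ‖z.1 - q‖ := by nlinarith
      nlinarith
    calc _ ≤ ‖VV g f z‖ₑ * (ofReal (C * (1 + |p.2|) ^ (2 * N)) * (ofReal (4 ^ N) * (ww (n + 1) (z.1 - q) * ww (n + 1) (z.1 - q) * ofReal (r ^ (2 * (n + 1)))⁻¹))) := by
          gcongr
          refine (H z p).trans ?_
          gcongr
          refine h5.trans ?_
          rw [hN, ww_add, ww_add]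
          gcongr
      _ ≤ ‖VV g f z‖ₑ * (ofReal (C * 2 ^ (2 * N)) * (ofReal (4 ^ N) * (ww (n + 1) (z.1 - q) * ww (n + 1) (z.1 - q) * ofReal (r ^ (2 * (n + 1)))⁻¹))) := by
          gcongr; linarith
      _ = _ := by rw [hk, ofReal_mul (p := C * 2 ^ (2 * N) * 4 ^ N) (by positivity), ofReal_mul (p := C * 2 ^ (2 * N)) (by positivity)]; ring
  have mw : Measurable fun z : V × V => ww (n + 1) (z.1 - q) := measurable_ww_comp _ (by fun_prop)
  have mB : Measurable fun z : V × V => B.indicator (fun _ => (1:ℝ≥0∞)) z.2 := (measurable_const.indicator measurableSet_closedBall).comp measurable_snd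
  have m1 : Measurable fun z : V × V => ‖VV g f z‖ₑ * ww (n + 1) (z.1 - q) := by fun_prop
  have m2 : Measurable fun z : V × V => B.indicator (fun _ => (1:ℝ≥0∞)) z.2 * ww (n + 1) (z.1 - q) := mB.mul mw
  have i2 : ∫⁻ z : V × V, (B.indicator (fun _ => (1:ℝ≥0∞)) z.2 * ww (n + 1) (z.1 - q)) ^ 2 ≤ ofReal (o * ((r0 + 1) * r) ^ n * I) := by
    calc _ ≤ ∫⁻ z : V × V, ww (n + 1) (z.1 - q) * B.indicator (fun _ => (1:ℝ≥0∞)) z.2 := by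
          refine lintegral_mono fun z => ?_
          rw [sq, mul_comm (ww _ _)]
          refine mul_le_of_le_one_right' ?_
          refine mul_le_one' ?_ (ww_le_one _ _)
          exact indicator_le_self' (fun _ _ => zero_le) _
      _ = _ := by
          rw [Measure.volume_eq_prod, lintegral_prod_mul (f := fun x => ww (n+1) (x - q)) (g := fun ξ => B.indicator (fun _ => (1:ℝ≥0∞)) ξ) (measurable_ww_comp _ (by fun_prop)).aemeasurable (measurable_const.indicator measurableSet_closedBall).aemeasurable]
          rw [lintegral_sub_right_eq_self (fun v : V => ww (n+1) v) q, lintegral_indicator measurableSet_closedBall, setLIntegral_const, one_mul, Measure.addHaar_closedBall _ _ (by positivity), eo, ← ofReal_mul (by positivity)]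
          have : ∫⁻ v : V, ww (n+1) v = ofReal I := eI
          rw [this, ← ofReal_mul (by positivity)]
          congr 1; ring
  calc _ ≤ (ofReal k * ∫⁻ z, ((‖VV g f z‖ₑ * ww (n + 1) (z.1 - q)) * (B.indicator (fun _ => 1) z.2 * ww (n + 1) (z.1 - q)))) ^ 2 := by
        gcongr
        refine (enorm_integral_le_lintegral_enorm _).trans ?_
        rw [← lintegral_const_mul _ (by fun_prop)]
        exact lintegral_mono pw
    _ ≤ ofReal k ^ 2 * ((∫⁻ z, ‖VV g f z‖ₑ ^ 2 * ww (n + 1) (z.1 - q)) * ofReal (o * ((r0 + 1) * r) ^ n * I)) := by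
        rw [mul_pow]
        gcongr
        refine (CS_sq m1.aemeasurable m2.aemeasurable).trans ?_
        gcongr with z
        rw [mul_pow, sq (ww _ _)]
        gcongr
        exact mul_le_of_le_one_right' (ww_le_one _ _)
    _ = ofReal (k ^ 2 * (o * ((r0 + 1) * r) ^ n * I)) * (∫⁻ z, ‖VV g f z‖ₑ ^ 2 * ww (n + 1) (z.1 - q)) := by
        rw [ofReal_mul (p := k ^ 2) (by positivity), ofReal_pow (by positivity)]; ring
    _ ≤ _ := by
        refine mul_le_mul_left (ofReal_le_ofReal ?_) _
        rw [hk]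
        have : (r ^ (2 * (n + 1)))⁻¹ ^ 2 * r ^ n ≤ (r ^ (n + 4))⁻¹ := by
          have e : (r ^ (2 * (n + 1)))⁻¹ ^ 2 * r ^ n = (r ^ (n + 4))⁻¹ * (r ^ (2 * n))⁻¹ := by
            field_simp
            ring
          rw [e]
          exact mul_le_of_le_one_right (by positivity) (inv_le_one_of_one_le₀ (one_le_pow₀ hr))
        calc _ = (C * 2 ^ (2 * N) * 4 ^ N) ^ 2 * (o * (r0 + 1) ^ n * I) * ((r ^ (2 * (n + 1)))⁻¹ ^ 2 * r ^ n) := by rw [mul_pow (r0 + 1) r n]; ring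
          _ ≤ (C * 2 ^ (2 * N) * 4 ^ N) ^ 2 * (o * (r0 + 1) ^ n * I) * (r ^ (n + 4))⁻¹ := by gcongr
          _ ≤ _ := by gcongr; linarith

lemma conv {X : Type*} [MeasurableSpace X] {μ : Measure X} [SFinite μ] {π : X → V} (hπ : Measurable π) {h : X → ℝ≥0∞} (hh : Measurable h)
    {k : V → ℝ≥0∞} (hk : Measurable k) : ∫⁻ q, ∫⁻ x, h x * k (π x - q) ∂μ = (∫⁻ x, h x ∂μ) * ∫⁻ v, k v := by
  rw [lintegral_lintegral_swap (by fun_prop), ← lintegral_mul_const _ hh]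
  refine lintegral_congr fun x => ?_
  rw [lintegral_const_mul _ (by fun_prop), lintegral_sub_left_eq_self k]

lemma young {s : ℝ} (hs : 0 < s) (a b : ℝ≥0∞) : a * b ≤ ofReal s⁻¹ * a ^ 2 + ofReal s * b ^ 2 := by
  rcases le_total a (ofReal s * b) with h | h
  · exact le_add_left (by rw [sq, ← mul_assoc]; gcongr)
  · refine le_add_right ?_
    have : b ≤ ofReal s⁻¹ * a := by
      calc b = ofReal s⁻¹ * (ofReal s * b) := by
            rw [← mul_assoc, ← ofReal_mul (by positivity), inv_mul_cancel₀ hs.ne', ofReal_one, one_mul]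
        _ ≤ _ := by gcongr
    calc a * b ≤ a * (ofReal s⁻¹ * a) := by gcongr
      _ = _ := by ring

lemma young2 {s : ℝ} (hs : 1 ≤ s) {x1 x2 A1 A2 e1 e2 W : ℝ≥0∞} (h1 : x1 ≤ A1 + e1) (h2 : x2 ≤ A2 + e2) (hW : W ≤ 1) :
    x1 * x2 * W ≤ A1 * A2 * W + ofReal s⁻¹ * (A1 ^ 2 + A2 ^ 2) + ofReal (2 * s) * (e1 ^ 2 + e2 ^ 2) := by
  have y1 := young (by linarith : 0 < s) A1 e2
  have y2 := young (by linarith : 0 < s) A2 e1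
  have y3 : e1 * e2 ≤ ofReal s * (e1 ^ 2 + e2 ^ 2) := by
    have := young one_pos e1 e2
    simp only [inv_one, ofReal_one, one_mul] at this
    refine this.trans (le_mul_of_one_le_left' ?_)
    rwa [ENNReal.one_le_ofReal]
  calc x1 * x2 * W ≤ (A1 + e1) * (A2 + e2) * W := by gcongr
    _ = A1 * A2 * W + (A1 * e2 + A2 * e1 + e1 * e2) * W := by ring
    _ ≤ A1 * A2 * W + (A1 * e2 + A2 * e1 + e1 * e2) := by gcongr; exact mul_le_of_le_one_right' hW
    _ ≤ A1 * A2 * W + ((ofReal s⁻¹ * A1 ^ 2 + ofReal s * e2 ^ 2) + (ofReal s⁻¹ * A2 ^ 2 + ofReal s * e1 ^ 2) + ofReal s * (e1 ^ 2 + e2 ^ 2)) := by gcongr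
    _ = _ := by rw [two_mul, ofReal_add (by linarith) (by linarith)]; ring

set_option maxHeartbeats 2000000 in
lemma glob (hM : ∀ a b, ⟪M a, b⟫ = ⟪a, M b⟫) (hg : Win g) {α γ r0 l : ℝ} (hB : Bil M α γ) (hr0 : 0 < r0) (hl : 0 < l) : ∃ C : ℝ, 0 < C ∧ ∀ (r : ℝ) (K : ℕ), 1 ≤ r → 1 ≤ K → (K : ℝ) ≤ r →
    ∀ S1 S2 T1 T2 : Set V, (∀ ξ ∈ S1, ‖ξ‖ ≤ r0 * r) → (∀ ξ ∈ S2, ‖ξ‖ ≤ r0 * r) → (∀ ξ ∈ T1, ‖ξ‖ ≤ r0 * r) → (∀ ξ ∈ T2, ‖ξ‖ ≤ r0 * r) → Sep M r l T1 T2 → Sep M r l T2 T1 →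
    (∀ ξ ∈ S1, ∀ η, ‖η - ξ‖ ≤ 2 → η ∈ T1) → (∀ ξ ∈ S2, ∀ η, ‖η - ξ‖ ≤ 2 → η ∈ T2) →
    ∀ W, Wt α r W → ∀ f1 f2 : V → ℂ, Measurable f1 → Measurable f2 → Integrable f1 → Integrable f2 →
    (∀ ξ, f1 ξ ≠ 0 → ξ ∈ S1) → (∀ ξ, f2 ξ ≠ 0 → ξ ∈ S2) →
    ∫⁻ p, ‖EE M f1 p‖ₑ * ‖EE M f2 p‖ₑ * W p ∂(pm (Ico 0 1)) ≤
      ofReal (C * (r ^ 2)⁻¹ * ((r ^ 2 * (K:ℝ)⁻¹) ^ γ + K * √((K:ℝ) ^ Module.finrank ℝ V) * r ^ (α - (Module.finrank ℝ V : ℝ) / 2 + 1 / 2) + 1)) * (nn f1 + nn f2) := by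
  obtain ⟨C1, hC1, H1⟩ := loc M hM hg hB hr0 hl
  obtain ⟨C2, hC2, H2⟩ := tail M hM hg hr0
  obtain ⟨I, hI, eI⟩ := ex_ofReal (WI_ne (V := V))
  obtain ⟨o, ho, eo⟩ := ex_ofReal (measure_ball_lt_top (μ := (volume : Measure V)) (x := 0) (r := 1)).ne
  have hop : 0 < o := by
    have := measure_ball_pos (volume : Measure V) 0 (one_pos : (0:ℝ) < 1)
    rw [eo] at this; exact ENNReal.ofReal_pos.mp this
  set n := Module.finrank ℝ V with hn
  set c4 := 4 * r0 + 6 with hc4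
  refine ⟨(C1 + 4) * c4 ^ n + 2 * C2 * I, by positivity, fun r K hr hK hKr S1 S2 T1 T2 bS1 bS2 bT1 bT2 h12 h21 hST1 hST2 W hW f1 f2 m1 m2 i1 i2 s1 s2 => ?_⟩
  have hrp : 0 < r := by linarith
  have hKp : (0:ℝ) < K := by exact_mod_cast hK
  set X := (r ^ 2 * (K:ℝ)⁻¹) ^ γ + K * √((K:ℝ) ^ n) * r ^ (α - (n : ℝ) / 2 + 1 / 2) with hX
  have hX0 : 0 ≤ X := by positivity
  by_cases htop : nn f1 = ⊤ ∨ nn f2 = ⊤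
  · have : nn f1 + nn f2 = ⊤ := by rcases htop with h | h <;> simp [h]
    rw [this, ENNReal.mul_top]
    · exact le_top
    · rw [Ne, ENNReal.ofReal_eq_zero, not_le]; positivity
  push Not at htop
  set c : (V → ℂ) → V → V × V → ℂ := fun f q => cq g f (c4 * r) q
  set Z : (V → ℂ) → V → ℝ≥0∞ := fun f q => ∫⁻ z, ‖VV g f z‖ₑ ^ 2 * ww (n + 1) (z.1 - q)
  have mW := hW.1
  have mE1 := measurable_EE M m1
  have mE2 := measurable_EE M m2
  have fs : ∀ (f : V → ℂ) (S : Set V), (∀ ξ ∈ S, ‖ξ‖ ≤ r0 * r) → (∀ ξ, f ξ ≠ 0 → ξ ∈ S) → ∀ ξ, f ξ ≠ 0 → ‖ξ‖ ≤ r0 * r := fun f S a b ξ h => a _ (b _ h)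
  have cs : ∀ (f : V → ℂ) (S T : Set V), (∀ ξ ∈ S, ∀ η, ‖η - ξ‖ ≤ 2 → η ∈ T) → (∀ ξ, f ξ ≠ 0 → ξ ∈ S) → ∀ q z, c f q z ≠ 0 → ∀ η, ‖η - z.2‖ ≤ 1 → η ∈ T := fun f S T hST hf q z hz η hη => by
    have h0 : VV g f z ≠ 0 := fun h => hz (by simp [c, cq, indicator, h])
    obtain ⟨ξ, h1, h2⟩ := VV_supp hg hf h0
    refine hST ξ h1 η ?_
    have := norm_sub_le (η - z.2) (ξ - z.2)
    rw [sub_sub_sub_cancel_right] at this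
    linarith
  have en : ∀ f : V → ℂ, Measurable f → Integrable f → (∀ ξ, f ξ ≠ 0 → ‖ξ‖ ≤ r0 * r) → ∀ q, ∫⁻ p in closedBall q r ×ˢ Ico (0:ℝ) 1, ‖EE M (VS g (c f q)) p‖ₑ ^ 2 ≤ 2 * nn (c f q) := fun f mf jf sf q => by
    have mc := measurable_cq hg mf (c4 * r) q
    have ic := integrable_cq hg mf jf sf (c4 * r) q
    have mv := measurable_VS hg mc
    have iv := integrable_VS hg mc ic
    have := triv M (zero_le_one) (t0 := 0) (W := fun _ => 1) (fun _ => le_rfl) mv mv iv iv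
    rw [zero_add] at this
    calc _ ≤ ∫⁻ p, ‖EE M (VS g (c f q)) p‖ₑ * ‖EE M (VS g (c f q)) p‖ₑ * 1 ∂(pm (Ico 0 1)) := by
          simp only [mul_one, ← sq]
          exact lintegral_mono' (Measure.restrict_mono (prod_mono_left (subset_univ _)) le_rfl) le_rfl
      _ ≤ _ := this
      _ ≤ _ := by
          rw [ofReal_one, one_mul, ← two_mul]
          gcongr
          exact nn_VS_le hg mc ic
  have te : ∀ f : V → ℂ, Measurable f → Integrable f → nn f ≠ ⊤ → (∀ ξ, f ξ ≠ 0 → ‖ξ‖ ≤ r0 * r) → ∀ q, ∫⁻ p in closedBall q r ×ˢ Ico (0:ℝ) 1, ‖EE M f p - EE M (VS g (c f q)) p‖ₑ ^ 2 ≤ ofReal (o * C2 * (r ^ 4)⁻¹) * Z f q := fun f mf jf nf sf q => by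
    calc _ ≤ ∫⁻ p in closedBall q r ×ˢ Ico (0:ℝ) 1, ofReal (C2 * (r ^ (n + 4))⁻¹) * Z f q := by
          refine setLIntegral_mono measurable_const fun p hp => ?_
          refine H2 r hr f mf jf nf sf q p (by simpa [dist_eq_norm] using hp.1) ?_
          rw [abs_le]; have := hp.2; constructor <;> linarith [this.1, this.2]
      _ = _ := by
          rw [setLIntegral_const, Measure.volume_eq_prod, Measure.prod_prod, Measure.addHaar_closedBall _ _ hrp.le, eo, Real.volume_Ico, mul_comm, ← mul_assoc, ← ofReal_mul (by positivity), ← ofReal_mul (by positivity), ← ofReal_mul (by positivity), ← hn]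
          congr 2; rw [pow_add]; field_simp; ring
  have fix : ∀ q, ∫⁻ p in closedBall q r ×ˢ Ico (0:ℝ) 1, ‖EE M f1 p‖ₑ * ‖EE M f2 p‖ₑ * W p ≤
      ofReal ((r ^ 2)⁻¹ * (C1 * X + 2)) * (nn (c f1 q) + nn (c f2 q)) + ofReal (2 * o * C2 * (r ^ 2)⁻¹) * (Z f1 q + Z f2 q) := fun q => by
    have mc1 := measurable_cq hg m1 (c4 * r) q
    have mc2 := measurable_cq hg m2 (c4 * r) q
    have ic1 := integrable_cq hg m1 i1 (fs _ _ bS1 s1) (c4 * r) q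
    have ic2 := integrable_cq hg m2 i2 (fs _ _ bS2 s2) (c4 * r) q
    have mA1 := measurable_EE M (measurable_VS hg mc1)
    have mA2 := measurable_EE M (measurable_VS hg mc2)
    have L := H1 r K hr hK hKr T1 T2 bT1 bT2 h12 h21 W hW (c f1 q) (c f2 q) mc1 mc2 ic1 ic2 (cs _ _ _ hST1 s1 q) (cs _ _ _ hST2 s2 q) q
    calc _ ≤ ∫⁻ p in closedBall q r ×ˢ Ico (0:ℝ) 1, (‖EE M (VS g (c f1 q)) p‖ₑ * ‖EE M (VS g (c f2 q)) p‖ₑ * W p + ofReal (r ^ 2)⁻¹ * (‖EE M (VS g (c f1 q)) p‖ₑ ^ 2 + ‖EE M (VS g (c f2 q)) p‖ₑ ^ 2)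
            + ofReal (2 * r ^ 2) * (‖EE M f1 p - EE M (VS g (c f1 q)) p‖ₑ ^ 2 + ‖EE M f2 p - EE M (VS g (c f2 q)) p‖ₑ ^ 2)) := by
          refine lintegral_mono fun p => young2 (one_le_pow₀ hr) ?_ ?_ (hW.2.1 p)
          · refine le_trans ?_ (enorm_add_le _ _); rw [add_sub_cancel]
          · refine le_trans ?_ (enorm_add_le _ _); rw [add_sub_cancel]
      _ ≤ ofReal (C1 * (r ^ 2)⁻¹ * X) * (nn (c f1 q) + nn (c f2 q)) + ofReal (r ^ 2)⁻¹ * (2 * nn (c f1 q) + 2 * nn (c f2 q))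
          + ofReal (2 * r ^ 2) * (ofReal (o * C2 * (r ^ 4)⁻¹) * Z f1 q + ofReal (o * C2 * (r ^ 4)⁻¹) * Z f2 q) := by
          have a1 : Measurable fun p => ‖EE M (VS g (c f1 q)) p‖ₑ ^ 2 := by fun_prop
          have a2 : Measurable fun p => ‖EE M f1 p - EE M (VS g (c f1 q)) p‖ₑ ^ 2 := by fun_prop
          rw [lintegral_add_left (by fun_prop), lintegral_add_left (by fun_prop), lintegral_const_mul _ (by fun_prop), lintegral_const_mul _ (by fun_prop), lintegral_add_left a1, lintegral_add_left a2]
          gcongr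
          · exact en f1 m1 i1 (fs _ _ bS1 s1) q
          · exact en f2 m2 i2 (fs _ _ bS2 s2) q
          · exact te f1 m1 i1 htop.1 (fs _ _ bS1 s1) q
          · exact te f2 m2 i2 htop.2 (fs _ _ bS2 s2) q
      _ = _ := by
          rw [← mul_add 2, ← mul_add, ← mul_assoc, ← mul_assoc, ← add_mul, ← ofReal_mul (by positivity), ← ENNReal.ofReal_ofNat 2, ← ofReal_mul (by positivity), ← ofReal_add (by positivity) (by positivity)]
          congr 3
          · ring
          · field_simp
  have mV1 := measurable_VV hg m1
  have mV2 := measurable_VV hg m2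
  set kk : ℝ → V → ℝ≥0∞ := fun R => (closedBall 0 R).indicator fun _ => 1
  have mk : ∀ R, Measurable (kk R) := fun R => measurable_const.indicator measurableSet_closedBall
  have ik : ∀ R, 0 ≤ R → ∫⁻ v, kk R v = ofReal (R ^ n * o) := fun R hR => by
    simp only [kk]
    rw [lintegral_indicator measurableSet_closedBall, setLIntegral_const, one_mul, Measure.addHaar_closedBall _ _ hR, eo, ← ofReal_mul (by positivity)]
  have ic : ∀ f : V → ℂ, Measurable f → Integrable f → ∫⁻ q, nn (c f q) ≤ nn f * ofReal ((c4 * r) ^ n * o) := fun f mf jf => by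
    have mV := measurable_VV hg mf
    have e : ∀ q, nn (c f q) = ∫⁻ z, ‖VV g f z‖ₑ ^ 2 * kk (c4 * r) (z.1 - q) := fun q => by
      refine lintegral_congr fun z => ?_
      simp only [c, cq, kk, indicator, mem_setOf_eq, mem_closedBall_zero_iff]
      split_ifs <;> simp
    simp_rw [e]
    rw [conv measurable_fst (by fun_prop) (mk _), ik _ (by positivity)]
    gcongr
    exact nn_VV_le hg mf jf
  have iZ : ∀ f : V → ℂ, Measurable f → Integrable f → ∫⁻ q, Z f q ≤ nn f * ofReal I := fun f mf jf => by
    have mV := measurable_VV hg mf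
    simp only [Z]
    rw [conv measurable_fst (by fun_prop) (measurable_ww _), ← eI]
    gcongr
    · exact nn_VV_le hg mf jf
    · exact le_rfl
  have mc : ∀ f : V → ℂ, Measurable f → Measurable fun q => nn (c f q) := fun f mf => by
    have mV := measurable_VV hg mf
    have : Measurable fun x : V × (V × V) => ‖c f x.1 x.2‖ₑ ^ 2 := by
      have : Measurable fun x : V × (V × V) => c f x.1 x.2 := by
        have hS : MeasurableSet {x : V × (V × V) | ‖x.2.1 - x.1‖ ≤ c4 * r} := measurableSet_le (by fun_prop) (by fun_prop)
        exact (mV.comp measurable_snd).indicator hS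
      fun_prop
    exact this.lintegral_prod_right'
  have mZ : ∀ f : V → ℂ, Measurable f → Measurable (Z f) := fun f mf => by
    have mV := measurable_VV hg mf
    have h2 : Measurable fun x : V × (V × V) => ww (n+1) (x.2.1 - x.1) := measurable_ww_comp _ (by fun_prop)
    have : Measurable fun x : V × (V × V) => ‖VV g f x.2‖ₑ ^ 2 * ww (n+1) (x.2.1 - x.1) := by fun_prop
    exact this.lintegral_prod_right'
  have mc1 := mc f1 m1
  have mc2 := mc f2 m2
  have mZ1 := mZ f1 m1
  have mZ2 := mZ f2 m2
  haveI : SFinite (pm (Ico 0 1) : Measure (V × ℝ)) := by rw [pm_eq]; infer_instance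
  have main : (∫⁻ p, ‖EE M f1 p‖ₑ * ‖EE M f2 p‖ₑ * W p ∂(pm (Ico 0 1))) * ofReal (r ^ n * o) ≤
      ofReal ((r ^ 2)⁻¹ * (C1 * X + 2)) * (nn f1 * ofReal ((c4 * r) ^ n * o) + nn f2 * ofReal ((c4 * r) ^ n * o)) + ofReal (2 * o * C2 * (r ^ 2)⁻¹) * (nn f1 * ofReal I + nn f2 * ofReal I) := by
    rw [← ik r hrp.le, ← conv measurable_fst (by fun_prop) (mk _)]
    calc _ = ∫⁻ q, ∫⁻ p in closedBall q r ×ˢ Ico (0:ℝ) 1, ‖EE M f1 p‖ₑ * ‖EE M f2 p‖ₑ * W p := by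
          refine lintegral_congr fun q => ?_
          unfold pm
          rw [← lintegral_indicator (MeasurableSet.univ.prod measurableSet_Ico), ← lintegral_indicator (measurableSet_closedBall.prod measurableSet_Ico)]
          refine lintegral_congr fun p => ?_
          simp only [kk, indicator, mem_prod, mem_univ, true_and, mem_closedBall_zero_iff, mem_closedBall, dist_eq_norm]
          by_cases h1 : ‖p.1 - q‖ ≤ r <;> by_cases h2 : p.2 ∈ Ico (0:ℝ) 1 <;> simp [h1, h2]
      _ ≤ _ := lintegral_mono fix
      _ ≤ _ := by
          rw [lintegral_add_left (by fun_prop), lintegral_const_mul _ (by fun_prop), lintegral_const_mul _ (by fun_prop), lintegral_add_left mc1, lintegral_add_left mZ1]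
          gcongr
          · exact ic f1 m1 i1
          · exact ic f2 m2 i2
          · exact iZ f1 m1 i1
          · exact iZ f2 m2 i2
  have hro : (0:ℝ) < r ^ n * o := by positivity
  rw [← ENNReal.mul_le_mul_iff_left (ENNReal.ofReal_pos.mpr hro).ne' ofReal_ne_top]
  refine main.trans ?_
  rw [← add_mul, ← add_mul, mul_comm _ (ofReal ((c4 * r) ^ n * o)), mul_comm _ (ofReal I), ← mul_assoc, ← mul_assoc, ← add_mul, mul_comm (ofReal _ * (nn f1 + nn f2)), ← mul_assoc]
  refine mul_le_mul_left ?_ _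
  rw [← ofReal_mul (by positivity), ← ofReal_mul (by positivity), ← ofReal_mul (by positivity), ← ofReal_add (by positivity) (by positivity)]
  refine ofReal_le_ofReal ?_
  have hrn : 1 ≤ r ^ n := one_le_pow₀ hr
  have e1 : (C1 * X + 2) * c4 ^ n * r ^ n + 2 * C2 * I ≤ r ^ n * (((C1 + 4) * c4 ^ n + 2 * C2 * I) * (X + 1)) := by
    have a : 2 * C2 * I ≤ r ^ n * (2 * C2 * I * (X + 1)) := by
      have : 2 * C2 * I ≤ 2 * C2 * I * (X + 1) := le_mul_of_one_le_right (by positivity) (by linarith)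
      exact this.trans (le_mul_of_one_le_left (by positivity) hrn)
    have b : (C1 * X + 2) * c4 ^ n ≤ (C1 + 4) * c4 ^ n * (X + 1) := by
      have : C1 * X + 2 ≤ (C1 + 4) * (X + 1) := by nlinarith
      nlinarith [show 0 ≤ c4 ^ n by positivity]
    nlinarith
  calc _ = o * (r ^ 2)⁻¹ * ((C1 * X + 2) * c4 ^ n * r ^ n + 2 * C2 * I) := by rw [mul_pow]; ring
    _ ≤ o * (r ^ 2)⁻¹ * (r ^ n * (((C1 + 4) * c4 ^ n + 2 * C2 * I) * (X + 1))) := by gcongr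
    _ = _ := by ring

lemma abs_inner_M (a b : V) : |⟪M a, b⟫| ≤ ‖a‖ * ‖b‖ := by
  have := abs_real_inner_le_norm (M a) b
  rwa [M.norm_map] at this

lemma inner_stab {a a' b b' : V} {c A B : ℝ} (ha : ‖a' - a‖ ≤ c) (hb : ‖b' - b‖ ≤ c) (hA : ‖a‖ ≤ A) (hB : ‖b'‖ ≤ B) :
    |⟪M a, b⟫| ≤ |⟪M a', b'⟫| + c * (A + B) := by
  have e : ⟪M a, b⟫ = ⟪M a', b'⟫ - (⟪M (a' - a), b'⟫ + ⟪M a, b' - b⟫) := by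
    rw [map_sub, inner_sub_left, inner_sub_right]; ring
  have h1 := abs_inner_M M (a' - a) b'
  have h2 := abs_inner_M M a (b' - b)
  have h3 : ‖a' - a‖ * ‖b'‖ ≤ c * B := mul_le_mul ha hB (norm_nonneg _) ((norm_nonneg _).trans ha)
  have h4 : ‖a‖ * ‖b' - b‖ ≤ A * c := mul_le_mul hA hb (norm_nonneg _) ((norm_nonneg _).trans hA)
  rw [e]
  refine (abs_sub _ _).trans ?_
  have := abs_add_le ⟪M (a' - a), b'⟫ ⟪M a, b' - b⟫
  linarith

lemma Sep_thick {r0 r l : ℝ} (hr0 : 0 < r0) (hl : 0 < l) (hr : 1 ≤ r) (hr1 : 32 * (r0 + 2) / l ≤ r) {S1 S2 : Set V}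
    (h1 : ∀ ξ ∈ S1, ‖ξ‖ ≤ r0 * r) (h2 : ∀ ξ ∈ S2, ‖ξ‖ ≤ r0 * r) (h : Sep M r l S1 S2) :
    Sep M r (l / 2) {η | ∃ ξ ∈ S1, ‖η - ξ‖ ≤ 2} {η | ∃ ξ ∈ S2, ‖η - ξ‖ ≤ 2} := by
  rintro a' ⟨a, ha, haa⟩ b' ⟨b, hb, hbb⟩ c' ⟨c, hc, hcc⟩
  have k := h a ha b hb c hc
  have e : ∀ x y x' y' : V, ‖x' - x‖ ≤ 2 → ‖y' - y‖ ≤ 2 → ‖(x' - y') - (x - y)‖ ≤ 4 := fun x y x' y' hx hy => by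
    rw [sub_sub_sub_comm]; exact (norm_sub_le _ _).trans (by linarith)
  have b1 : ‖c - a‖ ≤ 2 * (r0 * r) := (norm_sub_le _ _).trans (by linarith [h1 a ha, h2 c hc])
  have b2 : ‖b' - a'‖ ≤ 2 * (r0 * r) + 4 := by
    have := e b a b' a' hbb haa
    have := norm_sub_norm_le (b' - a') (b - a)
    have : ‖b - a‖ ≤ 2 * (r0 * r) := (norm_sub_le _ _).trans (by linarith [h1 a ha, h2 b hb])
    linarith
  have st := inner_stab M (e c a c' a' hcc haa) (e b a b' a' hbb haa) b1 b2
  rw [div_le_iff₀ hl] at hr1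
  nlinarith

lemma step (hM : ∀ a b, ⟪M a, b⟫ = ⟪a, M b⟫) {α γ δ γ' : ℝ} (hB : Bil M α γ) (hγ : 0 ≤ γ) (hδ : 0 < δ) (hδ1 : δ ≤ 1 / 4) (h0 : 0 ≤ γ')
    (h1 : (1 - δ) * γ ≤ γ') (h2 : (α - (Module.finrank ℝ V : ℝ) / 2 + 1 / 2) / 2 + (1 + (Module.finrank ℝ V : ℝ) / 2) * δ ≤ γ') : Bil M α γ' := by
  obtain ⟨g, hg⟩ := exists_win (V := V)
  refine bil_of_one M hM fun r0 l hr0 hl => ?_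
  obtain ⟨C, hC, H⟩ := glob M hM hg hB (r0 := r0 + 2) (l := l / 2) (by positivity) (by positivity)
  set n := Module.finrank ℝ V with hn
  set r1 := max 4 (32 * (r0 + 2) / l) with hr1
  refine ⟨C * (2 ^ (1 + (n:ℝ) / 2) + 2) + r1 ^ 2, by positivity, fun r hr S1 S2 b1 b2 h12 h21 W hW f1 f2 m1 m2 i1 i2 s1 s2 => ?_⟩
  have hrp : 0 < r := by linarith
  have hp1 : 1 ≤ (r ^ 2) ^ γ' := Real.one_le_rpow (one_le_pow₀ hr) h0
  rcases le_total r r1 with hrr | hrr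
  · have := triv M (zero_le_one) (t0 := 0) hW.2.1 m1 m2 i1 i2
    rw [zero_add] at this
    refine this.trans (mul_le_mul_left (ofReal_le_ofReal ?_) _)
    have : 1 ≤ r1 ^ 2 * (r ^ 2)⁻¹ := by
      rw [← div_eq_mul_inv, le_div_iff₀ (by positivity), one_mul]; gcongr
    calc (1:ℝ) ≤ (C * (2 ^ (1 + (n:ℝ) / 2) + 2) + r1 ^ 2) * (r ^ 2)⁻¹ := by
          have : 0 ≤ C * (2 ^ (1 + (n:ℝ) / 2) + 2) * (r ^ 2)⁻¹ := by positivity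
          linarith
      _ ≤ _ := le_mul_of_one_le_right (by positivity) hp1
  have hr4 : 4 ≤ r := (le_max_left _ _).trans hrr
  have hr5 : 32 * (r0 + 2) / l ≤ r := (le_max_right _ _).trans hrr
  set x := r ^ (2 * δ) with hx
  have hx1 : 1 ≤ x := Real.one_le_rpow hr (by positivity)
  set K := ⌈x⌉₊ with hK
  have hK1 : x ≤ K := Nat.le_ceil _
  have hK2 : (K:ℝ) ≤ 2 * x := by have := Nat.ceil_lt_add_one (show 0 ≤ x by positivity); linarith
  have hKr : (K:ℝ) ≤ r := by
    refine hK2.trans ?_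
    have : x ≤ √r := by
      rw [Real.sqrt_eq_rpow]; exact Real.rpow_le_rpow_of_exponent_le hr (by linarith)
    have h2 : 2 ≤ √r := Real.le_sqrt_of_sq_le (by linarith)
    nlinarith [Real.sq_sqrt hrp.le]
  have hKn : 1 ≤ K := Nat.one_le_ceil_iff.mpr (by linarith)
  have hKp : (0:ℝ) < K := by linarith
  have tb : ∀ S : Set V, (∀ ξ ∈ S, ‖ξ‖ ≤ r0 * r) → ∀ ξ ∈ {η : V | ∃ ξ ∈ S, ‖η - ξ‖ ≤ 2}, ‖ξ‖ ≤ (r0 + 2) * r := by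
    rintro S hS η ⟨ξ, hξ, h⟩
    have := norm_sub_norm_le η ξ
    have := hS ξ hξ
    nlinarith
  have key := H r K hr hKn hKr S1 S2 {η | ∃ ξ ∈ S1, ‖η - ξ‖ ≤ 2} {η | ∃ ξ ∈ S2, ‖η - ξ‖ ≤ 2} (fun ξ h => (b1 ξ h).trans (by nlinarith)) (fun ξ h => (b2 ξ h).trans (by nlinarith))
    (tb _ b1) (tb _ b2) (Sep_thick M hr0 hl hr hr5 b1 b2 h12) (Sep_thick M hr0 hl hr hr5 b2 b1 h21) (fun ξ h η hη => ⟨ξ, h, hη⟩) (fun ξ h η hη => ⟨ξ, h, hη⟩)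
    W hW f1 f2 m1 m2 i1 i2 s1 s2
  refine key.trans (mul_le_mul_left (ofReal_le_ofReal ?_) _)
  have r2 : (r ^ 2) ^ γ' = r ^ (2 * γ') := by rw [Real.rpow_mul hrp.le, Real.rpow_two]
  have t1 : (r ^ 2 * (K:ℝ)⁻¹) ^ γ ≤ (r ^ 2) ^ γ' := by
    have : r ^ 2 * (K:ℝ)⁻¹ ≤ r ^ (2 - 2 * δ) := by
      rw [Real.rpow_sub hrp, Real.rpow_two, div_eq_mul_inv]; gcongr
    calc _ ≤ (r ^ (2 - 2 * δ)) ^ γ := by gcongr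
      _ = r ^ ((2 - 2 * δ) * γ) := by rw [Real.rpow_mul hrp.le]
      _ ≤ r ^ (2 * γ') := Real.rpow_le_rpow_of_exponent_le hr (by linarith)
      _ = _ := r2.symm
  have t2 : K * √((K:ℝ) ^ n) * r ^ (α - (n:ℝ) / 2 + 1 / 2) ≤ 2 ^ (1 + (n:ℝ) / 2) * (r ^ 2) ^ γ' := by
    have e1 : K * √((K:ℝ) ^ n) = (K:ℝ) ^ (1 + (n:ℝ) / 2) := by
      rw [Real.rpow_add hKp, Real.rpow_one, Real.sqrt_eq_rpow, ← Real.rpow_natCast, ← Real.rpow_mul hKp.le]; ring_nf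
    rw [e1]
    calc _ ≤ (2 * x) ^ (1 + (n:ℝ) / 2) * r ^ (α - (n:ℝ) / 2 + 1 / 2) := by gcongr
      _ = 2 ^ (1 + (n:ℝ) / 2) * r ^ (2 * δ * (1 + (n:ℝ) / 2) + (α - (n:ℝ) / 2 + 1 / 2)) := by
          rw [Real.mul_rpow (by positivity) (by positivity), hx, ← Real.rpow_mul hrp.le, mul_assoc, ← Real.rpow_add hrp]
      _ ≤ 2 ^ (1 + (n:ℝ) / 2) * r ^ (2 * γ') := by
          gcongr
          linarith
      _ = _ := by rw [r2]
  calc _ ≤ C * (r ^ 2)⁻¹ * ((r ^ 2) ^ γ' + 2 ^ (1 + (n:ℝ) / 2) * (r ^ 2) ^ γ' + (r ^ 2) ^ γ') := by gcongr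
    _ = C * (2 ^ (1 + (n:ℝ) / 2) + 2) * (r ^ 2)⁻¹ * (r ^ 2) ^ γ' := by ring
    _ ≤ _ := by gcongr; linarith [sq_nonneg r1]

theorem bil_all (hM : ∀ a b, ⟪M a, b⟫ = ⟪a, M b⟫) {α γ : ℝ} (h0 : 0 < γ) (h : (α - (Module.finrank ℝ V : ℝ) / 2 + 1 / 2) / 2 < γ) : Bil M α γ := by
  set n := Module.finrank ℝ V with hn
  have base : Bil M α 1 := fun r0 l hr0 hl => ⟨1, one_pos, fun r T t0 hr hT hrT S1 S2 b1 b2 h12 h21 W hW f1 f2 m1 m2 i1 i2 s1 s2 => by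
    refine (triv M hT.le hW.2.1 m1 m2 i1 i2).trans (mul_le_mul_left (ofReal_le_ofReal ?_) _)
    rw [Real.rpow_one, one_mul, ← mul_assoc, inv_mul_cancel₀ (by positivity), one_mul]⟩
  set δ := min (1 / 4) ((γ - (α - (n : ℝ) / 2 + 1 / 2) / 2) / (1 + (n:ℝ) / 2)) with hδ
  have hδ0 : 0 < δ := lt_min (by norm_num) (div_pos (by linarith) (by positivity))
  have hδ1 : δ ≤ 1 / 4 := min_le_left _ _
  have hδ2 : (1 + (n:ℝ) / 2) * δ ≤ γ - (α - (n : ℝ) / 2 + 1 / 2) / 2 := by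
    have := min_le_right (1 / 4) ((γ - (α - (n : ℝ) / 2 + 1 / 2) / 2) / (1 + (n:ℝ) / 2))
    rw [← hδ, le_div_iff₀ (by positivity)] at this
    linarith
  have it : ∀ k : ℕ, Bil M α (max ((1 - δ) ^ k) γ) ∨ Bil M α γ := fun k => by
    induction k with
    | zero =>
      rcases le_total 1 γ with h1 | h1
      · right
        refine step M hM base zero_le_one hδ0 hδ1 h0.le ?_ (by linarith)
        linarith
      · left; rwa [pow_zero, max_eq_left h1]
    | succ k ih =>
      refine ih.imp_left fun ih => ?_
      refine step M hM ih (le_max_of_le_right h0.le) hδ0 hδ1 (le_max_of_le_right h0.le) ?_ ((by linarith : _ ≤ γ).trans (le_max_right _ _))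
      rw [mul_max_of_nonneg _ _ (by linarith), ← pow_succ']
      exact max_le_max le_rfl (by nlinarith)
  obtain ⟨k, hk⟩ := exists_pow_lt_of_lt_one h0 (show 1 - δ < 1 by linarith)
  rcases it k with h | h
  · rwa [max_eq_right hk.le] at h
  · exact h

def kap (ξ : V) : ℂ := ∫ v in closedBall (0 : V × ℝ) (1 / 32), ee (ph M v ξ)

def vb (V : Type*) [NormedAddCommGroup V] [InnerProductSpace ℝ V] [FiniteDimensional ℝ V]
  [MeasurableSpace V] [BorelSpace V] : ℝ := (volume : Measure (V × ℝ)).real (closedBall 0 (1 / 32))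

lemma vb_pos : 0 < vb V := by
  unfold vb
  exact ENNReal.toReal_pos (measure_closedBall_pos _ _ (by norm_num)).ne' measure_closedBall_lt_top.ne

lemma measurable_kap : Measurable (kap M) := by
  have h1 : StronglyMeasurable fun q : V × (V × ℝ) => ee (ph M q.2 q.1) := by
    apply Measurable.stronglyMeasurable
    exact measurable_ee.comp ((continuous_ph M).measurable.comp (by fun_prop : Measurable fun q : V × (V × ℝ) => (q.2, q.1)))
  exact h1.integral_prod_right.measurable

instance instALI : (volume : Measure (V × ℝ)).IsAddLeftInvariant := by
  rw [Measure.volume_eq_prod]; infer_instance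

lemma ph_add (p v : V × ℝ) (ξ : V) : ph M (p + v) ξ = ph M p ξ + ph M v ξ := by
  unfold ph; rw [Prod.fst_add, Prod.snd_add, inner_add_left]; ring

lemma norm_ee_sub (x : ℝ) : ‖ee x - 1‖ ≤ 2 * Real.pi * |x| := by
  rw [ee_eq]
  have := Real.norm_exp_I_mul_ofReal_sub_one_le (x := 2 * Real.pi * x)
  push_cast at this
  rw [mul_comm Complex.I] at this
  refine this.trans_eq ?_
  rw [norm_mul, Real.norm_of_nonneg (by positivity), Real.norm_eq_abs]

lemma continuous_ph1 (ξ : V) : Continuous fun v : V × ℝ => ph M v ξ :=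
  (continuous_ph M).comp (by fun_prop : Continuous fun v : V × ℝ => (v, ξ))

lemma kap_ge {ξ : V} (h : ‖ξ‖ ≤ 1) : vb V ≤ 2 * ‖kap M ξ‖ := by
  have hb : ‖kap M ξ - vb V‖ ≤ 1 / 2 * vb V := by
    have e : kap M ξ - vb V = ∫ v in closedBall (0 : V × ℝ) (1 / 32), (ee (ph M v ξ) - 1) := by
      rw [integral_sub, kap]
      · simp [vb]
      · exact (continuous_ee.comp (continuous_ph1 M ξ)).continuousOn.integrableOn_compact (isCompact_closedBall _ _)
      · exact integrableOn_const measure_closedBall_lt_top.ne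
    rw [e]
    refine norm_setIntegral_le_of_norm_le_const measure_closedBall_lt_top fun v hv => ?_
    refine (norm_ee_sub _).trans ?_
    rw [mem_closedBall_zero_iff] at hv
    have h1 := (norm_fst_le v).trans hv
    have h2 := (norm_snd_le v).trans hv
    have h3 : |ph M v ξ| ≤ 1 / 16 := by
      unfold ph QQ
      have a1 := abs_real_inner_le_norm v.1 ξ
      have a2 := abs_inner_M M ξ ξ
      have a3 : |v.2 * ⟪M ξ, ξ⟫| ≤ 1 / 32 := by
        rw [abs_mul]
        have : ‖ξ‖ * ‖ξ‖ ≤ 1 := mul_le_one₀ h (norm_nonneg _) h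
        exact (mul_le_mul h2 (a2.trans this) (abs_nonneg _) (by norm_num)).trans (by norm_num)
      have a4 : ‖v.1‖ * ‖ξ‖ ≤ 1 / 32 := (mul_le_mul h1 h (norm_nonneg _) (by norm_num)).trans (by norm_num)
      refine (abs_add_le _ _).trans (by linarith)
    nlinarith [Real.pi_lt_four, Real.pi_pos]
  have := norm_sub_norm_le (vb V : ℂ) (kap M ξ)
  rw [norm_sub_rev, Complex.norm_of_nonneg vb_pos.le] at this
  linarith

def pf (f : V → ℂ) (ξ : V) : ℂ := f ξ * (vb V / kap M ξ)

lemma measurable_pf {f : V → ℂ} (hf : Measurable f) : Measurable (pf M f) := by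
  have := measurable_kap M
  unfold pf; fun_prop

lemma norm_pf {f : V → ℂ} (hs : ∀ ξ, f ξ ≠ 0 → ‖ξ‖ ≤ 1) (ξ) : ‖pf M f ξ‖ ≤ 2 * ‖f ξ‖ := by
  by_cases h : f ξ = 0
  · simp [pf, h]
  have k := kap_ge M (hs ξ h)
  have hv := vb_pos (V := V)
  have kp : 0 < ‖kap M ξ‖ := by linarith
  rw [pf, norm_mul, norm_div, Complex.norm_of_nonneg hv.le, mul_comm]
  gcongr
  rwa [div_le_iff₀ kp]

lemma EE_pf {f : V → ℂ} (hf : Measurable f) (hi : Integrable f) (hs : ∀ ξ, f ξ ≠ 0 → ‖ξ‖ ≤ 1) (p) :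
    vb V * EE M f p = ∫ v in closedBall (0 : V × ℝ) (1 / 32), EE M (pf M f) (p + v) := by
  have ip : Integrable (pf M f) := (hi.norm.const_mul 2).mono' (measurable_pf M hf).aestronglyMeasurable (Filter.Eventually.of_forall (norm_pf M hs))
  have hI : Integrable (fun q : (V × ℝ) × V => pf M f q.2 * ee (ph M (p + q.1) q.2)) ((volume.restrict (closedBall (0 : V × ℝ) (1 / 32))).prod volume) := by
    haveI : IsFiniteMeasure ((volume : Measure (V × ℝ)).restrict (closedBall (0 : V × ℝ) (1 / 32))) := isFiniteMeasure_restrict.mpr measure_closedBall_lt_top.ne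
    refine (ip.comp_snd _).mul_bdd (c := 1) ?_ (Filter.Eventually.of_forall fun q => (norm_ee _).le)
    exact (continuous_ee.comp ((continuous_ph M).comp (by fun_prop : Continuous fun q : (V × ℝ) × V => (p + q.1, q.2)))).aestronglyMeasurable
  unfold EE
  rw [integral_integral_swap hI, ← integral_const_mul]
  congr 1; ext ξ
  simp_rw [ph_add, ee_add]
  rw [integral_const_mul, integral_const_mul]
  change _ = _ * (_ * kap M ξ)
  by_cases h : f ξ = 0
  · simp [pf, h]
  have k := kap_ge M (hs ξ h)
  have hv := vb_pos (V := V)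
  have kp : kap M ξ ≠ 0 := by intro h0; rw [h0, norm_zero] at k; linarith
  rw [pf]; field_simp

lemma enorm_EE_pf {f : V → ℂ} (hf : Measurable f) (hi : Integrable f) (hs : ∀ ξ, f ξ ≠ 0 → ‖ξ‖ ≤ 1) (p) :
    ofReal (vb V) * ‖EE M f p‖ₑ ≤ ∫⁻ v in closedBall (0 : V × ℝ) (1 / 32), ‖EE M (pf M f) (p + v)‖ₑ := by
  have : ofReal (vb V) = ‖(vb V : ℂ)‖ₑ := by
    rw [← ofReal_norm, Complex.norm_of_nonneg vb_pos.le]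
  rw [this, ← enorm_mul, EE_pf M hf hi hs]
  exact enorm_integral_le_lintegral_enorm _

lemma measurable_Nw {ν : Measure (V × ℝ)} [SFinite ν] (η : ℝ) : Measurable fun x => ν (closedBall x η) := by
  have : MeasurableSet {q : (V × ℝ) × (V × ℝ) | dist q.2 q.1 ≤ η} := measurableSet_le (by fun_prop) (by fun_prop)
  exact measurable_measure_prodMk_left this

lemma ball_swap {ν : Measure (V × ℝ)} [SFinite ν] {η : ℝ} {G : V × ℝ → ℝ≥0∞} (hG : Measurable G) :
    ∫⁻ p, (∫⁻ v in closedBall (0 : V × ℝ) η, G (p + v)) ∂ν = ∫⁻ x, G x * ν (closedBall x η) := by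
  have mS : MeasurableSet {q : (V × ℝ) × (V × ℝ) | dist q.1 q.2 ≤ η} := measurableSet_le (by fun_prop) (by fun_prop)
  have e1 : ∀ p, ∫⁻ v in closedBall (0 : V × ℝ) η, G (p + v) = ∫⁻ x, {q : (V × ℝ) × (V × ℝ) | dist q.1 q.2 ≤ η}.indicator (fun q => G q.2) (p, x) := fun p => by
    rw [← lintegral_indicator measurableSet_closedBall, ← lintegral_add_left_eq_self (fun x => {q : (V × ℝ) × (V × ℝ) | dist q.1 q.2 ≤ η}.indicator (fun q => G q.2) (p, x)) p]
    refine lintegral_congr fun v => ?_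
    simp [indicator, dist_eq_norm, norm_neg]
  have e2 : ∀ x, G x * ν (closedBall x η) = ∫⁻ p, {q : (V × ℝ) × (V × ℝ) | dist q.1 q.2 ≤ η}.indicator (fun q => G q.2) (p, x) ∂ν := fun x => by
    rw [← setLIntegral_const, ← lintegral_indicator measurableSet_closedBall]
    rfl
  simp_rw [e1, e2]
  rw [lintegral_lintegral_swap]
  exact ((hG.comp measurable_snd).indicator mS).aemeasurable

lemma smooth : ∃ C : ℝ, 0 < C ∧ ∀ (ν : Measure (V × ℝ)) [SFinite ν] (f1 f2 : V → ℂ), Measurable f1 → Measurable f2 → Integrable f1 → Integrable f2 →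
    (∀ ξ, f1 ξ ≠ 0 → ‖ξ‖ ≤ 1) → (∀ ξ, f2 ξ ≠ 0 → ‖ξ‖ ≤ 1) → ∀ Y : ℝ≥0∞,
    (∀ g1 g2 : V → ℂ, Measurable g1 → Measurable g2 → Integrable g1 → Integrable g2 → (∀ ξ, ‖g1 ξ‖ ≤ 2 * ‖f1 ξ‖) → (∀ ξ, ‖g2 ξ‖ ≤ 2 * ‖f2 ξ‖) →
      ∫⁻ x, ‖EE M g1 x‖ₑ * ‖EE M g2 x‖ₑ * ν (closedBall x 1) ≤ Y) →
    ∫⁻ p, ‖EE M f1 p‖ₑ * ‖EE M f2 p‖ₑ ∂ν ≤ ofReal C * Y := by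
  obtain ⟨b2, hb2, eb2⟩ := ex_ofReal (measure_closedBall_lt_top (μ := (volume : Measure (V × ℝ))) (x := 0) (r := 1 / 16)).ne
  have hv := vb_pos (V := V)
  refine ⟨(vb V ^ 2)⁻¹ * b2 + 1, by positivity, fun ν _ f1 f2 m1 m2 i1 i2 s1 s2 Y hY => ?_⟩
  have n1 := measurable_pf M m1
  have n2 := measurable_pf M m2
  have j1 : Integrable (pf M f1) := (i1.norm.const_mul 2).mono' n1.aestronglyMeasurable (Filter.Eventually.of_forall (norm_pf M s1))
  have j2 : Integrable (pf M f2) := (i2.norm.const_mul 2).mono' n2.aestronglyMeasurable (Filter.Eventually.of_forall (norm_pf M s2))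
  have mE1 := measurable_EE M n1
  have mE2 := measurable_EE M n2
  set G : V × ℝ → V × ℝ → ℝ≥0∞ := fun u x => ‖EE M (pf M f1) x‖ₑ * ‖EE M (pf M f2) (x + u)‖ₑ with hG
  have mG : ∀ u, Measurable (G u) := fun u => by
    have : Measurable fun x => EE M (pf M f2) (x + u) := mE2.comp (by fun_prop)
    fun_prop
  have mG2 : Measurable fun q : (V × ℝ) × (V × ℝ) => G q.1 q.2 := by
    have : Measurable fun q : (V × ℝ) × (V × ℝ) => EE M (pf M f2) (q.2 + q.1) := mE2.comp (by fun_prop)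
    have : Measurable fun q : (V × ℝ) × (V × ℝ) => EE M (pf M f1) q.2 := mE1.comp (by fun_prop)
    fun_prop
  have pw : ∀ p, ofReal (vb V ^ 2) * (‖EE M f1 p‖ₑ * ‖EE M f2 p‖ₑ) ≤ ∫⁻ u in closedBall (0 : V × ℝ) (1 / 16), ∫⁻ v in closedBall (0 : V × ℝ) (1 / 32), G u (p + v) := fun p => by
    have mp : Measurable fun v => ‖EE M (pf M f1) (p + v)‖ₑ := (mE1.comp (by fun_prop : Measurable fun v => p + v)).enorm
    have mq : Measurable fun v => ‖EE M (pf M f2) (p + v)‖ₑ := (mE2.comp (by fun_prop : Measurable fun v => p + v)).enorm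
    calc _ = (ofReal (vb V) * ‖EE M f1 p‖ₑ) * (ofReal (vb V) * ‖EE M f2 p‖ₑ) := by rw [sq, ofReal_mul hv.le]; ring
      _ ≤ (∫⁻ v in closedBall (0 : V × ℝ) (1 / 32), ‖EE M (pf M f1) (p + v)‖ₑ) * ∫⁻ v in closedBall (0 : V × ℝ) (1 / 32), ‖EE M (pf M f2) (p + v)‖ₑ := by
          gcongr
          · exact enorm_EE_pf M m1 i1 s1 p
          · exact enorm_EE_pf M m2 i2 s2 p
      _ ≤ ∫⁻ v in closedBall (0 : V × ℝ) (1 / 32), ∫⁻ u in closedBall (0 : V × ℝ) (1 / 16), G u (p + v) := by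
          rw [← lintegral_mul_const _ mp]
          refine setLIntegral_mono' measurableSet_closedBall fun v hv => ?_
          have mq' : Measurable fun u => ‖EE M (pf M f2) (p + v + u)‖ₑ := (mE2.comp (by fun_prop : Measurable fun u => p + v + u)).enorm
          simp only [hG]
          rw [lintegral_const_mul _ mq']
          gcongr ‖EE M (pf M f1) (p + v)‖ₑ * ?_
          rw [← lintegral_indicator measurableSet_closedBall, ← lintegral_indicator measurableSet_closedBall, ← lintegral_add_left_eq_self ((closedBall (0 : V × ℝ) (1 / 32)).indicator fun v => ‖EE M (pf M f2) (p + v)‖ₑ) v]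
          refine lintegral_mono fun u => ?_
          by_cases hu : v + u ∈ closedBall (0 : V × ℝ) (1 / 32)
          · rw [indicator_of_mem hu, indicator_of_mem, add_assoc]
            rw [mem_closedBall_zero_iff] at hu hv ⊢
            have := norm_sub_le (v + u) v
            rw [add_sub_cancel_left] at this
            linarith
          · rw [indicator_of_notMem hu]; exact zero_le
      _ = _ := by
          refine lintegral_lintegral_swap ?_
          have m : Measurable fun q : (V × ℝ) × (V × ℝ) => (q.2, p + q.1) := measurable_snd.prodMk (measurable_const.add measurable_fst)
          exact (mG2.comp m).aemeasurable
  have per : ∀ u, ∫⁻ p, (∫⁻ v in closedBall (0 : V × ℝ) (1 / 32), G u (p + v)) ∂ν ≤ Y := fun u => by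
    rw [ball_swap (mG u)]
    have mm : Measurable fun ξ => ee (ph M u ξ) := measurable_ee.comp ((continuous_ph M).comp (by fun_prop : Continuous fun ξ : V => (u, ξ))).measurable
    refine le_trans ?_ (hY (pf M f1) (fun ξ => pf M f2 ξ * ee (ph M u ξ)) n1 (n2.mul mm) j1 ?_ (norm_pf M s1) ?_)
    · refine lintegral_mono fun x => ?_
      simp only [hG]
      have : EE M (pf M f2) (x + u) = EE M (fun ξ => pf M f2 ξ * ee (ph M u ξ)) x := by
        unfold EE; congr 1; ext ξ; rw [ph_add, ee_add]; ring
      rw [this]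
      gcongr
      norm_num
    · exact j2.mul_bdd (c := 1) mm.aestronglyMeasurable (Filter.Eventually.of_forall fun q => (norm_ee _).le)
    · intro ξ; rw [norm_mul, norm_ee, mul_one]; exact norm_pf M s2 ξ
  have mF1 := measurable_EE M m1
  have mF2 := measurable_EE M m2
  have fin : ofReal (vb V ^ 2) * ∫⁻ p, ‖EE M f1 p‖ₑ * ‖EE M f2 p‖ₑ ∂ν ≤ ofReal b2 * Y := by
    rw [← lintegral_const_mul _ (by fun_prop)]
    refine (lintegral_mono pw).trans ?_
    rw [lintegral_lintegral_swap]
    · refine (lintegral_mono per).trans_eq ?_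
      rw [setLIntegral_const, eb2, mul_comm]
    · have m : Measurable fun q : ((V × ℝ) × (V × ℝ)) × (V × ℝ) => (q.1.2, q.1.1 + q.2) := (measurable_snd.comp measurable_fst).prodMk ((measurable_fst.comp measurable_fst).add measurable_snd)
      exact (mG2.comp m).lintegral_prod_right'.aemeasurable
  calc _ = ofReal (vb V ^ 2)⁻¹ * (ofReal (vb V ^ 2) * ∫⁻ p, ‖EE M f1 p‖ₑ * ‖EE M f2 p‖ₑ ∂ν) := by
        rw [← mul_assoc, ← ofReal_mul (by positivity), inv_mul_cancel₀ (by positivity), ofReal_one, one_mul]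
    _ ≤ ofReal (vb V ^ 2)⁻¹ * (ofReal b2 * Y) := by gcongr
    _ = ofReal ((vb V ^ 2)⁻¹ * b2) * Y := by rw [← mul_assoc, ← ofReal_mul (by positivity)]
    _ ≤ _ := by gcongr; linarith

def Adm (α R t0 : ℝ) (ν : Measure (V × ℝ)) : Prop :=
  (∀ p, ∀ r : ℝ, 1 ≤ r → ν (closedBall p r) ≤ ofReal (r ^ α)) ∧ ν {p | p.2 ∉ Icc t0 (t0 + R)} = 0

def Lin (α γ D R : ℝ) : Prop := ∀ (t0 : ℝ) (ν : Measure (V × ℝ)), IsFiniteMeasure ν → Adm α R t0 ν →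
  ∀ f : V → ℂ, Measurable f → Integrable f → (∀ ξ, f ξ ≠ 0 → ‖ξ‖ ≤ 1) →
  ∫⁻ p, ‖EE M f p‖ₑ ^ 2 ∂ν ≤ ofReal (D * R ^ γ) * nn f

lemma wlem {α : ℝ} (hα : 0 ≤ α) : ∃ c : ℝ, 0 < c ∧ ∀ (R t0 : ℝ) (ν : Measure (V × ℝ)), IsFiniteMeasure ν → Adm α R t0 ν →
    ∃ W : V × ℝ → ℝ≥0∞, Wt α 1 W ∧ ∀ F : V × ℝ → ℝ≥0∞, Measurable F →
      ∫⁻ x, F x * ν (closedBall x 1) ≤ ofReal c * ∫⁻ x, F x * W x ∂(pm (Ico (t0 - 1) (t0 - 1 + (R + 3)))) := by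
  obtain ⟨v, hv, ev⟩ := ex_ofReal (measure_closedBall_lt_top (μ := (volume : Measure (V × ℝ))) (x := 0) (r := 1)).ne
  refine ⟨v * 2 ^ α + 1, by positivity, fun R t0 ν _ hA => ?_⟩
  set c := v * 2 ^ α + 1 with hc
  have hc0 : 0 < c := by positivity
  have hc1 : 1 ≤ c := by rw [hc]; linarith [show 0 ≤ v * 2 ^ α by positivity]
  have mN := measurable_Nw (ν := ν) 1
  have cc : ofReal c * ofReal c⁻¹ = 1 := by
    rw [← ofReal_mul hc0.le, mul_inv_cancel₀ hc0.ne', ofReal_one]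
  refine ⟨fun x => ofReal c⁻¹ * ν (closedBall x 1), ⟨mN.const_mul _, fun p => ?_, fun y t s hs => ?_⟩, fun F mF => ?_⟩
  · have := hA.1 p 1 le_rfl
    rw [Real.one_rpow, ofReal_one] at this
    exact mul_le_one' (ENNReal.ofReal_le_one.2 (inv_le_one_of_one_le₀ hc1)) this
  · have e : closedBall y (s / 1) ×ˢ Icc (t - s / 1 ^ 2) (t + s / 1 ^ 2) = closedBall (y, t) s := by
      rw [← closedBall_prod_same, Real.closedBall_eq_Icc]; simp
    have key : ∫⁻ x in closedBall (y, t) s, ν (closedBall x 1) ≤ ofReal v * ofReal ((s + 1) ^ α) := by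
      have hb := ball_swap (ν := ν) (η := 1) (G := (closedBall (y, t) s).indicator 1) (measurable_one.indicator measurableSet_closedBall)
      have : ∫⁻ x in closedBall (y, t) s, ν (closedBall x 1) = ∫⁻ x, (closedBall (y, t) s).indicator 1 x * ν (closedBall x 1) := by
        rw [← lintegral_indicator measurableSet_closedBall]
        refine lintegral_congr fun x => ?_
        by_cases h : x ∈ closedBall (y, t) s <;> simp [h, indicator]
      rw [this, ← hb]
      calc _ ≤ ∫⁻ p, (closedBall (y, t) (s + 1)).indicator (fun _ => ofReal v) p ∂ν := by
            refine lintegral_mono fun p => ?_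
            by_cases h : p ∈ closedBall (y, t) (s + 1)
            · rw [indicator_of_mem h, ← ev]
              refine (setLIntegral_mono (g := fun _ => 1) measurable_const fun v _ => ?_).trans_eq (setLIntegral_one _)
              by_cases hh : p + v ∈ closedBall (y, t) s <;> simp [indicator, hh]
            · rw [indicator_of_notMem h]
              refine (setLIntegral_congr_fun measurableSet_closedBall (g := fun _ => 0) fun v hv => indicator_of_notMem (fun hm => h ?_) _).trans_le (by simp)
              rw [mem_closedBall] at hm ⊢
              rw [mem_closedBall_zero_iff] at hv
              have := dist_triangle p (p + v) (y, t)
              rw [dist_self_add_right] at this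
              linarith
        _ = ofReal v * ν (closedBall (y, t) (s + 1)) := by
            rw [lintegral_indicator measurableSet_closedBall, setLIntegral_const]
        _ ≤ _ := by gcongr; exact hA.1 _ _ (by linarith)
    rw [e, lintegral_const_mul _ mN]
    refine (mul_le_mul_right key _).trans ?_
    rw [← ofReal_mul hv, ← ofReal_mul (by positivity)]
    refine ofReal_le_ofReal ?_
    rw [one_pow, inv_one, one_mul, inv_mul_le_iff₀ hc0]
    have : (s + 1) ^ α ≤ 2 ^ α * s ^ α := by
      rw [← Real.mul_rpow (by norm_num) (by linarith)]
      exact Real.rpow_le_rpow (by linarith) (by linarith) hα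
    calc v * (s + 1) ^ α ≤ v * (2 ^ α * s ^ α) := by gcongr
      _ ≤ c * s ^ α := by rw [hc, ← mul_assoc]; gcongr; linarith
  · rw [pm, ← lintegral_indicator (MeasurableSet.univ.prod measurableSet_Ico), ← lintegral_const_mul' _ _ ofReal_ne_top]
    refine lintegral_mono fun x => ?_
    by_cases h : x ∈ (univ : Set V) ×ˢ Ico (t0 - 1) (t0 - 1 + (R + 3))
    · rw [indicator_of_mem h]
      refine le_of_eq ?_
      calc _ = (ofReal c * ofReal c⁻¹) * (F x * ν (closedBall x 1)) := by rw [cc, one_mul]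
        _ = _ := by ring
    · have : ν (closedBall x 1) = 0 := by
        refine measure_mono_null (fun p hp => ?_) hA.2
        intro h2
        apply h
        have h3 : |p.2 - x.2| ≤ 1 := (le_max_right _ _).trans (mem_closedBall.1 hp)
        rw [abs_le] at h3
        exact ⟨mem_univ _, by linarith [h2.1], by linarith [h2.2]⟩
      rw [this, mul_zero]; exact zero_le

lemma nn_two {f g : V → ℂ} (h : ∀ ξ, ‖g ξ‖ ≤ 2 * ‖f ξ‖) : nn g ≤ 4 * nn f := by
  unfold nn
  rw [← lintegral_const_mul' _ _ (by norm_num)]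
  refine lintegral_mono fun ξ => ?_
  have : ‖g ξ‖ₑ ≤ 2 * ‖f ξ‖ₑ := by
    rw [← ofReal_norm, ← ofReal_norm, show (2 : ℝ≥0∞) = ofReal 2 by simp, ← ofReal_mul (by norm_num)]
    exact ofReal_le_ofReal (h ξ)
  calc _ ≤ (2 * ‖f ξ‖ₑ) ^ 2 := by gcongr
    _ = _ := by rw [mul_pow]; norm_num

lemma to_nu {α : ℝ} (hα : 0 ≤ α) : ∃ C : ℝ, 0 < C ∧ ∀ (R t0 : ℝ) (ν : Measure (V × ℝ)), IsFiniteMeasure ν → Adm α R t0 ν →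
    ∀ f1 f2 : V → ℂ, Measurable f1 → Measurable f2 → Integrable f1 → Integrable f2 →
    (∀ ξ, f1 ξ ≠ 0 → ‖ξ‖ ≤ 1) → (∀ ξ, f2 ξ ≠ 0 → ‖ξ‖ ≤ 1) → ∀ B : ℝ, 0 ≤ B →
    (∀ W, Wt α 1 W → ∀ g1 g2 : V → ℂ, Measurable g1 → Measurable g2 → Integrable g1 → Integrable g2 → (∀ ξ, g1 ξ ≠ 0 → f1 ξ ≠ 0) → (∀ ξ, g2 ξ ≠ 0 → f2 ξ ≠ 0) →
      ∫⁻ x, ‖EE M g1 x‖ₑ * ‖EE M g2 x‖ₑ * W x ∂(pm (Ico (t0 - 1) (t0 - 1 + (R + 3)))) ≤ ofReal B * (nn g1 + nn g2)) →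
    ∫⁻ p, ‖EE M f1 p‖ₑ * ‖EE M f2 p‖ₑ ∂ν ≤ ofReal (C * B) * (nn f1 + nn f2) := by
  obtain ⟨c, hc, h1⟩ := wlem (V := V) hα
  obtain ⟨C, hC, h2⟩ := smooth M
  refine ⟨C * (c * 4), by positivity, fun R t0 ν _ hA f1 f2 m1 m2 i1 i2 s1 s2 B hB hW => ?_⟩
  obtain ⟨W, wW, hF⟩ := h1 R t0 ν inferInstance hA
  refine (h2 ν f1 f2 m1 m2 i1 i2 s1 s2 (ofReal (c * B * 4) * (nn f1 + nn f2)) fun g1 g2 n1 n2 j1 j2 b1 b2 => ?_).trans_eq ?_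
  · have e1 := measurable_EE M n1
    have e2 := measurable_EE M n2
    refine (hF _ (by fun_prop)).trans ?_
    have hz : ∀ {f g : V → ℂ}, (∀ ξ, ‖g ξ‖ ≤ 2 * ‖f ξ‖) → ∀ ξ, g ξ ≠ 0 → f ξ ≠ 0 := fun h ξ hg hf => hg (by simpa [hf] using h ξ)
    calc _ ≤ ofReal c * (ofReal B * (4 * nn f1 + 4 * nn f2)) := by
          gcongr
          refine (hW W wW g1 g2 n1 n2 j1 j2 (hz b1) (hz b2)).trans ?_
          gcongr
          · exact nn_two b1
          · exact nn_two b2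
      _ = _ := by rw [ofReal_mul (by positivity), ofReal_mul hc.le, show ofReal 4 = 4 by simp]; ring
  · rw [← mul_assoc, ← ofReal_mul hC.le]; congr 2; ring

lemma broad (hM : ∀ a b, ⟪M a, b⟫ = ⟪a, M b⟫) {α γ l : ℝ} (hα : 0 ≤ α) (h0 : 0 < γ) (h : (α - (Module.finrank ℝ V : ℝ) / 2 + 1 / 2) / 2 < γ) (hl : 0 < l) :
    ∃ C : ℝ, 0 < C ∧ ∀ (R t0 : ℝ) (ν : Measure (V × ℝ)), 1 ≤ R → IsFiniteMeasure ν → Adm α R t0 ν →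
    ∀ f1 f2 : V → ℂ, Measurable f1 → Measurable f2 → Integrable f1 → Integrable f2 →
    (∀ ξ, f1 ξ ≠ 0 → ‖ξ‖ ≤ 1) → (∀ ξ, f2 ξ ≠ 0 → ‖ξ‖ ≤ 1) → Sep M 1 l {ξ | f1 ξ ≠ 0} {ξ | f2 ξ ≠ 0} → Sep M 1 l {ξ | f2 ξ ≠ 0} {ξ | f1 ξ ≠ 0} →
    ∫⁻ p, ‖EE M f1 p‖ₑ * ‖EE M f2 p‖ₑ ∂ν ≤ ofReal (C * R ^ γ) * (nn f1 + nn f2) := by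
  obtain ⟨C1, hC1, H1⟩ := to_nu M hα
  obtain ⟨C2, hC2, H2⟩ := bil_all M hM h0 h 1 l one_pos hl
  refine ⟨C1 * (C2 * 4 ^ γ), by positivity, fun R t0 ν hR _ hA f1 f2 m1 m2 i1 i2 s1 s2 p1 p2 => ?_⟩
  refine (H1 R t0 ν inferInstance hA f1 f2 m1 m2 i1 i2 s1 s2 (C2 * (R + 3) ^ γ) (by positivity) fun W hW g1 g2 n1 n2 j1 j2 z1 z2 => ?_).trans ?_
  · have := H2 1 (R + 3) (t0 - 1) le_rfl (by linarith) (by linarith) {ξ | f1 ξ ≠ 0} {ξ | f2 ξ ≠ 0} (by simpa using s1) (by simpa using s2) p1 p2 W hW g1 g2 n1 n2 j1 j2 z1 z2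
    simpa using this
  · refine mul_le_mul_left (ofReal_le_ofReal ?_) _
    rw [mul_assoc, mul_assoc]
    gcongr
    rw [← Real.mul_rpow (by norm_num) (by linarith)]
    gcongr; linarith

lemma base {α : ℝ} (hα : 0 ≤ α) : ∃ C : ℝ, 0 < C ∧ ∀ R γ D : ℝ, 1 ≤ R → 0 ≤ γ → C * R ≤ D → Lin M α γ D R := by
  obtain ⟨C1, hC1, H1⟩ := to_nu M hα
  refine ⟨C1 * 8, by positivity, fun R γ D hR hγ hD t0 ν _ hA f hf hi hs => ?_⟩
  simp_rw [sq ‖EE M f _‖ₑ]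
  refine (H1 R t0 ν inferInstance hA f f hf hf hi hi hs hs (R + 3) (by linarith) fun W hW g1 g2 n1 n2 j1 j2 _ _ => triv M (by linarith) hW.2.1 n1 n2 j1 j2).trans ?_
  calc _ = ofReal (C1 * (R + 3) * 2) * nn f := by
        rw [ofReal_mul (q := 2) (by positivity), show ofReal 2 = 2 by simp]; ring
    _ ≤ _ := by
        refine mul_le_mul_left (ofReal_le_ofReal ?_) _
        have : (1 : ℝ) ≤ R ^ γ := Real.one_le_rpow hR hγ
        nlinarith [mul_pos hC1 (by linarith : 0 < R)]

lemma adm_map {α R t0 ρ : ℝ} (hα : 0 ≤ α) (hρ : 0 < ρ) (hρ1 : ρ ≤ 1) {ξ0 : V} (hξ : ‖ξ0‖ ≤ 1) {ν : Measure (V × ℝ)} (hA : Adm α R t0 ν) :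
    Adm α (ρ ^ 2 * R) 0 (ofReal ((3 / ρ) ^ (1 + α))⁻¹ • ν.map fun p : V × ℝ => (ρ • (p.1 + (2 * (p.2 - t0)) • M ξ0), ρ ^ 2 * (p.2 - t0))) := by
  have mΦ : Measurable fun p : V × ℝ => (ρ • (p.1 + (2 * (p.2 - t0)) • M ξ0), ρ ^ 2 * (p.2 - t0)) := by fun_prop
  have hρ2 : 0 < ρ ^ 2 := by positivity
  constructor
  · rintro ⟨y', t'⟩ r hr
    rw [Measure.smul_apply, Measure.map_apply mΦ measurableSet_closedBall, smul_eq_mul]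
    have hr0 : 0 < r := by linarith
    have hq : 0 < r / ρ := by positivity
    set T : ℕ → ℝ := fun j => t' / ρ ^ 2 - r / ρ ^ 2 + j * (r / ρ) with hT
    set N := ⌊2 / ρ⌋₊ + 1 with hN
    have hNle : (N : ℝ) ≤ 3 / ρ := by
      have h1 := Nat.floor_le (by positivity : 0 ≤ 2 / ρ)
      have h2 : 1 ≤ 1 / ρ := by rw [le_div_iff₀ hρ]; linarith
      rw [hN]; push_cast
      have : 3 / ρ = 2 / ρ + 1 / ρ := by rw [← add_div]; norm_num
      linarith
    have cov : (fun p : V × ℝ => (ρ • (p.1 + (2 * (p.2 - t0)) • M ξ0), ρ ^ 2 * (p.2 - t0))) ⁻¹' closedBall (y', t') r ⊆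
        ⋃ j ∈ Finset.range N, closedBall (ρ⁻¹ • y' - (2 * T j) • M ξ0, t0 + T j) (3 * r / ρ) := by
      rintro ⟨y, t⟩ hp
      rw [mem_preimage, ← closedBall_prod_same, mem_prod, mem_closedBall_iff_norm, Real.closedBall_eq_Icc] at hp
      obtain ⟨h1, h2, h3⟩ := hp
      dsimp only at h1 h2 h3
      set σ := t - t0 - t' / ρ ^ 2 + r / ρ ^ 2 with hσ
      have hσ0 : 0 ≤ σ := by
        have : ρ ^ 2 * σ = ρ ^ 2 * (t - t0) - t' + r := by rw [hσ]; field_simp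
        exact nonneg_of_mul_nonneg_right (by linarith) hρ2
      have hσ1 : σ / (r / ρ) ≤ 2 / ρ := by
        have : ρ ^ 2 * σ = ρ ^ 2 * (t - t0) - t' + r := by rw [hσ]; field_simp
        rw [div_le_iff₀ hq, show 2 / ρ * (r / ρ) = 2 * r / ρ ^ 2 by field_simp, le_div_iff₀ hρ2]; linarith
      have f1 := Nat.floor_le (by positivity : 0 ≤ σ / (r / ρ))
      have f2 := Nat.lt_floor_add_one (σ / (r / ρ))
      rw [le_div_iff₀ hq] at f1
      rw [div_lt_iff₀ hq] at f2
      simp only [mem_iUnion, Finset.mem_range]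
      refine ⟨⌊σ / (r / ρ)⌋₊, Nat.lt_succ_of_le (Nat.floor_mono hσ1), ?_⟩
      set j := ⌊σ / (r / ρ)⌋₊
      have e : t - t0 - T j = σ - j * (r / ρ) := by simp only [hT, hσ]; ring
      have h4 : |t - t0 - T j| ≤ r / ρ := by rw [e, abs_le]; constructor <;> linarith
      rw [← closedBall_prod_same, mem_prod, mem_closedBall_iff_norm, mem_closedBall_iff_norm]
      dsimp only
      constructor
      · have e2 : y - (ρ⁻¹ • y' - (2 * T j) • M ξ0) = ρ⁻¹ • (ρ • (y + (2 * (t - t0)) • M ξ0) - y') - (2 * (t - t0 - T j)) • M ξ0 := by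
          rw [smul_sub, smul_smul, inv_mul_cancel₀ hρ.ne', one_smul]; module
        rw [e2]
        refine (norm_sub_le _ _).trans ?_
        rw [norm_smul, norm_smul, M.norm_map, norm_inv, Real.norm_of_nonneg hρ.le, norm_mul, Real.norm_eq_abs, Real.norm_eq_abs, abs_of_pos (by norm_num : (0:ℝ) < 2)]
        have a1 : ρ⁻¹ * ‖ρ • (y + (2 * (t - t0)) • M ξ0) - y'‖ ≤ ρ⁻¹ * r := by gcongr
        have a2 : 2 * |t - t0 - T j| * ‖ξ0‖ ≤ 2 * (r / ρ) * 1 := by gcongr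
        calc _ ≤ ρ⁻¹ * r + 2 * (r / ρ) * 1 := add_le_add a1 a2
          _ = _ := by field_simp; norm_num
      · rw [← sub_sub, Real.norm_eq_abs]
        refine h4.trans ?_
        gcongr; linarith
    calc _ ≤ ofReal ((3 / ρ) ^ (1 + α))⁻¹ * ∑ j ∈ Finset.range N, ν (closedBall (ρ⁻¹ • y' - (2 * T j) • M ξ0, t0 + T j) (3 * r / ρ)) := by
          gcongr
          exact (measure_mono cov).trans (measure_biUnion_finset_le _ _)
      _ ≤ ofReal ((3 / ρ) ^ (1 + α))⁻¹ * ∑ j ∈ Finset.range N, ofReal ((3 * r / ρ) ^ α) := by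
          gcongr with j
          refine hA.1 _ _ ?_
          rw [le_div_iff₀ hρ]; linarith
      _ = ofReal ((3 / ρ) ^ (1 + α))⁻¹ * ofReal (N * (3 * r / ρ) ^ α) := by
          rw [Finset.sum_const, Finset.card_range, nsmul_eq_mul, ofReal_mul (by positivity), ENNReal.ofReal_natCast]
      _ ≤ _ := by
          rw [← ofReal_mul (by positivity)]
          refine ofReal_le_ofReal ?_
          rw [inv_mul_le_iff₀ (by positivity), Real.rpow_add (by positivity), Real.rpow_one, mul_assoc, ← Real.mul_rpow (by positivity) hr0.le, show 3 / ρ * r = 3 * r / ρ by ring]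
          gcongr
  · rw [Measure.smul_apply, smul_eq_mul]
    refine mul_eq_zero_of_right _ ?_
    have mS : MeasurableSet {p : V × ℝ | p.2 ∉ Icc 0 (0 + ρ ^ 2 * R)} := (measurable_snd measurableSet_Icc).compl
    rw [Measure.map_apply mΦ mS]
    refine measure_mono_null (t := {p | p.2 ∉ Icc t0 (t0 + R)}) (fun p hp => ?_) hA.2
    intro hp2
    apply hp
    dsimp only
    refine ⟨mul_nonneg hρ2.le (by linarith [hp2.1]), ?_⟩
    rw [zero_add]
    gcongr; linarith [hp2.2]

lemma rescale (hM : ∀ a b, ⟪M a, b⟫ = ⟪a, M b⟫) {α γ D R t0 ρ : ℝ} (hD : 0 ≤ D) (hR : 0 ≤ R) (hα : 0 ≤ α) (hρ : 0 < ρ) (hρ1 : ρ ≤ 1) (hL : Lin M α γ D (ρ ^ 2 * R))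
    {ξ0 : V} (hξ : ‖ξ0‖ ≤ 1) {ν : Measure (V × ℝ)} [IsFiniteMeasure ν] (hA : Adm α R t0 ν) {f : V → ℂ} (hf : Measurable f) (hi : Integrable f) (hs : ∀ ξ, f ξ ≠ 0 → ‖ξ - ξ0‖ ≤ ρ) :
    ∫⁻ p, ‖EE M f p‖ₑ ^ 2 ∂ν ≤ ofReal (ρ ^ Module.finrank ℝ V * (3 / ρ) ^ (1 + α) * (ρ ^ 2) ^ γ * (D * R ^ γ)) * nn f := by
  set n := Module.finrank ℝ V
  set Φ : V × ℝ → V × ℝ := fun p => (ρ • (p.1 + (2 * (p.2 - t0)) • M ξ0), ρ ^ 2 * (p.2 - t0)) with hΦ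
  have mΦ : Measurable Φ := by rw [hΦ]; fun_prop
  have ms := measurable_sc M ρ ξ0 t0 hf
  have mE := measurable_EE M ms
  have c0 : 0 < (3 / ρ) ^ (1 + α) := by positivity
  have h1 := hL 0 _ (Measure.smul_finite _ ofReal_ne_top) (adm_map M hα hρ hρ1 hξ hA) (sc M ρ ξ0 t0 f) ms (integrable_sc M hρ ξ0 t0 hf hi) fun η hη => by
    have := hs (ξ0 + ρ • η) (fun h => hη (by simp [sc, h]))
    rw [add_sub_cancel_left, norm_smul, Real.norm_of_nonneg hρ.le] at this
    exact le_of_mul_le_mul_left (by linarith) hρ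
  rw [lintegral_smul_measure, lintegral_map (by fun_prop) mΦ, nn_sc M hρ ξ0 t0 hf, smul_eq_mul] at h1
  have e : ∀ p : V × ℝ, ‖EE M f p‖ₑ ^ 2 = ofReal ((ρ ^ n) ^ 2) * ‖EE M (sc M ρ ξ0 t0 f) (Φ p)‖ₑ ^ 2 := fun p => by
    have := EE_sc M hM hρ ξ0 t0 f p.1 (p.2 - t0)
    rw [add_sub_cancel] at this
    change ‖EE M f (p.1, p.2)‖ₑ ^ 2 = _
    rw [this, mul_pow, ofReal_pow (p := ρ ^ n) (by positivity)]
  simp_rw [e]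
  rw [lintegral_const_mul' _ _ ofReal_ne_top]
  calc _ = ofReal ((ρ ^ n) ^ 2) * (ofReal ((3 / ρ) ^ (1 + α)) * (ofReal ((3 / ρ) ^ (1 + α))⁻¹ * ∫⁻ p, ‖EE M (sc M ρ ξ0 t0 f) (Φ p)‖ₑ ^ 2 ∂ν)) := by
        rw [← mul_assoc (ofReal ((3 / ρ) ^ (1 + α))), ← ofReal_mul c0.le, mul_inv_cancel₀ c0.ne', ofReal_one, one_mul]
    _ ≤ ofReal ((ρ ^ n) ^ 2) * (ofReal ((3 / ρ) ^ (1 + α)) * (ofReal (D * (ρ ^ 2 * R) ^ γ) * (ofReal (ρ ^ n)⁻¹ * nn f))) := by gcongr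
    _ = _ := by
        simp only [← mul_assoc]
        rw [← ofReal_mul (by positivity), ← ofReal_mul (by positivity), ← ofReal_mul (by positivity)]
        congr 2
        rw [Real.mul_rpow (by positivity) hR]
        field_simp

open Classical in
lemma bn {I T : Type*} (s : Finset I) (π : I → T) (far : I → I → Prop) (K : ℕ)
    (hK : ∀ S ⊆ s, (∀ i ∈ S, ∀ j ∈ S, ¬ far i j) → (S.image π).card ≤ K) (z : I → ℂ) :
    ‖∑ i ∈ s, z i‖ ^ 2 ≤ 4 * K * ∑ τ ∈ s.image π, ‖∑ i ∈ s with π i = τ, z i‖ ^ 2 +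
      4 * (s.card : ℝ) ^ 2 * ∑ q ∈ s ×ˢ s with far q.1 q.2, ‖z q.1‖ * ‖z q.2‖ := by
  set Z := ‖∑ i ∈ s, z i‖ with hZ
  have p1 : 0 ≤ ∑ τ ∈ s.image π, ‖∑ i ∈ s with π i = τ, z i‖ ^ 2 := Finset.sum_nonneg fun _ _ => by positivity
  have p2 : 0 ≤ ∑ q ∈ s ×ˢ s with far q.1 q.2, ‖z q.1‖ * ‖z q.2‖ := Finset.sum_nonneg fun _ _ => by positivity
  rcases s.eq_empty_or_nonempty with rfl | hs
  · simp [hZ]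
  have c0 : (0 : ℝ) < s.card := by exact_mod_cast hs.card_pos
  set S := s.filter fun i => Z ≤ 2 * s.card * ‖z i‖ with hS
  have hZ0 : 0 ≤ Z := norm_nonneg _
  by_cases hfar : ∀ i ∈ S, ∀ j ∈ S, ¬ far i j
  · have hk := hK S (Finset.filter_subset _ _) hfar
    have hsub : S.image π ⊆ s.image π := Finset.image_subset_image (Finset.filter_subset _ _)
    have e1 : ∑ i ∈ s with π i ∈ S.image π, z i = ∑ τ ∈ S.image π, ∑ i ∈ s with π i = τ, z i := by
      rw [← Finset.sum_fiberwise_of_maps_to (s := s.filter fun i => π i ∈ S.image π) (t := S.image π) (g := π) (fun i hi => (Finset.mem_filter.1 hi).2)]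
      refine Finset.sum_congr rfl fun τ hτ => Finset.sum_congr ?_ fun _ _ => rfl
      ext i; simp only [Finset.mem_filter]
      constructor
      · rintro ⟨⟨a, _⟩, b⟩; exact ⟨a, b⟩
      · rintro ⟨a, b⟩; exact ⟨⟨a, b ▸ hτ⟩, b⟩
    have h1 : Z ≤ ∑ τ ∈ S.image π, ‖∑ i ∈ s with π i = τ, z i‖ + Z / 2 := by
      rw [hZ, ← Finset.sum_filter_add_sum_filter_not s (fun i => π i ∈ S.image π), e1]
      refine (norm_add_le _ _).trans (add_le_add (norm_sum_le _ _) ?_)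
      rw [← e1, Finset.sum_filter_add_sum_filter_not s (fun i => π i ∈ S.image π), ← hZ]
      refine (norm_sum_le _ _).trans ?_
      calc _ ≤ ∑ i ∈ s with π i ∉ S.image π, Z / (2 * s.card) := by
            refine Finset.sum_le_sum fun i hi => ?_
            rw [Finset.mem_filter] at hi
            have : i ∉ S := fun h => hi.2 (Finset.mem_image_of_mem _ h)
            simp only [hS, Finset.mem_filter, not_and, not_le] at this
            rw [le_div_iff₀ (by positivity)]
            linarith [this hi.1]
        _ ≤ s.card * (Z / (2 * s.card)) := by
            rw [Finset.sum_const, nsmul_eq_mul]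
            gcongr; exact Finset.filter_subset _ _
        _ = Z / 2 := by field_simp
    have h2 : (∑ τ ∈ S.image π, ‖∑ i ∈ s with π i = τ, z i‖) ^ 2 ≤ K * ∑ τ ∈ s.image π, ‖∑ i ∈ s with π i = τ, z i‖ ^ 2 := by
      refine sq_sum_le_card_mul_sum_sq.trans ?_
      gcongr
    have h3 : (Z / 2) ^ 2 ≤ (∑ τ ∈ S.image π, ‖∑ i ∈ s with π i = τ, z i‖) ^ 2 := by
      gcongr; linarith
    have : 0 ≤ 4 * (s.card : ℝ) ^ 2 * ∑ q ∈ s ×ˢ s with far q.1 q.2, ‖z q.1‖ * ‖z q.2‖ := by positivity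
    linarith
  · push Not at hfar
    obtain ⟨i, hi, j, hj, hij⟩ := hfar
    rw [hS, Finset.mem_filter] at hi hj
    have h1 : ‖z i‖ * ‖z j‖ ≤ ∑ q ∈ s ×ˢ s with far q.1 q.2, ‖z q.1‖ * ‖z q.2‖ :=
      Finset.single_le_sum (f := fun q : I × I => ‖z q.1‖ * ‖z q.2‖) (fun _ _ => by positivity) (Finset.mem_filter.2 ⟨Finset.mk_mem_product hi.1 hj.1, hij⟩ : (i, j) ∈ _)
    have h2 : Z * Z ≤ (2 * s.card * ‖z i‖) * (2 * s.card * ‖z j‖) := mul_le_mul hi.2 hj.2 hZ0 (by positivity)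
    have h3 : 0 ≤ 4 * K * ∑ τ ∈ s.image π, ‖∑ i ∈ s with π i = τ, z i‖ ^ 2 := by positivity
    nlinarith [mul_le_mul_of_nonneg_left h1 (by positivity : 0 ≤ 4 * (s.card : ℝ) ^ 2)]

open Classical in
lemma count {ι : Type*} [Fintype ι] (s : ι → ℝ) (hs : ∀ k, s k = 1 ∨ s k = -1) {N : ℕ} (hN : 1 ≤ N) (S : Finset (ι → ℤ))
    (hS : ∀ i ∈ S, ∀ k, i k ∈ Icc (-(N : ℤ) ^ 2) (N ^ 2))
    (hp : ∀ i ∈ S, ∀ j ∈ S, ¬ 24 * Fintype.card ι * (N : ℝ) ^ 2 ≤ |∑ k, s k * ((i k : ℝ) - j k) ^ 2|) :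
    (S.image fun i k => i k / (N : ℤ)).card ≤ (10 * Fintype.card ι + 3) ^ Fintype.card ι * (3 * N) ^ Fintype.card {k // s k = -1} := by
  set n := Fintype.card ι with hn
  have hN' : (0 : ℤ) < N := by exact_mod_cast hN
  refine (Finset.card_le_mul_card_image (f := fun (τ : ι → ℤ) (k : {k // s k = -1}) => τ k) _ ((10 * n + 3) ^ n) ?_).trans (Nat.mul_le_mul_left _ ?_)
  · intro a ha
    obtain ⟨τ0, h0, rfl⟩ := Finset.mem_image.1 ha
    obtain ⟨i0, hi0, rfl⟩ := Finset.mem_image.1 h0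
    refine (Finset.card_le_card (t := Fintype.piFinset fun k => Finset.Icc (i0 k / (N : ℤ) - (5 * n + 1)) (i0 k / (N : ℤ) + (5 * n + 1))) ?_).trans_eq ?_
    · intro τ hτ
      rw [Finset.mem_filter] at hτ
      obtain ⟨hτ, heq⟩ := hτ
      obtain ⟨i, hi, rfl⟩ := Finset.mem_image.1 hτ
      have hneg : ∀ k, s k = -1 → i k / (N : ℤ) = i0 k / (N : ℤ) := fun k hk => congrFun heq ⟨k, hk⟩
      have dv : ∀ a : ℤ, N * (a / N) ≤ a ∧ a < N * (a / N) + N := fun a => ⟨Int.mul_ediv_self_le hN'.ne', Int.lt_mul_ediv_self_add hN'⟩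
      have hsq : ∀ k, s k = -1 → ((i k : ℝ) - i0 k) ^ 2 ≤ (N : ℝ) ^ 2 := fun k hk => by
        have h1 := dv (i k)
        have h2 := dv (i0 k)
        rw [hneg k hk] at h1
        have : ((i k) - i0 k) ^ 2 ≤ (N : ℤ) ^ 2 := sq_le_sq' (by linarith) (by linarith)
        exact_mod_cast this
      rw [Fintype.mem_piFinset]
      intro k0
      rw [Finset.mem_Icc]
      rcases hs k0 with hk | hk
      · have h1 := hp i hi i0 hi0
        rw [not_le, abs_lt] at h1
        have h2 : ((i k0 : ℝ) - i0 k0) ^ 2 - n * (N : ℝ) ^ 2 ≤ ∑ k, s k * ((i k : ℝ) - i0 k) ^ 2 := by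
          calc _ = ∑ k, ((if k = k0 then ((i k0 : ℝ) - i0 k0) ^ 2 else 0) - (N : ℝ) ^ 2) := by
                rw [Finset.sum_sub_distrib, Finset.sum_ite_eq', Finset.sum_const, Finset.card_univ, nsmul_eq_mul]; simp [hn]
            _ ≤ _ := by
                refine Finset.sum_le_sum fun k _ => ?_
                by_cases h : k = k0
                · subst h; rw [if_pos rfl, hk]; nlinarith [sq_nonneg (N : ℝ)]
                · rw [if_neg h]
                  rcases hs k with h' | h' <;> rw [h']
                  · nlinarith [sq_nonneg (N : ℝ), sq_nonneg ((i k : ℝ) - i0 k)]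
                  · linarith [hsq k h']
        have n1 : (1 : ℝ) ≤ n := by
          have : 0 < n := Fintype.card_pos_iff.2 ⟨k0⟩
          exact_mod_cast this
        have h3 : ((i k0 : ℝ) - i0 k0) ^ 2 ≤ (5 * n * N : ℝ) ^ 2 := by
          nlinarith [h1.2, mul_le_mul_of_nonneg_right n1 (by positivity : 0 ≤ (n : ℝ) * N ^ 2)]
        have h4 : (i k0 - i0 k0) ^ 2 ≤ (5 * n * N : ℤ) ^ 2 := by exact_mod_cast h3
        have h5 := abs_le_of_sq_le_sq' h4 (by positivity)
        have d1 := dv (i k0)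
        have d2 := dv (i0 k0)
        constructor
        · by_contra hc; push Not at hc
          nlinarith
        · by_contra hc; push Not at hc
          nlinarith
      · rw [hneg k0 hk]; constructor <;> linarith [(Nat.cast_nonneg n : (0 : ℤ) ≤ n)]
    · rw [Fintype.card_piFinset]
      have : ∀ k, (Finset.Icc (i0 k / (N : ℤ) - (5 * n + 1)) (i0 k / (N : ℤ) + (5 * n + 1))).card = 10 * n + 3 := fun k => by
        rw [Int.card_Icc]; omega
      simp_rw [this]
      rw [Finset.prod_const, Finset.card_univ]
  · refine (Finset.card_le_card (t := Fintype.piFinset fun _ => Finset.Icc (-(N : ℤ)) N) ?_).trans ?_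
    · intro a ha
      obtain ⟨τ0, h0, rfl⟩ := Finset.mem_image.1 ha
      obtain ⟨i, hi, rfl⟩ := Finset.mem_image.1 h0
      rw [Fintype.mem_piFinset]
      intro k
      obtain ⟨h1, h2⟩ := hS i hi k
      rw [Finset.mem_Icc]
      exact ⟨(Int.le_ediv_iff_mul_le hN').2 (by linarith), Int.ediv_le_of_le_mul hN' (by linarith)⟩
    · rw [Fintype.card_piFinset, Finset.prod_const, Finset.card_univ, Int.card_Icc]
      gcongr
      omega

open Classical in
def fc {T : Type*} (φ : V → T) (f : V → ℂ) (i : T) (ξ : V) : ℂ := if φ ξ = i then f ξ else 0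

lemma fc_ne {T : Type*} {φ : V → T} {f : V → ℂ} {i : T} {ξ : V} (h : fc φ f i ξ ≠ 0) : φ ξ = i ∧ f ξ ≠ 0 := by
  unfold fc at h; split_ifs at h with h1
  · exact ⟨h1, h⟩
  · exact absurd rfl h
lemma norm_fc_le {T : Type*} (φ : V → T) (f : V → ℂ) (i : T) (ξ : V) : ‖fc φ f i ξ‖ ≤ ‖f ξ‖ := by
  unfold fc; split_ifs <;> simp
lemma measurable_fc {T : Type*} {φ : V → T} (hφ : ∀ i, MeasurableSet {ξ | φ ξ = i}) {f : V → ℂ} (hf : Measurable f) (i : T) : Measurable (fc φ f i) := by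
  unfold fc; exact hf.ite (hφ i) measurable_const
lemma integrable_fc {T : Type*} {φ : V → T} (hφ : ∀ i, MeasurableSet {ξ | φ ξ = i}) {f : V → ℂ} (hf : Measurable f) (hi : Integrable f) (i : T) : Integrable (fc φ f i) :=
  hi.norm.mono' (measurable_fc hφ hf i).aestronglyMeasurable (Filter.Eventually.of_forall (norm_fc_le φ f i))
lemma nn_fc_le {T : Type*} (φ : V → T) (f : V → ℂ) (i : T) : nn (fc φ f i) ≤ nn f := by
  refine lintegral_mono fun ξ => ?_
  gcongr 1
  exact enorm_le_iff_norm_le.2 (norm_fc_le φ f i ξ)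
open Classical in
lemma sum_nn_fc {T : Type*} {φ : V → T} (hφ : ∀ i, MeasurableSet {ξ | φ ξ = i}) {f : V → ℂ} (hf : Measurable f) (s : Finset T) : ∑ i ∈ s, nn (fc φ f i) ≤ nn f := by
  unfold nn
  rw [← lintegral_finsetSum _ (fun i _ => (measurable_fc hφ hf i).enorm.pow_const 2)]
  refine lintegral_mono fun ξ => ?_
  have : ∀ i, ‖fc φ f i ξ‖ₑ ^ 2 = if φ ξ = i then ‖f ξ‖ₑ ^ 2 else 0 := fun i => by unfold fc; split_ifs <;> simp
  simp_rw [this]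
  rw [Finset.sum_ite_eq]; split_ifs
  · exact le_rfl
  · exact zero_le

lemma integrable_EE' {f : V → ℂ} (hi : Integrable f) (p : V × ℝ) : Integrable fun ξ => f ξ * ee (ph M p ξ) :=
  hi.mul_bdd (c := 1) (continuous_ee.comp ((continuous_ph M).comp (by fun_prop : Continuous fun ξ : V => (p, ξ)))).aestronglyMeasurable (Filter.Eventually.of_forall fun q => (norm_ee _).le)

open Classical in
lemma EE_fc {T : Type*} {φ : V → T} (hφ : ∀ i, MeasurableSet {ξ | φ ξ = i}) {f : V → ℂ} (hf : Measurable f) (hi : Integrable f) (s : Finset T)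
    (hs : ∀ ξ, f ξ ≠ 0 → φ ξ ∈ s) (p) : ∑ i ∈ s, EE M (fc φ f i) p = EE M f p := by
  unfold EE
  rw [← integral_finsetSum _ fun i _ => integrable_EE' M (integrable_fc hφ hf hi i) p]
  congr 1; ext ξ
  rw [← Finset.sum_mul]
  congr 1
  unfold fc
  rw [Finset.sum_ite_eq]; split_ifs with h
  · rfl
  · by_contra h2; exact h (hs ξ fun h3 => h2 h3.symm)

open Classical in
lemma EE_fc2 {T I : Type*} {φ : V → I} (π : I → T) (hφ : ∀ i, MeasurableSet {ξ | φ ξ = i}) (hπ : ∀ i, MeasurableSet {ξ | π (φ ξ) = i}) {f : V → ℂ} (hf : Measurable f) (hi : Integrable f) (s : Finset I)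
    (hs : ∀ ξ, f ξ ≠ 0 → φ ξ ∈ s) (τ : T) (p) : ∑ i ∈ s with π i = τ, EE M (fc φ f i) p = EE M (fc (fun ξ => π (φ ξ)) f τ) p := by
  rw [← EE_fc M hφ (measurable_fc hπ hf τ) (integrable_fc hπ hf hi τ) (s.filter fun i => π i = τ) (fun ξ h => Finset.mem_filter.2 ⟨hs ξ (fc_ne h).2, (fc_ne h).1⟩)]
  refine Finset.sum_congr rfl fun i h => ?_
  congr 1; ext ξ
  have := (Finset.mem_filter.1 h).2
  unfold fc
  split_ifs with h1 h2 <;> simp_all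

lemma bn_int {T I : Type*} {φ : V → I} (π : I → T) (hφ : ∀ i, MeasurableSet {ξ | φ ξ = i}) (hπ : ∀ i, MeasurableSet {ξ | π (φ ξ) = i}) {f : V → ℂ} (hf : Measurable f) (hi : Integrable f) (s : Finset I)
    (hs : ∀ ξ, f ξ ≠ 0 → φ ξ ∈ s) (far : I → I → Prop) (K : ℕ) (hK : ∀ S ⊆ s, (∀ i ∈ S, ∀ j ∈ S, ¬ far i j) → ∀ [DecidableEq T], (S.image π).card ≤ K) (ν : Measure (V × ℝ)) {A B : ℝ} (hA : 0 ≤ A) (hB : 0 ≤ B)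
    (h1 : ∀ τ, ∫⁻ p, ‖EE M (fc (fun ξ => π (φ ξ)) f τ) p‖ₑ ^ 2 ∂ν ≤ ofReal A * nn (fc (fun ξ => π (φ ξ)) f τ))
    (h2 : ∀ i ∈ s, ∀ j ∈ s, far i j → ∫⁻ p, ‖EE M (fc φ f i) p‖ₑ * ‖EE M (fc φ f j) p‖ₑ ∂ν ≤ ofReal B * (nn (fc φ f i) + nn (fc φ f j))) :
    ∫⁻ p, ‖EE M f p‖ₑ ^ 2 ∂ν ≤ ofReal (4 * K * A + 8 * (s.card : ℝ) ^ 4 * B) * nn f := by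
  classical
  have mE : ∀ i, Measurable (EE M (fc φ f i)) := fun i => measurable_EE M (measurable_fc hφ hf i)
  have mT : ∀ i, Measurable (EE M (fc (fun ξ => π (φ ξ)) f i)) := fun i => measurable_EE M (measurable_fc hπ hf i)
  have pw : ∀ p, ‖EE M f p‖ₑ ^ 2 ≤ ofReal (4 * K) * ∑ τ ∈ s.image π, ‖EE M (fc (fun ξ => π (φ ξ)) f τ) p‖ₑ ^ 2 +
      ofReal (4 * (s.card : ℝ) ^ 2) * ∑ q ∈ s ×ˢ s with far q.1 q.2, ‖EE M (fc φ f q.1) p‖ₑ * ‖EE M (fc φ f q.2) p‖ₑ := fun p => by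
    have := bn s π far K (fun S a b => hK S a b) fun i => EE M (fc φ f i) p
    simp_rw [EE_fc M hφ hf hi s hs p, EE_fc2 M π hφ hπ hf hi s hs _ p] at this
    have := ofReal_le_ofReal this
    rw [ofReal_add (by positivity) (by positivity), ofReal_mul (p := 4 * (K : ℝ)) (by positivity), ofReal_mul (p := 4 * (s.card : ℝ) ^ 2) (by positivity),
      ENNReal.ofReal_sum_of_nonneg (fun _ _ => by positivity), ENNReal.ofReal_sum_of_nonneg (fun _ _ => by positivity)] at this
    simpa only [ofReal_pow (norm_nonneg _), ofReal_mul (norm_nonneg _), ofReal_norm] using this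
  refine (lintegral_mono pw).trans ?_
  rw [lintegral_add_left (by fun_prop), lintegral_const_mul' _ _ ofReal_ne_top, lintegral_const_mul' _ _ ofReal_ne_top,
    lintegral_finsetSum _ (fun _ _ => by fun_prop), lintegral_finsetSum _ (fun _ _ => by fun_prop), ofReal_add (by positivity) (by positivity), add_mul]
  refine add_le_add ?_ ?_
  · calc _ ≤ ofReal (4 * K) * ∑ τ ∈ s.image π, ofReal A * nn (fc (fun ξ => π (φ ξ)) f τ) := by
          gcongr with τ; exact h1 τ
      _ ≤ ofReal (4 * K) * (ofReal A * nn f) := by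
          rw [← Finset.mul_sum]; gcongr; exact sum_nn_fc hπ hf _
      _ = _ := by rw [← mul_assoc, ← ofReal_mul (by positivity)]
  · calc _ ≤ ofReal (4 * (s.card : ℝ) ^ 2) * ∑ q ∈ s ×ˢ s, ofReal B * (nn f + nn f) := by
          gcongr
          refine (Finset.sum_le_sum (g := fun _ => ofReal B * (nn f + nn f)) fun q hq => ?_).trans (Finset.sum_le_sum_of_subset (Finset.filter_subset _ _))
          rw [Finset.mem_filter, Finset.mem_product] at hq
          refine (h2 _ hq.1.1 _ hq.1.2 hq.2).trans ?_
          gcongr <;> exact nn_fc_le _ _ _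
      _ = _ := by
          rw [Finset.sum_const, Finset.card_product, nsmul_eq_mul, ← two_mul, show ((s.card * s.card : ℕ) : ℝ≥0∞) = ofReal ((s.card : ℝ) ^ 2) by rw [← ENNReal.ofReal_natCast]; push_cast; rw [sq], show (2 : ℝ≥0∞) = ofReal 2 by simp]
          simp only [← mul_assoc]
          rw [← ofReal_mul (by positivity), ← ofReal_mul (by positivity), ← ofReal_mul (by positivity)]
          congr 2; ring

end HP
end

noncomputable section
open MeasureTheory Metric Set
open scoped ENNReal NNReal FourierTransform RealInnerProductSpace ContDiff

namespace HP
open ENNReal (ofReal ofReal_mul ofReal_le_ofReal ofReal_pow ofReal_one ofReal_ne_top ofReal_pos ofReal_add)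
set_option linter.unusedSectionVars false

section
variable {ι : Type*} [Fintype ι]

lemma norm_le_card [Nonempty ι] {x : EuclideanSpace ℝ ι} {c : ℝ} (hc : 0 ≤ c) (h : ∀ k, |x k| ≤ c) : ‖x‖ ≤ Fintype.card ι * c := by
  rw [EuclideanSpace.norm_eq]
  refine Real.sqrt_le_iff.2 ⟨by positivity, ?_⟩
  have n1 : (1 : ℝ) ≤ Fintype.card ι := by exact_mod_cast (Fintype.card_pos : 0 < Fintype.card ι)
  calc _ ≤ ∑ k : ι, c ^ 2 := Finset.sum_le_sum fun k _ => by rw [Real.norm_eq_abs]; gcongr; exact h k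
    _ = Fintype.card ι * c ^ 2 := by rw [Finset.sum_const, Finset.card_univ, nsmul_eq_mul]
    _ ≤ _ := by nlinarith [mul_le_mul_of_nonneg_right n1 (by positivity : 0 ≤ (Fintype.card ι : ℝ) * c ^ 2)]

def fl (N : ℕ) (ξ : EuclideanSpace ℝ ι) (k : ι) : ℤ := ⌊(N : ℝ) ^ 2 * ξ k⌋

lemma measurable_fl (N : ℕ) : Measurable (fl (ι := ι) N) := by
  unfold fl
  refine measurable_pi_lambda _ fun k => Int.measurable_floor.comp ?_
  fun_prop

def cen (N : ℕ) (i : ι → ℤ) : EuclideanSpace ℝ ι := WithLp.toLp 2 fun k => (i k : ℝ) / (N : ℝ) ^ 2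

lemma dist_cen [Nonempty ι] {N : ℕ} (hN : 1 ≤ N) (ξ : EuclideanSpace ℝ ι) : ‖ξ - cen N (fl N ξ)‖ ≤ Fintype.card ι * (1 / (N : ℝ) ^ 2) := by
  have hN' : (1 : ℝ) ≤ N := by exact_mod_cast hN
  have h2 : (0 : ℝ) < (N : ℝ) ^ 2 := by positivity
  refine norm_le_card (by positivity) fun k => ?_
  have e : (ξ - cen N (fl N ξ)) k = ((N : ℝ) ^ 2 * ξ k - ⌊(N : ℝ) ^ 2 * ξ k⌋) / (N : ℝ) ^ 2 := by
    simp only [PiLp.sub_apply, cen, fl]; field_simp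
  rw [e, abs_div, abs_of_pos h2]
  gcongr
  rw [abs_of_nonneg (Int.fract_nonneg _)]
  exact (Int.fract_lt_one _).le

lemma dist_cell [Nonempty ι] {N : ℕ} (hN : 1 ≤ N) {ξ ξ' : EuclideanSpace ℝ ι} (h : (fun k => fl N ξ k / (N : ℤ)) = fun k => fl N ξ' k / (N : ℤ)) :
    ‖ξ - ξ'‖ ≤ Fintype.card ι / N := by
  have hN' : (1 : ℝ) ≤ N := by exact_mod_cast hN
  have hz : (0 : ℤ) < N := by exact_mod_cast hN
  rw [div_eq_mul_one_div]
  refine norm_le_card (by positivity) fun k => ?_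
  have key : ∀ η : EuclideanSpace ℝ ι, (N : ℝ) * ((fl N η k / (N : ℤ) : ℤ) : ℝ) ≤ (N : ℝ) ^ 2 * η k ∧ (N : ℝ) ^ 2 * η k < (N : ℝ) * ((fl N η k / (N : ℤ) : ℤ) : ℝ) + N := fun η => by
    have h1 : (N : ℤ) * (fl N η k / N) ≤ fl N η k := Int.mul_ediv_self_le hz.ne'
    have h2 : fl N η k + 1 ≤ N * (fl N η k / N) + N := Int.lt_mul_ediv_self_add hz
    constructor
    · refine le_trans ?_ (Int.floor_le _); change _ ≤ ((fl N η k : ℤ) : ℝ); exact_mod_cast h1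
    · refine (Int.lt_floor_add_one _).trans_le ?_; change ((fl N η k : ℤ) : ℝ) + 1 ≤ _; exact_mod_cast h2
  have a := key ξ
  have b := key ξ'
  rw [congrFun h k] at a
  rw [PiLp.sub_apply, abs_le]
  have hp : (0 : ℝ) < N := by linarith
  constructor
  · rw [neg_le, le_div_iff₀ hp]; nlinarith
  · rw [le_div_iff₀ hp]; nlinarith

variable (M : EuclideanSpace ℝ ι ≃ₗᵢ[ℝ] EuclideanSpace ℝ ι) (s : ι → ℝ)

lemma sep_far [Nonempty ι] (hM : ∀ x k, M x k = s k * x k) {N : ℕ} (hN : 1 ≤ N) (hn : Fintype.card ι ≤ N ^ 2) {i j : ι → ℤ} (h : 24 * Fintype.card ι * (N : ℝ) ^ 2 ≤ |∑ k, s k * ((i k : ℝ) - j k) ^ 2|)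
    {S T : Set (EuclideanSpace ℝ ι)} (hS : ∀ ξ ∈ S, fl N ξ = i ∧ ‖ξ‖ ≤ 1) (hT : ∀ ξ ∈ T, fl N ξ = j ∧ ‖ξ‖ ≤ 1) :
    Sep M 1 (12 * Fintype.card ι / (N : ℝ) ^ 2) S T := by
  intro ξ1 h1 ξ2 h2 ξ3 h3
  set n := Fintype.card ι
  have hN' : (1 : ℝ) ≤ N := by exact_mod_cast hN
  have hN2 : (0 : ℝ) < (N : ℝ) ^ 2 := by positivity
  have hn' : n * (1 / (N : ℝ) ^ 2) ≤ 1 := by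
    rw [mul_one_div, div_le_one hN2]; exact_mod_cast hn
  obtain ⟨f1, b1⟩ := hS ξ1 h1
  obtain ⟨f2, b2⟩ := hT ξ2 h2
  obtain ⟨f3, b3⟩ := hT ξ3 h3
  have d1 := dist_cen hN ξ1
  have d2 := dist_cen hN ξ2
  have d3 := dist_cen hN ξ3
  rw [f1] at d1
  rw [f2] at d2
  rw [f3] at d3
  set a := cen N j - cen N i with ha
  have hc : ∀ ξ, ‖ξ - cen N j‖ ≤ n * (1 / (N : ℝ) ^ 2) → ‖ξ - ξ1 - a‖ ≤ 2 * (n * (1 / (N : ℝ) ^ 2)) := fun ξ hξ => by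
    rw [show ξ - ξ1 - a = (ξ - cen N j) - (ξ1 - cen N i) by rw [ha]; abel]
    refine (norm_sub_le _ _).trans (by linarith)
  have c3 := hc ξ3 d3
  have c2 := hc ξ2 d2
  have B2 : ‖ξ2 - ξ1‖ ≤ 2 := (norm_sub_le _ _).trans (by linarith)
  have A : ‖a‖ ≤ 4 := by
    have := norm_sub_norm_le a (ξ2 - ξ1)
    rw [norm_sub_rev a (ξ2 - ξ1)] at this
    linarith
  have := inner_stab M c3 c2 A B2
  have e : ⟪M a, a⟫ = (∑ k, s k * ((i k : ℝ) - j k) ^ 2) / ((N : ℝ) ^ 2 * (N : ℝ) ^ 2) := by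
    rw [PiLp.inner_apply, Finset.sum_div]
    refine Finset.sum_congr rfl fun k _ => ?_
    rw [hM]
    simp only [ha, cen, PiLp.sub_apply, RCLike.inner_apply, conj_trivial]
    field_simp; ring
  rw [e, abs_div, abs_of_pos (by positivity : (0 : ℝ) < (N : ℝ) ^ 2 * (N : ℝ) ^ 2)] at this
  have h6 : 24 * n / (N : ℝ) ^ 2 ≤ |∑ k, s k * ((i k : ℝ) - j k) ^ 2| / ((N : ℝ) ^ 2 * (N : ℝ) ^ 2) := by
    rw [le_div_iff₀ (by positivity)]
    refine le_trans (le_of_eq ?_) h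
    field_simp
  rw [one_pow, mul_one]
  have e2 : 24 * n / (N : ℝ) ^ 2 = 12 * n / (N : ℝ) ^ 2 + 2 * (n * (1 / (N : ℝ) ^ 2)) * (4 + 2) := by ring
  linarith

lemma inner_M_symm (hM : ∀ x k, M x k = s k * x k) (a b : EuclideanSpace ℝ ι) : ⟪M a, b⟫ = ⟪a, M b⟫ := by
  rw [PiLp.inner_apply, PiLp.inner_apply]
  refine Finset.sum_congr rfl fun k _ => ?_
  rw [hM, hM]; simp only [RCLike.inner_apply, conj_trivial]; ring

lemma lin_step [Nonempty ι] (hs : ∀ k, s k = 1 ∨ s k = -1) (hM : ∀ x k, M x k = s k * x k) {α γ : ℝ} (hα : 0 ≤ α) (h0 : 0 < γ) (h : (α - (Fintype.card ι : ℝ) / 2 + 1 / 2) / 2 < γ)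
    {N : ℕ} (hN : 1 ≤ N) (hn : Fintype.card ι ≤ N) {K : ℕ} (hK : (10 * Fintype.card ι + 3) ^ Fintype.card ι * (3 * N) ^ Nat.card {k // s k = -1} ≤ K) :
    ∃ B : ℝ, 0 < B ∧ ∀ D R ρ : ℝ, 0 ≤ D → 1 ≤ R → ρ = Fintype.card ι / N → Lin M α γ D (ρ ^ 2 * R) →
      Lin M α γ (4 * K * (ρ ^ Fintype.card ι * (3 / ρ) ^ (1 + α) * (ρ ^ 2) ^ γ) * D + B) R := by
  classical
  set n := Fintype.card ι
  have hn1 : 0 < n := Fintype.card_pos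
  have hfr : Module.finrank ℝ (EuclideanSpace ℝ ι) = n := finrank_euclideanSpace
  have hMs := inner_M_symm M s hM
  obtain ⟨C, hC, hbr⟩ := broad M hMs (l := 12 * n / (N : ℝ) ^ 2) hα h0 (by rw [hfr]; exact h) (by positivity)
  set I : Finset (ι → ℤ) := Fintype.piFinset fun _ => Finset.Icc (-(N : ℤ) ^ 2) (N ^ 2)
  refine ⟨8 * (I.card : ℝ) ^ 4 * C + 1, by positivity, fun D R ρ hD hR hρ hL t0 ν _ hA f hf hi hsu => ?_⟩
  have hN' : (1 : ℝ) ≤ N := by exact_mod_cast hN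
  have hρ0 : 0 < ρ := by rw [hρ]; positivity
  have hρ1 : ρ ≤ 1 := by rw [hρ, div_le_one (by positivity)]; exact_mod_cast hn
  have hφ : ∀ i, MeasurableSet {ξ : EuclideanSpace ℝ ι | fl N ξ = i} := fun i => measurable_fl N (measurableSet_singleton i)
  have hπ : ∀ i, MeasurableSet {ξ : EuclideanSpace ℝ ι | (fun k => fl N ξ k / (N : ℤ)) = i} := fun i => by
    have : Measurable fun ξ : EuclideanSpace ℝ ι => fun k => fl N ξ k / (N : ℤ) :=
      (measurable_of_countable fun i : ι → ℤ => fun k => i k / (N : ℤ)).comp (measurable_fl N)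
    exact this (measurableSet_singleton i)
  have hI : ∀ ξ, f ξ ≠ 0 → fl N ξ ∈ I := fun ξ hξ => by
    have := hsu ξ hξ
    rw [Fintype.mem_piFinset]; intro k
    have h2 := (PiLp.norm_apply_le ξ k).trans this
    rw [Real.norm_eq_abs, abs_le] at h2
    have hN2 : (0 : ℝ) < (N : ℝ) ^ 2 := by positivity
    rw [Finset.mem_Icc]
    constructor
    · refine Int.le_floor.2 ?_; push_cast; nlinarith
    · refine Int.floor_le_iff.2 ?_; push_cast; nlinarith
  have main := bn_int M (fun (i : ι → ℤ) k => i k / (N : ℤ)) hφ hπ hf hi I hI (fun i j => 24 * n * (N : ℝ) ^ 2 ≤ |∑ k, s k * ((i k : ℝ) - j k) ^ 2|) K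
    (fun S hS hp _ => by
      have := count s hs hN S (fun i hi k => by
        have := Fintype.mem_piFinset.1 (hS hi) k
        rwa [Finset.mem_Icc] at this) hp
      rw [← Nat.card_eq_fintype_card (α := {k // s k = -1})] at this
      refine le_trans (le_of_eq ?_) (this.trans hK)
      congr!) ν
    (A := ρ ^ n * (3 / ρ) ^ (1 + α) * (ρ ^ 2) ^ γ * (D * R ^ γ)) (B := C * R ^ γ) (by positivity) (by positivity) (fun τ => ?_) (fun i _ j _ hij => ?_)
  · refine main.trans (mul_le_mul_left (ofReal_le_ofReal ?_) _)
    have : (0 : ℝ) ≤ R ^ γ := by positivity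
    nlinarith
  · set g := fc (fun ξ => fun k => fl N ξ k / (N : ℤ)) f τ with hg
    by_cases hz : ∃ ξ, g ξ ≠ 0
    · obtain ⟨ξ0, h0⟩ := hz
      have a0 := fc_ne h0
      have := rescale M hMs hD (by linarith) hα hρ0 hρ1 hL (hsu ξ0 a0.2) hA (measurable_fc hπ hf τ) (integrable_fc hπ hf hi τ) (fun ξ hξ => by
        rw [hρ]
        exact dist_cell hN ((fc_ne hξ).1.trans a0.1.symm))
      rwa [hfr] at this
    · push Not at hz
      have : ∀ p, EE M g p = 0 := fun p => by unfold EE; simp [hz]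
      simp [this]
  · have hij' : 24 * n * (N : ℝ) ^ 2 ≤ |∑ k, s k * ((j k : ℝ) - i k) ^ 2| := by
      simpa only [sub_sq_comm] using hij
    have q : ∀ i, ∀ ξ ∈ {ξ | fc (fl N) f i ξ ≠ 0}, fl N ξ = i ∧ ‖ξ‖ ≤ 1 := fun i ξ hξ => ⟨(fc_ne hξ).1, hsu ξ (fc_ne hξ).2⟩
    have hn2 : n ≤ N ^ 2 := by nlinarith
    exact hbr R t0 ν hR inferInstance hA _ _ (measurable_fc hφ hf i) (measurable_fc hφ hf j) (integrable_fc hφ hf hi i) (integrable_fc hφ hf hi j)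
      (fun ξ hξ => (q i ξ hξ).2) (fun ξ hξ => (q j ξ hξ).2) (sep_far M s hM hN hn2 hij (q i) (q j)) (sep_far M s hM hN hn2 hij' (q j) (q i))

lemma ex_N {n m : ℕ} (hn : 1 ≤ n) {α γ : ℝ} (h : (α - (n : ℝ) / 2 + 1 / 2) / 2 < γ) (hm : 2 * m + 1 ≤ n) : ∃ N : ℕ, 2 * n ≤ N ∧ ∀ ρ : ℝ, ρ = n / N →
    4 * ((10 * n + 3) ^ n * (3 * N) ^ m : ℕ) * (ρ ^ n * (3 / ρ) ^ (1 + α) * (ρ ^ 2) ^ γ) ≤ 1 / 2 := by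
  set θ : ℝ := n - 1 - α + 2 * γ - m with hθ
  have hm' : 2 * (m : ℝ) + 1 ≤ n := by exact_mod_cast hm
  have hθ0 : 0 < θ := by rw [hθ]; linarith
  set C : ℝ := 4 * (10 * n + 3) ^ n * 3 ^ m * 3 ^ (1 + α) * n ^ (θ + m) with hC
  have hl : Filter.Tendsto (fun N : ℕ => C * (N : ℝ) ^ (-θ)) Filter.atTop (nhds (C * 0)) :=
    ((tendsto_rpow_neg_atTop hθ0).comp tendsto_natCast_atTop_atTop).const_mul C
  rw [mul_zero] at hl
  obtain ⟨N, h1, h2⟩ := ((hl.eventually (Iic_mem_nhds (by norm_num : (0 : ℝ) < 1 / 2))).and (Filter.eventually_ge_atTop (2 * n))).exists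
  refine ⟨N, h2, fun ρ hρ => le_trans (le_of_eq ?_) h1⟩
  have hn0 : (0 : ℝ) < n := by exact_mod_cast hn
  have hN0 : (0 : ℝ) < N := by exact_mod_cast (by omega : 0 < N)
  have hρ0 : 0 < ρ := by rw [hρ]; positivity
  have e : ρ ^ n * (3 / ρ) ^ (1 + α) * (ρ ^ 2) ^ γ = 3 ^ (1 + α) * (n ^ (θ + m) * ((N : ℝ) ^ (-θ) * ((N : ℝ) ^ m)⁻¹)) := by
    rw [Real.div_rpow (by norm_num) hρ0.le, ← Real.rpow_natCast ρ n, ← Real.rpow_natCast ρ 2, ← Real.rpow_mul hρ0.le]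
    have : ρ ^ (n : ℝ) * (3 ^ (1 + α) / ρ ^ (1 + α)) * ρ ^ (((2 : ℕ) : ℝ) * γ) = 3 ^ (1 + α) * ρ ^ (θ + m) := by
      have : ρ ^ (θ + m) = ρ ^ (n : ℝ) * ρ ^ (((2 : ℕ) : ℝ) * γ) / ρ ^ (1 + α) := by
        rw [← Real.rpow_add hρ0, ← Real.rpow_sub hρ0]; congr 1; rw [hθ]; push_cast; ring
      rw [this]; ring
    rw [this, hρ, Real.div_rpow hn0.le hN0.le, ← Real.rpow_natCast (N : ℝ) m, ← Real.rpow_neg hN0.le, ← Real.rpow_add hN0, div_eq_mul_inv, ← Real.rpow_neg hN0.le]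
    congr 3; ring
  rw [e, hC]
  push_cast
  rw [mul_pow]
  field_simp

theorem lin_all [Nonempty ι] (hs : ∀ k, s k = 1 ∨ s k = -1) (hM : ∀ x k, M x k = s k * x k) {α γ : ℝ} (hα : 0 ≤ α) (h0 : 0 < γ) (h : (α - (Fintype.card ι : ℝ) / 2 + 1 / 2) / 2 < γ)
    (hm : 2 * Nat.card {k // s k = -1} + 1 ≤ Fintype.card ι) : ∃ D : ℝ, 0 < D ∧ ∀ R : ℝ, 1 ≤ R → Lin M α γ D R := by
  have hn1 : 0 < Fintype.card ι := Fintype.card_pos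
  obtain ⟨N, hN, hsm⟩ := ex_N hn1 h hm
  obtain ⟨B, hB, hst⟩ := lin_step M s hs hM hα h0 h (N := N) (by omega) (by omega) le_rfl
  obtain ⟨C, hC, hba⟩ := base M hα
  set n := Fintype.card ι
  have hn0 : (0 : ℝ) < n := by exact_mod_cast hn1
  have hN0 : (0 : ℝ) < N := by exact_mod_cast (by omega : 0 < N)
  set D : ℝ := C * N ^ 2 + 2 * B with hD
  have hD0 : 0 < D := by positivity
  refine ⟨D, hD0, ?_⟩
  have ind : ∀ k : ℕ, ∀ R : ℝ, 1 ≤ R → R ≤ N ^ 2 * 4 ^ k → Lin M α γ D R := by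
    intro k
    induction k with
    | zero =>
      intro R h1 h2
      refine hba R γ D h1 h0.le ?_
      rw [pow_zero, mul_one] at h2
      rw [hD]
      linarith [mul_le_mul_of_nonneg_left h2 hC.le]
    | succ k ih =>
      intro R h1 h2
      by_cases hR : R ≤ N ^ 2
      · refine hba R γ D h1 h0.le ?_
        rw [hD]
        linarith [mul_le_mul_of_nonneg_left hR hC.le]
      push Not at hR
      have hnN : 2 * (n : ℝ) ≤ N := by exact_mod_cast hN
      have hn1' : (1 : ℝ) ≤ n := by exact_mod_cast hn1
      have r1 : ((n : ℝ) / N) ^ 2 ≤ 1 / 4 := by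
        rw [div_pow, div_le_iff₀ (by positivity)]; nlinarith
      have r2 : 1 ≤ ((n : ℝ) / N) ^ 2 * R := by
        rw [div_pow, div_mul_eq_mul_div, le_div_iff₀ (by positivity), one_mul]
        exact hR.le.trans (le_mul_of_one_le_left (by linarith) (one_le_pow₀ hn1'))
      have := hst D R _ hD0.le h1 rfl (ih _ r2 ((mul_le_mul_of_nonneg_right r1 (by linarith : 0 ≤ R)).trans (by
        have : R ≤ 4 * (N ^ 2 * 4 ^ k) := h2.trans_eq (by ring)
        generalize (N : ℝ) ^ 2 * 4 ^ k = P at this ⊢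
        linarith)))
      intro t0 ν hν hA f hf hi hsu
      refine (this t0 ν hν hA f hf hi hsu).trans (mul_le_mul_left (ofReal_le_ofReal ?_) _)
      gcongr
      have h3 := mul_le_mul_of_nonneg_right (hsm _ rfl) hD0.le
      have : B ≤ D / 2 := by rw [hD]; linarith [show 0 ≤ C * (N : ℝ) ^ 2 by positivity]
      linarith
  intro R hR
  obtain ⟨k, hk⟩ := pow_unbounded_of_one_lt R (by norm_num : (1 : ℝ) < 4)
  refine ind k R hR (hk.le.trans ?_)
  have : (1 : ℝ) ≤ N := by exact_mod_cast (by omega : 1 ≤ N)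
  exact le_mul_of_one_le_left (by positivity) (one_le_pow₀ this)

end
end HP
end

noncomputable section
open MeasureTheory Metric Set
open scoped ENNReal NNReal FourierTransform RealInnerProductSpace ContDiff

namespace HP
open ENNReal (ofReal ofReal_mul ofReal_le_ofReal ofReal_pow ofReal_one ofReal_ne_top ofReal_pos ofReal_add)
set_option linter.unusedSectionVars false
variable {V : Type*} [NormedAddCommGroup V] [InnerProductSpace ℝ V] [FiniteDimensional ℝ V]
  [MeasurableSpace V] [BorelSpace V]
open ComplexConjugate
variable (M : V ≃ₗᵢ[ℝ] V) {g : V → ℝ}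

section fin
variable {E : Type*} [MetricSpace E] [MeasurableSpace E] [BorelSpace E] [SecondCountableTopology E]

def UU (α : ℝ) (μ : Measure E) (x : E) : ℝ≥0∞ := ∫⁻ y, ofReal (dist x y) ^ (-α) ∂μ

lemma measurable_UU (α : ℝ) (μ : Measure E) [IsFiniteMeasure μ] : Measurable (UU α μ) := by
  have h : Measurable fun q : E × E => ofReal (dist q.1 q.2) ^ (-α) :=
    (ENNReal.measurable_ofReal.comp measurable_dist).pow_const _
  exact h.lintegral_prod_right'

lemma UU_inv_le {α r : ℝ} (hα : 0 ≤ α) (hr : 0 < r) {μ : Measure E} [IsFiniteMeasure μ] {A : Set E} (hA : MeasurableSet A)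
    (h : ∀ x ∈ A, ∀ y ∈ A, dist x y ≤ r) : ∫⁻ x in A, (UU α μ x)⁻¹ ∂μ ≤ ofReal (r ^ α) := by
  set c : ℝ≥0∞ := ofReal r ^ (-α)
  have hc : c = ofReal (r ^ (-α)) := ENNReal.ofReal_rpow_of_pos hr
  have c0 : c ≠ 0 := by rw [hc]; exact (ENNReal.ofReal_pos.2 (by positivity)).ne'
  have c1 : c ≠ ⊤ := by rw [hc]; exact ofReal_ne_top
  have k1 : ∀ x ∈ A, (UU α μ x)⁻¹ ≤ (c * μ A)⁻¹ := by
    intro x hx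
    refine ENNReal.inv_le_inv.2 ?_
    calc c * μ A = ∫⁻ y in A, c ∂μ := by rw [setLIntegral_const]
      _ ≤ ∫⁻ y in A, ofReal (dist x y) ^ (-α) ∂μ := by
        refine setLIntegral_mono' hA fun y hy => ?_
        show ofReal r ^ (-α) ≤ _
        rw [ENNReal.rpow_neg, ENNReal.rpow_neg]
        exact ENNReal.inv_le_inv.2 (ENNReal.rpow_le_rpow (ofReal_le_ofReal (h x hx y hy)) hα)
      _ ≤ _ := setLIntegral_le_lintegral _ _
  calc _ ≤ ∫⁻ x in A, (c * μ A)⁻¹ ∂μ := setLIntegral_mono' hA k1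
    _ = (c * μ A)⁻¹ * μ A := setLIntegral_const _ _
    _ = c⁻¹ * ((μ A)⁻¹ * μ A) := by rw [ENNReal.mul_inv (Or.inl c0) (Or.inl c1), mul_assoc]
    _ ≤ c⁻¹ * 1 := mul_le_mul_right (ENNReal.inv_mul_le_one _) _
    _ = _ := by
      rw [mul_one, hc, ← ENNReal.ofReal_inv_of_pos (by positivity), Real.rpow_neg hr.le, inv_inv]

def FF (μ : Measure E) (Ψ : E → V × ℝ) : V → ℂ :=
  (ball (0 : V) 1).indicator fun ξ => ∫ x, ee (-ph M (Ψ x) ξ) ∂μ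

lemma measurable_FF {μ : Measure E} [IsFiniteMeasure μ] {Ψ : E → V × ℝ} (hΨ : Measurable Ψ) : Measurable (FF M μ Ψ) := by
  have h : StronglyMeasurable fun q : V × E => ee (-ph M (Ψ q.2) q.1) := by
    refine (measurable_ee.comp (Measurable.neg ?_)).stronglyMeasurable
    exact (continuous_ph M).measurable.comp ((hΨ.comp measurable_snd).prodMk measurable_fst)
  have h2 : StronglyMeasurable fun ξ : V => ∫ x, ee (-ph M (Ψ x) ξ) ∂μ := h.integral_prod_right
  exact h2.measurable.indicator measurableSet_ball

lemma norm_FF {μ : Measure E} [IsFiniteMeasure μ] {Ψ : E → V × ℝ} (ξ : V) : ‖FF M μ Ψ ξ‖ ≤ μ.real univ := by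
  refine (norm_indicator_le_norm_self _ _).trans ?_
  refine (norm_integral_le_of_norm_le_const (C := 1) (ae_of_all _ fun x => by simp [norm_ee])).trans (by simp)

lemma integrable_FF {μ : Measure E} [IsFiniteMeasure μ] {Ψ : E → V × ℝ} (hΨ : Measurable Ψ) : Integrable (FF M μ Ψ) := by
  have : IntegrableOn (FF M μ Ψ) (ball (0:V) 1) :=
    Measure.integrableOn_of_bounded (M := μ.real univ) measure_ball_lt_top.ne (measurable_FF M hΨ).aestronglyMeasurable
      (ae_of_all _ fun ξ => norm_FF M ξ)
  refine (integrableOn_iff_integrable_of_support_subset ?_).1 this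
  exact support_indicator_subset

lemma nn_FF_le {μ : Measure E} [IsFiniteMeasure μ] {Ψ : E → V × ℝ} (hΨ : Measurable Ψ) :
    nn (FF M μ Ψ) ≤ ∫⁻ x, ‖EE M (FF M μ Ψ) (Ψ x)‖ₑ ∂μ := by
  set F := FF M μ Ψ with hF
  have iF : Integrable F := integrable_FF M hΨ
  have mF : Measurable F := measurable_FF M hΨ
  have e1 : ∀ ξ, F ξ * ∫ x, ee (ph M (Ψ x) ξ) ∂μ = ((‖F ξ‖ ^ 2 : ℝ) : ℂ) := by
    intro ξ
    by_cases hξ : ξ ∈ ball (0:V) 1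
    · have : F ξ = ∫ x, ee (-ph M (Ψ x) ξ) ∂μ := by rw [hF, FF, indicator_of_mem hξ]
      have h2 : (∫ x, ee (ph M (Ψ x) ξ) ∂μ) = conj (F ξ) := by
        rw [this, ← integral_conj]; congr 1; ext x; rw [conj_ee, neg_neg]
      rw [h2, Complex.mul_conj, Complex.normSq_eq_norm_sq]
    · have : F ξ = 0 := by rw [hF, FF, indicator_of_notMem hξ]
      simp [this]
  have i2 : Integrable fun ξ => ‖F ξ‖ ^ 2 := by
    have := iF.norm.mul_bdd (c := μ.real univ) iF.norm.aestronglyMeasurable (ae_of_all _ fun ξ => by rw [norm_norm]; exact norm_FF M ξ)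
    simpa [sq] using this
  have e2 : nn F = ‖∫ ξ, F ξ * ∫ x, ee (ph M (Ψ x) ξ) ∂μ‖ₑ := by
    simp_rw [e1]
    rw [integral_complex_ofReal, ← ofReal_norm, Complex.norm_real, Real.norm_of_nonneg (integral_nonneg fun _ => by positivity),
      ofReal_integral_eq_lintegral_ofReal i2 (ae_of_all _ fun _ => by positivity)]
    refine lintegral_congr fun ξ => ?_
    rw [ofReal_pow (norm_nonneg _), ofReal_norm]
  have ip : Integrable (fun q : V × E => F q.1 * ee (ph M (Ψ q.2) q.1)) (volume.prod μ) := by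
    refine (iF.comp_fst μ).mul_bdd (c := 1) ?_ (ae_of_all _ fun q => by rw [norm_ee])
    refine (measurable_ee.comp ?_).aestronglyMeasurable
    exact (continuous_ph M).measurable.comp ((hΨ.comp measurable_snd).prodMk measurable_fst)
  have e3 : (∫ ξ, F ξ * ∫ x, ee (ph M (Ψ x) ξ) ∂μ) = ∫ x, EE M F (Ψ x) ∂μ := by
    simp_rw [← integral_const_mul]
    rw [integral_integral_swap ip]
    rfl
  rw [e2, e3]
  exact enorm_integral_le_lintegral_enorm _

lemma energy_bound {α γ D R a B : ℝ} (hα : 0 < α) (hD : 0 < D) (hR : 1 ≤ R) (ha : 0 < a) (hL : Lin M α γ D R)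
    {μ : Measure E} [IsFiniteMeasure μ] {Ψ : E → V × ℝ} (hΨ : Measurable Ψ)
    (hd : ∀ x y, dist x y ≤ a / 2 * dist (Ψ x) (Ψ y)) (hR2 : ∀ᵐ x ∂μ, |(Ψ x).2| ≤ R / 2) (hB : ∀ᵐ x ∂μ, ‖Ψ x‖ ≤ B)
    (hU : ∫⁻ x, UU α μ x ∂μ ≠ ⊤) :
    nn (FF M μ Ψ) ≤ ofReal (a ^ α * D * R ^ γ) * ∫⁻ x, UU α μ x ∂μ := by
  set F := FF M μ Ψ with hF
  have mU := measurable_UU α μ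
  rcases eq_zero_or_neZero μ with h0 | h0
  · refine (nn_FF_le M hΨ).trans ?_
    rw [h0]; simp
  have U0 : ∀ x, UU α μ x ≠ 0 := by
    intro x h
    rw [UU, lintegral_eq_zero_iff (by fun_prop)] at h
    have : ∀ᵐ y ∂μ, False := by
      filter_upwards [h] with y hy
      simp only [Pi.zero_apply, ENNReal.rpow_eq_zero_iff, ofReal_ne_top, false_and, or_false] at hy
      linarith [hy.2]
    have := ae_iff.1 this
    simp only [not_false_eq_true, setOf_true] at this
    exact h0.out (Measure.measure_univ_eq_zero.1 this)
  have U1 : ∀ᵐ x ∂μ, UU α μ x ≠ ⊤ := by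
    filter_upwards [ae_lt_top mU hU] with x hx using hx.ne
  set ν' := μ.withDensity fun x => (UU α μ x)⁻¹ with hν'
  have hball : ∀ p : V × ℝ, ∀ r : ℝ, 0 < r → ν' (Ψ ⁻¹' closedBall p r) ≤ ofReal ((a * r) ^ α) := by
    intro p r hr
    have mA : MeasurableSet (Ψ ⁻¹' closedBall p r) := hΨ measurableSet_closedBall
    rw [hν', withDensity_apply _ mA]
    refine UU_inv_le hα.le (by positivity) mA fun x hx y hy => (hd x y).trans ?_
    have := dist_triangle_right (Ψ x) (Ψ y) p
    have h1 := mem_closedBall.1 hx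
    have h2 := mem_closedBall.1 hy
    nlinarith
  have hac : ν' ≪ μ := withDensity_absolutelyContinuous _ _
  have fin' : IsFiniteMeasure ν' := by
    refine ⟨?_⟩
    have z : ν' (Ψ ⁻¹' closedBall 0 (|B| + 1))ᶜ = 0 := by
      refine hac ?_
      refine measure_mono_null (t := {x | ¬ ‖Ψ x‖ ≤ B}) ?_ hB
      intro x hx h
      exact hx (by simp only [mem_preimage, mem_closedBall, dist_zero_right]; linarith [le_abs_self B])
    calc ν' univ ≤ ν' (Ψ ⁻¹' closedBall 0 (|B| + 1)) + ν' (Ψ ⁻¹' closedBall 0 (|B| + 1))ᶜ := by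
          rw [← union_compl_self (Ψ ⁻¹' closedBall 0 (|B| + 1))]; exact measure_union_le _ _
      _ < ⊤ := by
        rw [z, add_zero]
        exact (hball _ _ (by positivity)).trans_lt ENNReal.ofReal_lt_top
  set c := ofReal ((a ^ α)⁻¹) with hc
  set ν := c • ν'.map Ψ with hν
  have finν : IsFiniteMeasure ν := Measure.smul_finite _ ofReal_ne_top
  have adm : Adm α R (-(R / 2)) ν := by
    constructor
    · intro p r hr
      rw [hν, Measure.smul_apply, Measure.map_apply hΨ measurableSet_closedBall, smul_eq_mul]
      refine (mul_le_mul_right (hball p r (by linarith)) _).trans ?_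
      rw [hc, ← ofReal_mul (by positivity), Real.mul_rpow ha.le (by linarith), inv_mul_cancel_left₀ (by positivity)]
    · have mS : MeasurableSet {p : V × ℝ | p.2 ∉ Icc (-(R / 2)) (-(R / 2) + R)} :=
        (measurable_snd measurableSet_Icc).compl
      rw [hν, Measure.smul_apply, Measure.map_apply hΨ mS, smul_eq_mul]
      have : ν' (Ψ ⁻¹' {p : V × ℝ | p.2 ∉ Icc (-(R / 2)) (-(R / 2) + R)}) = 0 := by
        refine hac (measure_mono_null (t := {x | ¬ |(Ψ x).2| ≤ R / 2}) ?_ hR2)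
        intro x hx h
        obtain ⟨h1, h2⟩ := abs_le.1 h
        exact hx ⟨h1, by linarith⟩
      rw [this, mul_zero]
  have mF : Measurable F := measurable_FF M hΨ
  have mEE : Measurable fun p => EE M F p := measurable_EE M mF
  have key := hL (-(R / 2)) ν finν adm F mF (integrable_FF M hΨ) (by
    intro ξ h
    rw [hF, FF] at h
    have := mem_of_indicator_ne_zero h
    simpa using (mem_ball.1 this).le)
  have mI : Measurable fun p => ‖EE M F p‖ₑ ^ 2 := mEE.enorm.pow_const 2
  rw [hν, lintegral_smul_measure, lintegral_map mI hΨ, smul_eq_mul] at key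
  have cs : (∫⁻ x, ‖EE M F (Ψ x)‖ₑ ∂μ) ^ 2 ≤ (∫⁻ x, ‖EE M F (Ψ x)‖ₑ ^ 2 ∂ν') * ∫⁻ x, UU α μ x ∂μ := by
    have mE : Measurable fun x => ‖EE M F (Ψ x)‖ₑ := (mEE.comp hΨ).enorm
    have := CS_sq (μ := μ) (f := fun x => ‖EE M F (Ψ x)‖ₑ * ((UU α μ x)⁻¹) ^ (1/2 : ℝ)) (g := fun x => (UU α μ x) ^ (1/2 : ℝ))
      (mE.mul (mU.inv.pow_const _)).aemeasurable (mU.pow_const _).aemeasurable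
    have hsq : ∀ t : ℝ≥0∞, (t ^ (1/2 : ℝ)) ^ 2 = t := by
      intro t; rw [← ENNReal.rpow_natCast, ← ENNReal.rpow_mul]; norm_num
    have l1 : ∫⁻ x, ‖EE M F (Ψ x)‖ₑ * ((UU α μ x)⁻¹) ^ (1/2 : ℝ) * (UU α μ x) ^ (1/2 : ℝ) ∂μ = ∫⁻ x, ‖EE M F (Ψ x)‖ₑ ∂μ := by
      refine lintegral_congr_ae ?_
      filter_upwards [U1] with x hx
      rw [mul_assoc, ← ENNReal.mul_rpow_of_nonneg _ _ (by norm_num), ENNReal.inv_mul_cancel (U0 x) hx, ENNReal.one_rpow, mul_one]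
    have l2 : ∫⁻ x, ‖EE M F (Ψ x)‖ₑ ^ 2 ∂ν' = ∫⁻ x, (‖EE M F (Ψ x)‖ₑ * ((UU α μ x)⁻¹) ^ (1/2 : ℝ)) ^ 2 ∂μ := by
      rw [hν', lintegral_withDensity_eq_lintegral_mul _ (by fun_prop : Measurable fun x => (UU α μ x)⁻¹) (mE.pow_const 2)]
      refine lintegral_congr fun x => ?_
      rw [mul_pow, hsq, mul_comm]; rfl
    rw [l2]
    simp_rw [hsq] at this
    rw [← l1]
    exact this
  have fX : nn F ≠ ⊤ := by
    have : nn F ≤ ∫⁻ ξ in ball (0:V) 1, ofReal (μ.real univ) ^ 2 := by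
      rw [nn, ← lintegral_indicator measurableSet_ball]
      refine lintegral_mono fun ξ => ?_
      by_cases hξ : ξ ∈ ball (0:V) 1
      · rw [indicator_of_mem hξ]
        gcongr
        rw [← ofReal_norm]
        exact ofReal_le_ofReal (norm_FF M ξ)
      · have : F ξ = 0 := by rw [hF, FF, indicator_of_notMem hξ]
        simp [this]
    refine (this.trans_lt ?_).ne
    rw [setLIntegral_const]
    exact ENNReal.mul_lt_top (ENNReal.pow_lt_top ENNReal.ofReal_lt_top) measure_ball_lt_top
  by_cases X0 : nn F = 0
  · rw [X0]; exact zero_le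
  set J := ∫⁻ x, UU α μ x ∂μ with hJ
  have step : nn F * nn F ≤ nn F * (ofReal (a ^ α * D * R ^ γ) * J) := by
    calc nn F * nn F = nn F ^ 2 := (sq _).symm
      _ ≤ (∫⁻ x, ‖EE M F (Ψ x)‖ₑ ∂μ) ^ 2 := by gcongr; exact nn_FF_le M hΨ
      _ ≤ (∫⁻ x, ‖EE M F (Ψ x)‖ₑ ^ 2 ∂ν') * J := cs
      _ = ofReal (a ^ α) * (c * ∫⁻ x, ‖EE M F (Ψ x)‖ₑ ^ 2 ∂ν') * J := by
        rw [← mul_assoc, hc, ← ofReal_mul (by positivity), mul_inv_cancel₀ (by positivity), ofReal_one, one_mul]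
      _ ≤ ofReal (a ^ α) * (ofReal (D * R ^ γ) * nn F) * J := by gcongr
      _ = _ := by
        rw [mul_assoc (a ^ α), ofReal_mul (p := a ^ α) (by positivity)]; ring
  exact (ENNReal.mul_le_mul_iff_right X0 fX).1 step

end fin
end HP
end

namespace HP
section conc
open ENNReal (ofReal ofReal_mul ofReal_le_ofReal ofReal_pow ofReal_one ofReal_ne_top ofReal_pos ofReal_add)
open Set
open scoped RealInnerProductSpace
variable {d : ℕ}

lemma sum_split (hd : 0 < d) (f : Fin d → ℝ) :
    ∑ i, f i = (∑ k : Fin (d - 1), f ⟨k, by omega⟩) + f ⟨d - 1, by omega⟩ := by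
  obtain ⟨n, rfl⟩ : ∃ n, d = n + 1 := ⟨d - 1, by omega⟩
  exact Fin.sum_univ_castSucc f

def Psi (hd : 0 < d) (κ : ℝ) (x : EuclideanSpace ℝ (Fin d)) : EuclideanSpace ℝ (Fin (d - 1)) × ℝ :=
  (WithLp.toLp 2 fun k : Fin (d - 1) => κ * x ⟨k, by omega⟩, κ * x ⟨d - 1, by omega⟩)

lemma continuous_Psi (hd : 0 < d) (κ : ℝ) : Continuous (Psi hd κ) := by
  unfold Psi; fun_prop

lemma dist_Psi (hd : 0 < d) {κ : ℝ} (hκ : 0 < κ) (x y : EuclideanSpace ℝ (Fin d)) :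
    dist x y ≤ 4 / κ / 2 * dist (Psi hd κ x) (Psi hd κ y) := by
  set T := dist (Psi hd κ x) (Psi hd κ y) with hT
  have T0 : 0 ≤ T := dist_nonneg
  have h1 : dist (Psi hd κ x).1 (Psi hd κ y).1 ≤ T := le_max_left _ _
  have h2 : dist (Psi hd κ x).2 (Psi hd κ y).2 ≤ T := le_max_right _ _
  have e1 : dist (Psi hd κ x).1 (Psi hd κ y).1 ^ 2 = κ ^ 2 * ∑ k : Fin (d - 1), (x ⟨k, by omega⟩ - y ⟨k, by omega⟩) ^ 2 := by
    rw [EuclideanSpace.dist_eq, Real.sq_sqrt (Finset.sum_nonneg fun _ _ => by positivity), Finset.mul_sum]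
    refine Finset.sum_congr rfl fun k _ => ?_
    rw [Real.dist_eq, sq_abs]
    simp only [Psi]; ring
  have e2 : dist (Psi hd κ x).2 (Psi hd κ y).2 ^ 2 = κ ^ 2 * (x ⟨d - 1, by omega⟩ - y ⟨d - 1, by omega⟩) ^ 2 := by
    rw [Real.dist_eq, sq_abs]; simp only [Psi]; ring
  have e3 : (κ * dist x y) ^ 2 ≤ (2 * T) ^ 2 := by
    have : dist x y ^ 2 = ∑ i, (x i - y i) ^ 2 := by
      rw [EuclideanSpace.dist_eq, Real.sq_sqrt (Finset.sum_nonneg fun _ _ => by positivity)]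
      refine Finset.sum_congr rfl fun k _ => ?_
      rw [Real.dist_eq, sq_abs]
    rw [mul_pow, this, sum_split hd, mul_add, ← e1, ← e2]
    have a1 := pow_le_pow_left₀ dist_nonneg h1 2
    have a2 := pow_le_pow_left₀ dist_nonneg h2 2
    nlinarith [sq_nonneg T]
  have e4 := (pow_le_pow_iff_left₀ (by positivity) (by positivity) two_ne_zero).1 e3
  have : 4 / κ / 2 * T = (2 * T) / κ := by field_simp; norm_num
  rw [this, le_div_iff₀ hκ]
  linarith

def sg (d m : ℕ) (k : Fin (d - 1)) : ℝ := if (k : ℕ) < d - 1 - m then 1 else -1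

def MM (d m : ℕ) : EuclideanSpace ℝ (Fin (d - 1)) ≃ₗᵢ[ℝ] EuclideanSpace ℝ (Fin (d - 1)) :=
  LinearIsometryEquiv.piLpCongrRight 2 fun k : Fin (d - 1) =>
    if (k : ℕ) < d - 1 - m then LinearIsometryEquiv.refl ℝ ℝ else LinearIsometryEquiv.neg ℝ

lemma MM_apply (d m : ℕ) (x : EuclideanSpace ℝ (Fin (d - 1))) (k : Fin (d - 1)) : MM d m x k = sg d m k * x k := by
  have : MM d m x k = (if (k : ℕ) < d - 1 - m then LinearIsometryEquiv.refl ℝ ℝ else LinearIsometryEquiv.neg ℝ) (x k) := rfl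
  rw [this, sg]
  split_ifs <;> simp

lemma QQ_MM (d m : ℕ) (ξ : EuclideanSpace ℝ (Fin (d - 1))) : QQ (MM d m) ξ = hypQ d m ξ := by
  rw [QQ, hypQ, PiLp.inner_apply]
  refine Finset.sum_congr rfl fun k _ => ?_
  rw [MM_apply, sg]
  simp only [RCLike.inner_apply, conj_trivial]
  ring

lemma card_sg {m : ℕ} (hm : 2 * m + 1 ≤ d - 1) : 2 * Nat.card {k // sg d m k = -1} + 1 ≤ Fintype.card (Fin (d - 1)) := by
  have : Nat.card {k // sg d m k = -1} ≤ Nat.card (Fin m) := by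
    have hk : ∀ k : {k // sg d m k = -1}, d - 1 - m ≤ (k.1 : ℕ) := by
      rintro ⟨k, hk⟩
      by_contra h
      push Not at h
      rw [sg, if_pos h] at hk
      norm_num at hk
    refine Nat.card_le_card_of_injective (fun k => (⟨(k.1 : ℕ) - (d - 1 - m), by have := hk k; have := k.1.2; omega⟩ : Fin m)) ?_
    intro k l h
    have h' := Fin.mk.inj_iff.1 h
    have a := hk k
    have b := hk l
    exact Subtype.ext (Fin.ext (by omega))
  rw [Nat.card_fin] at this
  rw [Fintype.card_fin]
  omega

lemma ftM_eq (hd : 0 < d) (m : ℕ) (μ : Measure (EuclideanSpace ℝ (Fin d))) (R : ℝ) (ξ : EuclideanSpace ℝ (Fin (d - 1))) :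
    ftM μ (R • hypLift d m ξ) = ∫ x, ee (-ph (MM d m) (Psi hd (R / (2 * Real.pi)) x) ξ) ∂μ := by
  unfold ftM
  congr 1
  ext x
  rw [ee_eq]
  congr 1
  have e : ∑ i, x i * (R • hypLift d m ξ) i = 2 * Real.pi * ph (MM d m) (Psi hd (R / (2 * Real.pi)) x) ξ := by
    have l1 : ∀ k : Fin (d - 1), (R • hypLift d m ξ) ⟨k, by omega⟩ = R * ξ k := by
      intro k; simp [hypLift]
    have l2 : (R • hypLift d m ξ) ⟨d - 1, by omega⟩ = R * hypQ d m ξ := by simp [hypLift]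
    rw [sum_split hd, l2, ph, QQ_MM, PiLp.inner_apply, mul_add, Finset.mul_sum]
    congr 1
    · refine Finset.sum_congr rfl fun k _ => ?_
      rw [l1]
      simp only [Psi, RCLike.inner_apply, conj_trivial]
      field_simp
    · simp only [Psi]; field_simp
  rw [e]
  push_cast
  ring

lemma hypAvg_le (hd : 0 < d) (m : ℕ) (μ : Measure (EuclideanSpace ℝ (Fin d))) [IsFiniteMeasure μ] (R : ℝ) :
    ofReal (hypAvg d m μ R) ≤ ofReal 3 * nn (FF (MM d m) μ (Psi hd (R / (2 * Real.pi)))) := by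
  set F := FF (MM d m) μ (Psi hd (R / (2 * Real.pi)))
  have n1 : 0 ≤ᵐ[volume.restrict (ball (0 : EuclideanSpace ℝ (Fin (d - 1))) 1)]
      fun ξ => ‖ftM μ (R • hypLift d m ξ)‖ ^ 2 * Real.sqrt (1 + 4 * ‖ξ‖ ^ 2) := ae_of_all _ fun ξ => by
    simp only [Pi.zero_apply]; positivity
  unfold hypAvg
  refine (ofReal_le_ofReal (integral_mono_of_nonneg (g := fun ξ => 3 * ‖F ξ‖ ^ 2) n1 ?_ ?_)).trans ?_
  · refine Integrable.const_mul ?_ _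
    have iF := integrable_FF (MM d m) (μ := μ) (continuous_Psi hd (R / (2 * Real.pi))).measurable
    have := iF.norm.mul_bdd (c := μ.real univ) iF.norm.aestronglyMeasurable (ae_of_all _ fun ξ => by rw [norm_norm]; exact norm_FF _ ξ)
    refine Integrable.integrableOn ?_
    simpa [sq] using this
  · refine (ae_restrict_iff' measurableSet_ball).2 (ae_of_all _ fun ξ hξ => ?_)
    have : F ξ = ftM μ (R • hypLift d m ξ) := by
      rw [ftM_eq hd]; exact indicator_of_mem hξ _
    simp only [this]
    have hn : ‖ξ‖ < 1 := by simpa using hξ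
    have : Real.sqrt (1 + 4 * ‖ξ‖ ^ 2) ≤ 3 := Real.sqrt_le_iff.2 ⟨by norm_num, by nlinarith [norm_nonneg ξ]⟩
    nlinarith [sq_nonneg ‖ftM μ (R • hypLift d m ξ)‖]
  · rw [integral_const_mul, ofReal_mul (by norm_num)]
    refine mul_le_mul_right ?_ _
    refine (ENNReal.ofReal_le_of_le_toReal (b := ∫⁻ ξ in ball 0 1, ‖F ξ‖ₑ ^ 2) ?_).trans (setLIntegral_le_lintegral _ _)
    rw [integral_eq_lintegral_of_nonneg_ae (ae_of_all _ fun _ => by positivity)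
      ((measurable_FF (MM d m) (continuous_Psi hd _).measurable).norm.pow_const 2).aestronglyMeasurable]
    refine le_of_eq (congrArg _ (lintegral_congr fun ξ => ?_))
    rw [ofReal_pow (norm_nonneg _), ofReal_norm]

theorem final (d m : ℕ) (hd : 3 ≤ d) (hm2 : (m : ℝ) < ((d : ℝ) - 1) / 2)
    (α : ℝ) (hα1 : ((d : ℝ) - 1) / 2 < α)
    (β : ℝ) (hβ : β < α / 2 + (d : ℝ) / 4 - 1 / 2) : decayBound d m α β := by
  have hd0 : 0 < d := by omega
  have hdr : (3 : ℝ) ≤ d := by exact_mod_cast hd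
  have hα : 0 < α := by linarith
  have hm : 2 * m + 1 ≤ d - 1 := by
    have : 2 * m + 1 < d := by
      have : (2 * m + 1 : ℝ) < d := by linarith
      exact_mod_cast this
    omega
  have : Nonempty (Fin (d - 1)) := ⟨⟨0, by omega⟩⟩
  have hcard : ((Fintype.card (Fin (d - 1)) : ℕ) : ℝ) = d - 1 := by
    rw [Fintype.card_fin, Nat.cast_sub (by omega)]; simp
  obtain ⟨D, hD, hL⟩ := lin_all (MM d m) (sg d m) (α := α) (γ := α - β) (fun k => by unfold sg; split_ifs <;> simp)
    (MM_apply d m) hα.le (by linarith) (by rw [hcard]; linarith) (card_sg hm)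
  refine ⟨3 * (8 * Real.pi) ^ α * D, by positivity, ?_⟩
  intro μ hμ hs R hR
  have R0 : 0 < R := by linarith
  have hen : energy α μ = ∫⁻ x, UU α μ x ∂μ := rfl
  by_cases hE : energy α μ = ⊤
  · rw [hE, ENNReal.mul_top (ENNReal.ofReal_pos.2 (by positivity)).ne']; exact le_top
  set κ := R / (2 * Real.pi) with hκ
  have κ0 : 0 < κ := by positivity
  have hae : ∀ᵐ x ∂μ, ‖x‖ ≤ 1 := by
    refine measure_mono_null (t := (closedBall 0 1)ᶜ) (fun x hx h => hx ?_) hs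
    simpa using h
  have hc : ∀ x : EuclideanSpace ℝ (Fin d), ‖x‖ ≤ 1 → ∀ i, |x i| ≤ 1 := fun x hx i =>
    (PiLp.norm_apply_le x i).trans hx
  have kR : κ ≤ R / 2 := by
    rw [hκ]
    refine div_le_div_of_nonneg_left R0.le (by norm_num) ?_
    linarith [Real.pi_gt_three]
  have hb := energy_bound (MM d m) (a := 4 / κ) (B := κ * d) hα hD hR.le (by positivity) (hL R hR.le) (μ := μ)
    (continuous_Psi hd0 κ).measurable (dist_Psi hd0 κ0) ?_ ?_ hE
  · refine (hypAvg_le hd0 m μ R).trans ?_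
    refine (mul_le_mul_right hb _).trans ?_
    rw [← mul_assoc, ← ofReal_mul (by norm_num), hen]
    refine le_of_eq (congrArg (fun t => ofReal t * _) ?_)
    have : 4 / κ = 8 * Real.pi / R := by rw [hκ]; field_simp; norm_num
    rw [this, Real.div_rpow (by positivity) R0.le, Real.rpow_sub R0, Real.rpow_neg R0.le]
    field_simp
  · filter_upwards [hae] with x hx
    simp only [Psi, abs_mul, abs_of_pos κ0]
    nlinarith [hc x hx ⟨d - 1, by omega⟩]
  · filter_upwards [hae] with x hx
    refine max_le ?_ ?_
    · refine (norm_le_card κ0.le fun k => ?_).trans (?_ : (Fintype.card (Fin (d - 1)) : ℝ) * κ ≤ κ * d)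
      · simp only [Psi, abs_mul, abs_of_pos κ0]
        nlinarith [hc x hx ⟨k, by omega⟩]
      · rw [hcard]; nlinarith
    · simp only [Psi, Real.norm_eq_abs, abs_mul, abs_of_pos κ0]
      nlinarith [hc x hx ⟨d - 1, by omega⟩]

end conc
end HP

/-- if `m < (d-1)/2` and `(d-1)/2 < a < d/2 + 1`, then for every
`0 < b < a/2 + d/4 - 1/2` the decay estimate holds. -/
theorem statement3 (d m : ℕ) (hd : 3 ≤ d) (hm1 : 1 ≤ m) (hm2 : (m : ℝ) < ((d : ℝ) - 1) / 2)
    (α : ℝ) (hα1 : ((d : ℝ) - 1) / 2 < α) (hα2 : α < (d : ℝ) / 2 + 1)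
    (β : ℝ) (hβ0 : 0 < β) (hβ : β < α / 2 + (d : ℝ) / 4 - 1 / 2) :
    decayBound d m α β := by
  exact HP.final d m hd hm2 α hα1 β hβ
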